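/- Let ω′ and ω be permutations of [n] with Inv(ω′) ⊆ Inv(ω), and let D(ω′,ω) be the collection of all ω-chamber sets X ⊆ [n] that additionally satisfy: if i < j, ω′(i) > ω′(j) and i ∈ X, then j ∈ X. Then D(ω′,ω) is w-pure, and its w-rank equals |Inv(ω)| − |Inv(ω′)| + n + 1. -/

import Mathlib

open Finset

/-- max of a finite set of naturals, with the convention `max0 ∅ = 0`. -/
def max0 (A : Finset ℕ) : ℕ := if h : A.Nonempty then A.max' h else 0

/-- min of a finite set of naturals, with the convention `min0 ∅ = 0`. -/
def min0 (A : Finset ℕ) : ℕ := if h : A.Nonempty then A.min' h else 0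

/-- `A < B` : global dominating, i.e. `max A < min B` (with `min ∅ = max ∅ = 0`). -/
def SetLT (A B : Finset ℕ) : Prop := max0 A < min0 B

/-- `A ⋖ B` : global dominating after cancelations, i.e. `(A − B) < (B − A)`. -/
def LessDot (A B : Finset ℕ) : Prop := SetLT (A \ B) (B \ A)

/-- `A ▷ B` (splitting): `A − B ≠ ∅` and `B − A` is a union of nonempty subsets
`B′, B″` with `B′ < (A − B) < B″`. -/
def Splits (A B : Finset ℕ) : Prop :=
  (A \ B).Nonempty ∧ ∃ B' B'' : Finset ℕ, B'.Nonempty ∧ B''.Nonempty ∧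
    B' ∪ B'' = B \ A ∧ SetLT B' (A \ B) ∧ SetLT (A \ B) B''

/-- `A` and `B` are strongly separated. -/
def StronglySep (A B : Finset ℕ) : Prop := LessDot A B ∨ LessDot B A ∨ A = B

/-- `A` and `B` are weakly separated. -/
def WeaklySep (A B : Finset ℕ) : Prop :=
  StronglySep A B ∨ (Splits A B ∧ B.card ≤ A.card) ∨ (Splits B A ∧ A.card ≤ B.card)

/-- a w-collection: members are pairwise weakly separated. -/
def IsWColl (F : Finset (Finset ℕ)) : Prop := ∀ A ∈ F, ∀ B ∈ F, WeaklySep A B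

/-- a maximal w-collection in the domain `D`. -/
def IsMaxWColl (D : Set (Finset ℕ)) (F : Finset (Finset ℕ)) : Prop :=
  ↑F ⊆ D ∧ IsWColl F ∧
    ∀ G : Finset (Finset ℕ), ↑G ⊆ D → IsWColl G → F ⊆ G → F = G

/-- the domain `D` is w-pure: all maximal w-collections in `D` have the same cardinality. -/
def WPure (D : Set (Finset ℕ)) : Prop :=
  ∀ F G : Finset (Finset ℕ), IsMaxWColl D F → IsMaxWColl D G → F.card = G.card

/-- an s-collection: members are pairwise strongly separated. -/
def IsSColl (F : Finset (Finset ℕ)) : Prop := ∀ A ∈ F, ∀ B ∈ F, StronglySep A B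

/-- a maximal s-collection in the domain `D`. -/
def IsMaxSColl (D : Set (Finset ℕ)) (F : Finset (Finset ℕ)) : Prop :=
  ↑F ⊆ D ∧ IsSColl F ∧
    ∀ G : Finset (Finset ℕ), ↑G ⊆ D → IsSColl G → F ⊆ G → F = G

/-- the domain `D` is s-pure: all maximal s-collections in `D` have the same cardinality. -/
def SPure (D : Set (Finset ℕ)) : Prop :=
  ∀ F G : Finset (Finset ℕ), IsMaxSColl D F → IsMaxSColl D G → F.card = G.card

/-- the set of inversions of `ω` (as a map `[n] → [n]`). -/
def InvPairs (n : ℕ) (ω : ℕ → ℕ) : Finset (ℕ × ℕ) :=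
  (Finset.Icc 1 n ×ˢ Finset.Icc 1 n).filter fun p => p.1 < p.2 ∧ ω p.2 < ω p.1

/-- the domain `D(ω′,ω)`: all `ω`-chamber sets `X` such that moreover
`i < j`, `ω′(i) > ω′(j)`, `i ∈ X` imply `j ∈ X`. -/
def ChamberDomain2 (n : ℕ) (ω' ω : ℕ → ℕ) : Set (Finset ℕ) :=
  {X | X ⊆ Finset.Icc 1 n ∧
    (∀ i ∈ Finset.Icc 1 n, ∀ j ∈ Finset.Icc 1 n, i < j → ω i < ω j → j ∈ X → i ∈ X) ∧
    (∀ i ∈ Finset.Icc 1 n, ∀ j ∈ Finset.Icc 1 n, i < j → ω' j < ω' i → i ∈ X → j ∈ X)}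

/-- No four elements alternate `A − B, B − A, A − B, B − A`. -/
def NoCross (A B : Finset ℕ) : Prop :=
  ∀ a b a' b', a < b → b < a' → a' < b' → a ∈ A → a ∉ B → b ∈ B → b ∉ A →
    a' ∈ A → a' ∉ B → b' ∈ B → b' ∉ A → False

/-- An alternation `A − B, B − A, A − B` forces `|A| ≤ |B|`. -/
def CardAlt (A B : Finset ℕ) : Prop :=
  ∀ a b a', a < b → b < a' → a ∈ A → a ∉ B → b ∈ B → b ∉ A → a' ∈ A → a' ∉ B → #A ≤ #B

/-- Elementwise form of weak separation. -/
structure WS (A B : Finset ℕ) : Prop where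
  nc : NoCross A B
  nc' : NoCross B A
  alt : CardAlt A B
  alt' : CardAlt B A

/-- Every element of `A − B` lies below every element of `B − A`. -/
def LD (A B : Finset ℕ) : Prop := ∀ a b, a ∈ A → a ∉ B → b ∈ B → b ∉ A → a < b

theorem WS.symm {A B : Finset ℕ} (h : WS A B) : WS B A := ⟨h.2, h.1, h.4, h.3⟩

theorem LD.ws {A B : Finset ℕ} (h : LD A B) : WS A B := by
  refine ⟨?_, ?_, ?_, ?_⟩
  · intro a b a' b' h1 h2 h3 ha ha' hb hb' hc hc' hd hd'
    exact absurd (h a' b hc hc' hb hb') (by omega)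
  · intro a b a' b' h1 h2 h3 ha ha' hb hb' hc hc' hd hd'
    exact absurd (h b a hb hb' ha ha') (by omega)
  · intro a b a' h1 h2 ha ha' hb hb' hc hc'
    exact absurd (h a' b hc hc' hb hb') (by omega)
  · intro a b a' h1 h2 ha ha' hb hb' hc hc'
    exact absurd (h b a hb hb' ha ha') (by omega)

theorem WS.refl (A : Finset ℕ) : WS A A := LD.ws fun _ _ h h' => absurd h h'

theorem setLT_iff {A B : Finset ℕ} :
    SetLT A B ↔ B.Nonempty ∧ 0 ∉ B ∧ ∀ a ∈ A, ∀ b ∈ B, a < b := by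
  unfold SetLT max0 min0
  by_cases hB : B.Nonempty
  · by_cases hA : A.Nonempty
    · simp only [hA, hB, dif_pos, true_and]
      constructor
      · intro h
        refine ⟨fun h0 => ?_, fun a ha b hb => ?_⟩
        · have := B.min'_le 0 h0
          omega
        · have := B.min'_le b hb
          have := A.le_max' a ha
          omega
      · rintro ⟨_, h⟩
        exact h _ (A.max'_mem hA) _ (B.min'_mem hB)
    · simp only [hA, hB, dif_pos, true_and]
      rw [not_nonempty_iff_eq_empty] at hA
      subst hA
      simp only [not_false_eq_true, dif_neg, notMem_empty, false_imp_iff, implies_true, and_true]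
      constructor
      · intro h h0
        have := B.min'_le 0 h0
        omega
      · intro h
        have := B.min'_mem hB
        rcases Nat.eq_zero_or_pos (B.min' hB) with h' | h'
        · rw [h'] at this; exact absurd this h
        · exact h'
  · simp [hB]

theorem weaklySep_iff {A B : Finset ℕ} (hA : 0 ∉ A) (hB : 0 ∉ B) : WeaklySep A B ↔ WS A B := by
  have key : ∀ {A B : Finset ℕ}, 0 ∉ A → 0 ∉ B → Splits A B → #B ≤ #A → WS A B := by
    intro A B hA hB h hc
    obtain ⟨⟨x, hx⟩, B', B'', ⟨y, hy⟩, ⟨z, hz⟩, hU, h1, h2⟩ := h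
    rw [setLT_iff] at h1 h2
    obtain ⟨_, _, h1⟩ := h1
    obtain ⟨_, _, h2⟩ := h2
    have hm : ∀ b, b ∈ B → b ∉ A → b ∈ B' ∨ b ∈ B'' := by
      intro b hb hb'
      rw [← mem_union, hU]; simp [hb, hb']
    have h1' : ∀ a b, b ∈ B' → a ∈ A → a ∉ B → b < a := fun a b hb ha ha' =>
      h1 b hb a (by simp [ha, ha'])
    have h2' : ∀ a b, b ∈ B'' → a ∈ A → a ∉ B → a < b := fun a b hb ha ha' =>
      h2 a (by simp [ha, ha']) b hb
    refine ⟨?_, ?_, ?_, ?_⟩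
    · intro a b a' b' i1 i2 i3 ha ha' hb hb' hc hc' hd hd'
      rcases hm b hb hb' with hm | hm
      · have := h1' a b hm ha ha'; omega
      · have := h2' a' b hm hc hc'; omega
    · intro b a b' a' i1 i2 i3 hb hb' ha ha' hd hd' hc hc'
      rcases hm b' hd hd' with hm | hm
      · have := h1' a b' hm ha ha'; omega
      · have := h2' a' b' hm hc hc'; omega
    · intro a b a' i1 i2 ha ha' hb hb' hc hc'
      rcases hm b hb hb' with hm | hm
      · have := h1' a b hm ha ha'; omega
      · have := h2' a' b hm hc hc'; omega
    · intro _ _ _ _ _ _ _ _ _ _ _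
      exact hc
  have dot : ∀ {A B : Finset ℕ}, LessDot A B → LD A B := by
    intro A B h a b ha ha' hb hb'
    exact (setLT_iff.1 h).2.2 a (by simp [ha, ha']) b (by simp [hb, hb'])
  have key2 : ∀ {A B : Finset ℕ}, 0 ∉ A → 0 ∉ B → WS A B → (∃ a b a', a < b ∧ b < a' ∧ a ∈ A \ B ∧
      b ∈ B \ A ∧ a' ∈ A \ B) → Splits B A ∧ #A ≤ #B := by
    rintro A B hA hB h ⟨a, b, a', i1, i2, ha, hb, hc⟩
    have ha0 := ha
    have hb0 := hb
    have hc0 := hc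
    simp only [mem_sdiff] at ha hb hc
    refine ⟨⟨⟨b, by simp [hb]⟩, (A \ B).filter (· < b), (A \ B).filter (b < ·), ⟨a, by simp [ha, i1]⟩,
      ⟨a', by simp [hc, i2]⟩, ?_, ?_, ?_⟩, h.alt a b a' i1 i2 ha.1 ha.2 hb.1 hb.2 hc.1 hc.2⟩
    · ext x
      simp only [mem_union, mem_filter]
      constructor
      · rintro (h | h) <;> exact h.1
      · intro hx
        have : x ≠ b := by
          rintro rfl; simp only [mem_sdiff] at hx; exact hx.2 hb.1
        rcases lt_or_gt_of_ne this with h | h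
        · exact Or.inl ⟨hx, h⟩
        · exact Or.inr ⟨hx, h⟩
    · rw [setLT_iff]
      refine ⟨⟨b, by simp [hb]⟩, by simp [hB], ?_⟩
      intro x hx y hy
      simp only [mem_filter, mem_sdiff] at hx hy
      by_contra hlt
      have hne : x ≠ y := by rintro rfl; exact hy.2 hx.1.1
      exact h.nc' y x b a' (by omega) hx.2 i2 hy.1 hy.2 hx.1.1 hx.1.2 hb.1 hb.2 hc.1 hc.2
    · rw [setLT_iff]
      refine ⟨⟨a', by simp [hc, i2]⟩, by simp [hA], ?_⟩
      intro y hy x hx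
      simp only [mem_filter, mem_sdiff] at hx hy
      by_contra hlt
      have hne : x ≠ y := by rintro rfl; exact hy.2 hx.1.1
      exact h.nc a b x y i1 hx.2 (by omega) ha.1 ha.2 hb.1 hb.2 hx.1.1 hx.1.2 hy.1 hy.2
  constructor
  · rintro ((h | h | h) | ⟨h, hc⟩ | ⟨h, hc⟩)
    · exact (dot h).ws
    · exact (dot h).ws.symm
    · subst h; exact WS.refl _
    · exact key hA hB h hc
    · exact (key hB hA h hc).symm
  · intro h
    by_cases h1 : ∃ a b a', a < b ∧ b < a' ∧ a ∈ A \ B ∧ b ∈ B \ A ∧ a' ∈ A \ B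
    · exact Or.inr (Or.inr (key2 hA hB h h1))
    by_cases h2 : ∃ a b a', a < b ∧ b < a' ∧ a ∈ B \ A ∧ b ∈ A \ B ∧ a' ∈ B \ A
    · exact Or.inr (Or.inl (key2 hB hA h.symm h2))
    refine Or.inl ?_
    by_cases hAB : A = B
    · exact Or.inr (Or.inr hAB)
    have mk : ∀ {A B : Finset ℕ}, 0 ∉ B → (B \ A).Nonempty → LD A B → LessDot A B := by
      intro A B hB hne h
      refine setLT_iff.2 ⟨hne, by simp [hB], ?_⟩
      intro a ha b hb
      simp only [mem_sdiff] at ha hb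
      exact h a b ha.1 ha.2 hb.1 hb.2
    rcases (A \ B).eq_empty_or_nonempty with hA' | ⟨x, hx⟩
    · refine Or.inl (mk hB ?_ ?_)
      · by_contra hB'
        rw [not_nonempty_iff_eq_empty] at hB'
        exact hAB (Subset.antisymm (sdiff_eq_empty_iff_subset.1 hA') (sdiff_eq_empty_iff_subset.1 hB'))
      · intro a b ha ha'
        have : a ∈ A \ B := by simp [ha, ha']
        simp [hA'] at this
    rcases (B \ A).eq_empty_or_nonempty with hB' | ⟨y, hy⟩
    · refine Or.inr (Or.inl (mk hA ⟨x, hx⟩ ?_))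
      intro a b ha ha'
      have : a ∈ B \ A := by simp [ha, ha']
      simp [hB'] at this
    have ne : ∀ u v, u ∈ A \ B → v ∈ B \ A → u ≠ v := by
      rintro u v hu hv rfl
      simp only [mem_sdiff] at hu hv
      exact hu.2 hv.1
    by_cases hlt : x < y
    · refine Or.inl (mk hB ⟨y, hy⟩ ?_)
      intro a b ha ha' hb hb'
      have ha : a ∈ A \ B := by simp [ha, ha']
      have hb : b ∈ B \ A := by simp [hb, hb']
      by_contra hab
      have := ne a b ha hb
      have := ne x b hx hb
      have := ne a y ha hy
      push Not at h1 h2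
      by_cases hxb : x < b
      · exact h1 x b a hxb (by omega) hx hb ha
      · exact h2 b x y (by omega) hlt hb hx hy
    · refine Or.inr (Or.inl (mk hA ⟨x, hx⟩ ?_))
      intro b a hb hb' ha ha'
      have ha : a ∈ A \ B := by simp [ha, ha']
      have hb : b ∈ B \ A := by simp [hb, hb']
      by_contra hab
      have := ne a b ha hb
      have := ne x b hx hb
      have := ne a y ha hy
      have := ne x y hx hy
      push Not at h1 h2
      by_cases hxb : x < b
      · exact h2 y x b (by omega) (by omega) hy hx hb
      · exact h1 a b x (by omega) (by omega) ha hb hx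

/-- The precedence relation: size does not drop and `A ⋖ B`. -/
def Pre (A B : Finset ℕ) : Prop := #A ≤ #B ∧ LD A B

theorem Pre.refl (A : Finset ℕ) : Pre A A := ⟨le_rfl, fun _ _ h h' => absurd h h'⟩

theorem Pre.ws {A B : Finset ℕ} (h : Pre A B) : WS A B := h.2.ws

theorem exists_mem_notMem_of_card {A B : Finset ℕ} (h : #A ≤ #B) (hne : A ≠ B) :
    ∃ x ∈ B, x ∉ A := by
  by_contra! hc
  exact hne (eq_of_subset_of_card_le (fun x hx => hc x hx) h).symm

theorem LD.antisymm {A B : Finset ℕ} (hc : #A = #B) (h : LD A B) (h' : LD B A) : A = B := by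
  by_contra hne
  obtain ⟨x, hx, hx'⟩ := exists_mem_notMem_of_card hc.le hne
  obtain ⟨y, hy, hy'⟩ := exists_mem_notMem_of_card hc.ge (Ne.symm hne)
  have := h y x hy hy' hx hx'
  have := h' x y hx hx' hy hy'
  omega

theorem Pre.antisymm {A B : Finset ℕ} (h : Pre A B) (h' : Pre B A) : A = B :=
  h.2.antisymm (le_antisymm h.1 h'.1) h'.2

/-- The equal-size padding of a subset of `[n]`, read from the top. -/
def pad (n : ℕ) (A : Finset ℕ) : Finset ℕ := A.image (n - ·) ∪ Ico n (2 * n - #A)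

theorem mem_pad {n y : ℕ} {A : Finset ℕ} (hA : A ⊆ Icc 1 n) :
    y ∈ pad n A ↔ (y < n ∧ n - y ∈ A) ∨ (n ≤ y ∧ y < 2 * n - #A) := by
  unfold pad
  simp only [mem_union, mem_image, mem_Ico]
  constructor
  · rintro (⟨a, ha, rfl⟩ | h)
    · have := mem_Icc.1 (hA ha)
      refine Or.inl ⟨by omega, ?_⟩
      rwa [show n - (n - a) = a by omega]
    · exact Or.inr h
  · rintro (⟨h, h'⟩ | h)
    · exact Or.inl ⟨_, h', by omega⟩
    · exact Or.inr h

theorem card_le_of_subset_Icc {n : ℕ} {A : Finset ℕ} (hA : A ⊆ Icc 1 n) : #A ≤ n := by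
  simpa using card_le_card hA

theorem card_pad {n : ℕ} {A : Finset ℕ} (hA : A ⊆ Icc 1 n) : #(pad n A) = n := by
  unfold pad
  have := card_le_of_subset_Icc hA
  rw [card_union_of_disjoint, card_image_of_injOn, Nat.card_Ico]
  · omega
  · intro a ha b hb h
    have := mem_Icc.1 (hA ha)
    have := mem_Icc.1 (hA hb)
    simp only at h
    omega
  · rw [disjoint_left]
    intro x hx hx'
    simp only [mem_image, mem_Ico] at hx hx'
    obtain ⟨a, ha, rfl⟩ := hx
    have := mem_Icc.1 (hA ha)
    omega

theorem sub_mem_pad {n x : ℕ} {A : Finset ℕ} (hA : A ⊆ Icc 1 n) (h1 : 1 ≤ x) (hn : x ≤ n) :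
    n - x ∈ pad n A ↔ x ∈ A := by
  rw [mem_pad hA, show n - (n - x) = x by omega]
  constructor
  · rintro (h | h)
    · exact h.2
    · omega
  · exact fun h => Or.inl ⟨by omega, h⟩

theorem WS.noCross_pad {n : ℕ} {A B : Finset ℕ} (hA : A ⊆ Icc 1 n) (hB : B ⊆ Icc 1 n)
    (h : WS A B) : NoCross (pad n A) (pad n B) := by
  intro a b a' b' h1 h2 h3 ha ha' hb hb' hc hc' hd hd'
  rw [mem_pad hA] at *
  rw [mem_pad hB] at *
  have e1 := h.alt (n - a') (n - b) (n - a)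
  have e2 := h.nc' (n - b') (n - a') (n - b) (n - a)
  grind

theorem ws_of_noCross_pad {n : ℕ} {A B : Finset ℕ} (hA : A ⊆ Icc 1 n) (hB : B ⊆ Icc 1 n)
    (h : NoCross (pad n A) (pad n B)) (h' : NoCross (pad n B) (pad n A)) : WS A B := by
  have key : ∀ {A B : Finset ℕ}, A ⊆ Icc 1 n → B ⊆ Icc 1 n → NoCross (pad n A) (pad n B) →
      NoCross (pad n B) (pad n A) → NoCross A B ∧ CardAlt A B := by
    clear h h' hA hB A B
    intro A B hA hB h h'
    have m : ∀ x ∈ A ∪ B, 1 ≤ x ∧ x ≤ n := fun x hx => mem_Icc.1 (union_subset hA hB hx)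
    constructor
    · intro a b a' b' h1 h2 h3 ha ha' hb hb' hc hc' hd hd'
      obtain ⟨a1, an⟩ := m a (by simp [ha])
      obtain ⟨b1, bn⟩ := m b (by simp [hb])
      obtain ⟨c1, cn⟩ := m a' (by simp [hc])
      obtain ⟨d1, dn⟩ := m b' (by simp [hd])
      refine h' (n - b') (n - a') (n - b) (n - a) (by omega) (by omega) (by omega) ?_ ?_ ?_ ?_ ?_ ?_ ?_ ?_ <;>
        simp only [sub_mem_pad, *, not_false_eq_true]
    · intro a b a' h1 h2 ha ha' hb hb' hc hc'
      obtain ⟨a1, an⟩ := m a (by simp [ha])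
      obtain ⟨b1, bn⟩ := m b (by simp [hb])
      obtain ⟨c1, cn⟩ := m a' (by simp [hc])
      have e1 := card_le_of_subset_Icc hA
      have e2 := card_le_of_subset_Icc hB
      by_contra hlt
      refine h (n - a') (n - b) (n - a) (2 * n - #A) (by omega) (by omega) (by omega)
        ?_ ?_ ?_ ?_ ?_ ?_ ?_ ?_
      iterate 6 simp only [sub_mem_pad, *, not_false_eq_true]
      · rw [mem_pad hB]; omega
      · rw [mem_pad hA]; omega
  exact ⟨(key hA hB h h').1, (key hB hA h' h).1, (key hA hB h h').2, (key hB hA h' h).2⟩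

theorem Pre.pad {n : ℕ} {A B : Finset ℕ} (hA : A ⊆ Icc 1 n) (hB : B ⊆ Icc 1 n) (h : Pre A B) :
    LD (pad n B) (pad n A) := by
  intro b a hb hb' ha ha'
  rw [mem_pad hA] at *
  rw [mem_pad hB] at *
  have := h.1
  have := h.2 (n - a) (n - b)
  grind

theorem pre_of_pad {n : ℕ} {A B : Finset ℕ} (hA : A ⊆ Icc 1 n) (hB : B ⊆ Icc 1 n)
    (h : LD (_root_.pad n B) (_root_.pad n A)) : Pre A B := by
  have m : ∀ x ∈ A ∪ B, 1 ≤ x ∧ x ≤ n := fun x hx => mem_Icc.1 (union_subset hA hB hx)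
  constructor
  · by_contra hc
    have hne : _root_.pad n B ≠ _root_.pad n A := by
      intro he
      have h1 := mem_pad (y := 2 * n - #A) hA
      have h2 := mem_pad (y := 2 * n - #A) hB
      have := card_le_of_subset_Icc hA
      rw [he, h1] at h2
      omega
    obtain ⟨x, hx, hx'⟩ := exists_mem_notMem_of_card (by rw [card_pad hA, card_pad hB]) hne
    have := h (2 * n - #A) x
    have := card_le_of_subset_Icc hA
    simp only [mem_pad hA, mem_pad hB] at *
    grind
  · intro a b ha ha' hb hb'
    obtain ⟨a1, an⟩ := m a (by simp [ha])
    obtain ⟨b1, bn⟩ := m b (by simp [hb])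
    have := h (n - b) (n - a) (by simp only [sub_mem_pad, *])
      (by simp only [sub_mem_pad, *, not_false_eq_true]) (by simp only [sub_mem_pad, *])
      (by simp only [sub_mem_pad, *, not_false_eq_true])
    omega

/-- Transitivity of `⋖` for equal-size sets whose ends do not cross. -/
theorem LD.trans_of_noCross {A B C : Finset ℕ} (hAB : #A = #B) (hBC : #B = #C) (h : LD A B)
    (h' : LD B C) (n1 : NoCross A C) : LD A C := by
  intro x y hx hx' hy hy'
  by_contra hlt
  have hne : x ≠ y := by rintro rfl; exact hx' hy
  by_cases hxB : x ∈ B <;> by_cases hyB : y ∈ B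
  · obtain ⟨w, hw, hw'⟩ := exists_mem_notMem_of_card hAB.ge (by rintro rfl; exact hy' hyB)
    obtain ⟨z, hz, hz'⟩ := exists_mem_notMem_of_card hBC.le (by rintro rfl; exact hx' hxB)
    have i1 := h w y hw hw' hyB hy'
    have i2 := h' x z hxB hx' hz hz'
    have hwC : w ∉ C := fun hc => by have := h' x w hxB hx' hc hw'; omega
    have hzA : z ∉ A := fun hc => by have := h z y hc hz' hyB hy'; omega
    exact n1 w y x z i1 (by omega) i2 hw hwC hy hy' hx hx' hz hzA
  · exact hlt (h' x y hxB hx' hy hyB)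
  · exact hlt (h x y hx hxB hyB hy')
  · obtain ⟨w, hw, hw'⟩ := exists_mem_notMem_of_card hBC.ge (by rintro rfl; exact hyB hy)
    obtain ⟨z, hz, hz'⟩ := exists_mem_notMem_of_card hAB.le (by rintro rfl; exact hxB hx)
    have i1 := h' w y hw hw' hy hyB
    have i2 := h x z hx hxB hz hz'
    have hwA : w ∈ A := by
      by_contra hc
      have := h x w hx hxB hw hc
      omega
    have hzC : z ∈ C := by
      by_contra hc
      have := h' z y hz hc hy hyB
      omega
    exact n1 w y x z i1 (by omega) i2 hwA hw' hy hy' hx hx' hzC hz'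

theorem Pre.trans {n : ℕ} {A B C : Finset ℕ} (hA : A ⊆ Icc 1 n) (hB : B ⊆ Icc 1 n)
    (hC : C ⊆ Icc 1 n) (h : Pre A B) (h' : Pre B C) (hw : WS A C) : Pre A C := by
  apply pre_of_pad hA hC
  refine LD.trans_of_noCross ?_ ?_ (h'.pad hB hC) (h.pad hA hB) (hw.symm.noCross_pad hC hA)
  · rw [card_pad hC, card_pad hB]
  · rw [card_pad hA, card_pad hB]

section InsertNoCross

/-- `T` blocks `c` from the right, relative to `S ∪ {0}` and `S ∪ {a}`. -/
def RightBlock (S : Finset ℕ) (a c : ℕ) (T : Finset ℕ) : Prop :=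
  c ∉ T ∧ ∃ s y z, (s = 0 ∨ s ∈ S) ∧ s ∉ T ∧ s < y ∧ y ∈ T ∧ y ∉ S ∧ y < c ∧ c < z ∧ z ≤ a ∧
    z ∈ T ∧ z ∉ S

/-- `T` blocks `c` from the left, relative to `S ∪ {0}` and `S ∪ {a}`. -/
def LeftBlock (S : Finset ℕ) (a c : ℕ) (T : Finset ℕ) : Prop :=
  c ∉ T ∧ 0 ∈ T ∧ ∃ z t, c < z ∧ z < t ∧ t ≤ a ∧ z ∈ T ∧ z ∉ S ∧ (t = a ∨ t ∈ S) ∧ t ∉ T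

variable {𝓕 : Finset (Finset ℕ)} {S : Finset ℕ} {a : ℕ}

theorem block_of_cross {c : ℕ} {T : Finset ℕ} (hS : ∀ x ∈ S, 0 < x ∧ x < a)
    (N0 : NoCross (insert 0 S) T) (Na : NoCross (insert a S) T) (Na' : NoCross T (insert a S))
    (h0c : 0 < c) (hca : c < a) (hR : ¬ RightBlock S a c T) (hL : ¬ LeftBlock S a c T) :
    NoCross (insert c S) T ∧ NoCross T (insert c S) := by
  have haS : a ∉ S := fun h => absurd (hS a h).2 (lt_irrefl a)
  constructor
  · intro s y s' y' h1 h2 h3 hs hs' hy hy' ht ht' hz hz'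
    rw [mem_insert] at hs hy' ht hz'
    push Not at hy' hz'
    rcases hs with rfl | hs
    · have ht : s' ∈ S := by
        rcases ht with rfl | ht
        · omega
        · exact ht
      refine hL ⟨hs', ?_, y, s', h1, h2, (hS _ ht).2.le, hy, hy'.2, Or.inr ht, ht'⟩
      by_contra h0
      exact N0 0 y s' y' (by omega) h2 h3 (by simp) h0 hy (by simp [hy'.2]; omega) (by simp [ht]) ht' hz
        (by simp [hz'.2]; omega)
    · rcases ht with rfl | ht
      · have hza : a ∈ T ∨ y' < a := by
          by_contra! hcon
          have : y' ≠ a := by rintro rfl; exact hcon.1 hz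
          exact Na s y a y' h1 (by omega) (by omega) (by simp [hs]) hs' hy
            (by simp [hy'.2]; omega) (by simp) hcon.1 hz (by simp [hz'.2]; omega)
        rcases hza with hza | hza
        · exact hR ⟨ht', s, y, a, Or.inr hs, hs', h1, hy, hy'.2, h2, hca, le_rfl, hza, haS⟩
        · exact hR ⟨ht', s, y, y', Or.inr hs, hs', h1, hy, hy'.2, h2, h3, hza.le, hz, hz'.2⟩
      · exact N0 s y s' y' h1 h2 h3 (by simp [hs]) hs' hy (by simp [hy'.2]; omega)
          (by simp [ht]) ht' hz (by simp [hz'.2]; omega)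
  · intro y s y' s' h1 h2 h3 hy hy' hs hs' hz hz' ht ht'
    rw [mem_insert] at hs hy' ht hz'
    push Not at hy' hz'
    rcases hs with rfl | hs
    · have ht : s' ∈ S := by
        rcases ht with rfl | ht
        · omega
        · exact ht
      have := hS _ ht
      by_cases h0 : 0 ∈ T
      · exact hL ⟨hs', h0, y', s', h2, h3, this.2.le, hz, hz'.2, Or.inr ht, ht'⟩
      · have : y ≠ 0 := by rintro rfl; exact h0 hy
        exact hR ⟨hs', 0, y, y', Or.inl rfl, h0, by omega, hy, hy'.2, h1, h2, by omega, hz, hz'.2⟩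
    · rcases ht with rfl | ht
      · have hza : a ∈ T := by
          by_contra hcon
          exact Na' y s y' a h1 h2 (by omega) hy (by simp [hy'.2]; omega) (by simp [hs]) hs' hz
            (by simp [hz'.2]; omega) (by simp) hcon
        exact hR ⟨ht', s, y', a, Or.inr hs, hs', h2, hz, hz'.2, h3, hca, le_rfl, hza, haS⟩
      · have := hS _ ht
        exact Na' y s y' s' h1 h2 h3 hy (by simp [hy'.2]; omega) (by simp [hs]) hs' hz
          (by simp [hz'.2]; omega) (by simp [ht]) ht'

/-- Candidates between a blocked position and a missing element of `S ∪ {a}`. -/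
def Cand (S : Finset ℕ) (a c : ℕ) (X : Finset ℕ) (q : ℕ) : Prop :=
  q ∈ X ∧ q ∉ S ∧ c < q ∧ ∃ t, (t = a ∨ t ∈ S) ∧ t ∉ X ∧ q < t

/-- A set of `𝓕` that witnesses a downward link from `X`. -/
def DownLink (𝓕 : Finset (Finset ℕ)) (S : Finset ℕ) (a c : ℕ) (X : Finset ℕ)
    (g q : ℕ) : Prop :=
  Cand S a c X g ∧ g < q ∧ ∃ T ∈ 𝓕, ∃ s, (s = 0 ∨ s ∈ S) ∧ s ∉ T ∧ s < g ∧ g ∈ T ∧ q ∉ T ∧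
    (∀ w, g < w → w < q → w ∈ T → w ∈ S) ∧ (∀ w, s < w → w < q → w ∈ T → w ∈ X)

/-- A set of `𝓕` that witnesses an upward link from `X`. -/
def UpLink (𝓕 : Finset (Finset ℕ)) (S : Finset ℕ) (a c : ℕ) (X : Finset ℕ)
    (q v : ℕ) : Prop :=
  Cand S a c X v ∧ q < v ∧ ∃ T ∈ 𝓕, ∃ s, (s = 0 ∨ s ∈ S) ∧ s ∉ T ∧ v ∈ T ∧
    (∀ w, q ≤ w → w < v → w ∈ T → w ∈ S) ∧ (∃ b ∈ T, b ∉ X) ∧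
    (∀ b ∈ T, b ∉ X → s < b ∧ b < q)

theorem link_exists {c q : ℕ} {X : Finset ℕ} (hS : ∀ x ∈ S, 0 < x ∧ x < a)
    (hX : X ∈ 𝓕) (hnc : ∀ T ∈ 𝓕, ∀ T' ∈ 𝓕, NoCross T T') (h0 : insert 0 S ∈ 𝓕)
    (ha : insert a S ∈ 𝓕) (h0c : 0 < c) (hcX : c ∉ X) (h0X : 0 ∈ X)
    (hcR : ∀ T ∈ 𝓕, ¬ RightBlock S a c T) (hq : Cand S a c X q)
    (hqR : ∃ T ∈ 𝓕, RightBlock S a q T) :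
    (∃ g, DownLink 𝓕 S a c X g q) ∨ ∃ v, UpLink 𝓕 S a c X q v := by
  obtain ⟨hqX, hqS, hcq, t, ht, htX, hqt⟩ := hq
  obtain ⟨T, hT, hqT, s, y, z, hs, hsT, hsy, hyT, hyS, hyq, hqz, hza, hzT, hzS⟩ := hqR
  have claimA : ∀ s ∈ S, s < q → s ∈ X := by
    intro s hs hsq
    by_contra hsX
    have := hS s hs
    exact hnc X hX _ ha 0 s q t (by omega) hsq hqt h0X
      (by simp; exact ⟨by omega, fun h => absurd (hS 0 h).1 (by omega)⟩) (by simp [hs]) hsX hqX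
      (by simp [hqS]; rcases ht with rfl | ht
          · omega
          · have := hS t ht; omega) (by simpa using ht) htX
  have hsX : s ∈ X := by
    rcases hs with rfl | hs
    · exact h0X
    · exact claimA s hs (by omega)
  have hs0 : s ∈ insert 0 S := by simpa using hs
  have hy0 : y ∉ insert 0 S := by simp [hyS]; omega
  by_cases hI : ∀ w, s < w → w < q → w ∈ T → w ∈ X
  · left
    have hcy : c < y := by
      by_contra hcy
      have hyX := hI y hsy hyq hyT
      have : y ≠ c := by rintro rfl; exact hcX hyX
      refine hcR T hT ⟨fun h => hcX (hI c (by omega) hcq h), s, y, z, hs, hsT, hsy, hyT, hyS,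
        by omega, by omega, hza, hzT, hzS⟩
    obtain ⟨g, hg, hmax⟩ := exists_max_image (T.filter fun w => w ∉ S ∧ s < w ∧ w < q) id
      ⟨y, by simp [*]⟩
    simp only [mem_filter, id] at hg hmax
    have hyg := hmax y ⟨hyT, hyS, hsy, hyq⟩
    refine ⟨g, ⟨hI g (by omega) hg.2.2.2 hg.1, hg.2.1, by omega, t, ht, htX, by omega⟩, hg.2.2.2,
      T, hT, s, hs, hsT, by omega, hg.1, hqT, ?_, hI⟩
    intro w h1 h2 hw
    by_contra hwS
    have := hmax w ⟨hw, hwS, by omega, h2⟩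
    omega
  · right
    push Not at hI
    obtain ⟨x0, h1, h2, hx0, hx0X⟩ := hI
    have hTX : ∀ b ∈ T, b ∉ X → s < b ∧ b < q := by
      intro b hb hbX
      have : b ≠ s := by rintro rfl; exact hsT hb
      have : b ≠ q := by rintro rfl; exact hqT hb
      constructor
      · by_contra hlt
        exact hnc T hT X hX b s x0 q (by omega) h1 h2 hb hbX hsX hsT hx0 hx0X hqX hqT
      · by_contra hlt
        exact hnc X hX T hT s x0 q b h1 h2 (by omega) hsX hsT hx0 hx0X hqX hqT hb hbX
    have hcr : ∀ t' ∈ S, q < t' → t' ∉ X → ∀ w ∈ T, w ∉ S → t' < w → False := by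
      intro t' ht' hqt' ht'X w hw hwS hlt
      have ht'T : t' ∉ T := fun h => by have := hTX t' h ht'X; omega
      exact hnc _ h0 T hT s y t' w hsy (by omega) hlt hs0 hsT hyT hy0 (by simp [ht']) ht'T hw
        (by simp [hwS]; omega)
    have hzX : z ∈ X := by
      by_contra h
      have := hTX z hzT h
      omega
    have hza' : z < a := by
      by_contra hcon
      obtain rfl : z = a := by omega
      have ht : t ∈ S := by
        rcases ht with rfl | ht
        · exact absurd hzX htX
        · exact ht
      exact hcr t ht hqt htX z hzT hzS (hS t ht).2
    obtain ⟨v, hv, hmin⟩ := exists_min_image (T.filter fun w => w ∉ S ∧ q < w) id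
      ⟨z, by simp [*]⟩
    simp only [mem_filter, id] at hv hmin
    have hvz := hmin z ⟨hzT, hzS, hqz⟩
    have hvX : v ∈ X := by
      by_contra h
      have := hTX v hv.1 h
      omega
    refine ⟨v, ⟨hvX, hv.2.1, by omega, t, ht, htX, ?_⟩, hv.2.2, T, hT, s, hs, hsT, hv.1, ?_,
      ⟨x0, hx0, hx0X⟩, hTX⟩
    · by_contra hlt
      have : t ≠ v := by rintro rfl; exact htX hvX
      have ht : t ∈ S := by
        rcases ht with rfl | ht
        · omega
        · exact ht
      exact hcr t ht hqt htX v hv.1 hv.2.1 (by omega)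
    · intro w h1 h2 hw
      by_contra hwS
      have : w ≠ q := by rintro rfl; exact hqT hw
      have := hmin w ⟨hw, hwS, by omega⟩
      omega

theorem link_no_conflict {c g h u v m : ℕ} {X : Finset ℕ} (hS : ∀ x ∈ S, 0 < x ∧ x < a)
    (hX : X ∈ 𝓕) (hcard : ∀ T ∈ 𝓕, #T = m) (hnc : ∀ T ∈ 𝓕, ∀ T' ∈ 𝓕, NoCross T T')
    (h0 : insert 0 S ∈ 𝓕) (ha : insert a S ∈ 𝓕) (h0X : 0 ∈ X)
    (hI : DownLink 𝓕 S a c X g h) (hII : UpLink 𝓕 S a c X u v) (hug : u ≤ g) (hgv : g < v)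
    (hvh : v ≤ h) : False := by
  obtain ⟨⟨hgX, hgS, hcg, t, ht, htX, hgt⟩, hgh, T', hT', s', hs', hs'T', hs'g, hgT', hhT', hgap',
    hTX'⟩ := hI
  obtain ⟨⟨hvX, hvS, -⟩, huv, T, hT, s, hs, hsT, hvT, hgap, ⟨b, hb, hbX⟩, hTX⟩ := hII
  have claimA : ∀ s ∈ S, s < g → s ∈ X := by
    intro s hs hsq
    by_contra hsX
    have := hS s hs
    exact hnc X hX _ ha 0 s g t (by omega) hsq hgt h0X
      (by simp; exact ⟨by omega, fun h => absurd (hS 0 h).1 (by omega)⟩) (by simp [hs]) hsX hgX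
      (by simp [hgS]; rcases ht with rfl | ht
          · omega
          · have := hS t ht; omega) (by simpa using ht) htX
  have hgT : g ∉ T := fun hgT => hgS (hgap g hug hgv hgT)
  have hvT' : v ∉ T' := by
    intro hvT'
    have : v ≠ h := by rintro rfl; exact hhT' hvT'
    exact hvS (hgap' v hgv (by omega) hvT')
  have hs0 : s ∈ insert 0 S := by simpa using hs
  have hbS : ∀ b ∈ T, b ∉ X → b ∉ S := fun b hb hbX hbS =>
    hbX (claimA b hbS (by have := hTX b hb hbX; omega))
  have hs'T : ∀ b ∈ T, b ∉ X → b < s' → s' ∈ T := by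
    intro b hb hbX hbs'
    by_contra hs'T
    have h1 := hTX b hb hbX
    have := hbS b hb hbX
    exact hnc _ h0 T hT s b s' v h1.1 hbs' (by omega) hs0 hsT hb (by simp [this]; omega)
      (by simpa using hs') hs'T hvT (by simp [hvS]; omega)
  have hi : ∀ b ∈ T, b ∉ X → b ∉ T' := by
    intro b hb hbX hbT'
    have h1 := hTX b hb hbX
    have : b ≠ s' := by rintro rfl; exact hs'T' hbT'
    have hbs' : b < s' := by
      by_contra hlt
      exact hbX (hTX' b (by omega) (by omega) hbT')
    have h2 := hs'T b hb hbX hbs'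
    by_cases hsT' : s ∈ T'
    · exact hnc T' hT' T hT s s' g v (by omega) hs'g hgv hsT' hsT h2 hs'T' hgT' hgT hvT hvT'
    · exact hnc _ h0 T' hT' s b s' g h1.1 hbs' hs'g hs0 hsT' hbT'
        (by simp [hbS b hb hbX]; omega) (by simpa using hs') hs'T' hgT' (by simp [hgS]; omega)
  have hii : ∀ w ∈ T', w ∉ T → w ∈ X := by
    intro w hw hwT
    by_contra hwX
    have hbT' := hi b hb hbX
    have h1 := hTX b hb hbX
    have : w ≠ b := by rintro rfl; exact hwT hb
    have : w ≠ v := by rintro rfl; exact hwT hvT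
    have hbw : b < w := by
      by_contra hlt
      exact hnc T' hT' T hT w b g v (by omega) (by omega) hgv hw hwT hb hbT' hgT' hgT hvT hvT'
    have hwv : w < v := by
      by_contra hlt
      exact hnc T hT T' hT' b g v w (by omega) hgv (by omega) hb hbT' hgT' hgT hvT hvT' hw hwT
    have : w ≠ s' := by rintro rfl; exact hs'T' hw
    have hws' : w < s' := by
      by_contra hlt
      exact hwX (hTX' w (by omega) (by omega) hw)
    have h2 := hs'T b hb hbX (by omega)
    exact hnc T' hT' T hT w s' g v hws' hs'g hgv hw hwT h2 hs'T' hgT' hgT hvT hvT'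
  have e1 : #(T' \ T) ≤ #(X \ T) := card_le_card fun w hw => by
    simp only [mem_sdiff] at hw ⊢
    exact ⟨hii w hw.1 hw.2, hw.2⟩
  have e2 : #(X \ T) = #(T \ X) := card_sdiff_comm (by rw [hcard X hX, hcard T hT])
  have e3 : #(T' \ T) = #(T \ T') := card_sdiff_comm (by rw [hcard T' hT', hcard T hT])
  have e4 : #(T \ X) < #(T \ T') := card_lt_card <| by
    rw [ssubset_iff_of_subset]
    · exact ⟨v, by simp [hvT, hvT'], by simp [hvX]⟩
    · intro w hw
      simp only [mem_sdiff] at hw ⊢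
      exact ⟨hw.1, hi w hw.1 hw.2⟩
  omega

/-- In an equal-size non-crossing family containing `S ∪ {0}` and `S ∪ {a}`, some `S ∪ {c}` with
`0 < c < a` crosses no member, as soon as `S` misses an element between `0` and `a`. -/
theorem exists_insert_noCross {m : ℕ} (hcard : ∀ T ∈ 𝓕, #T = m)
    (hnc : ∀ T ∈ 𝓕, ∀ T' ∈ 𝓕, NoCross T T') (hS : ∀ x ∈ S, 0 < x ∧ x < a)
    (h0 : insert 0 S ∈ 𝓕) (ha : insert a S ∈ 𝓕) (hne : ∃ c, 0 < c ∧ c < a ∧ c ∉ S) :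
    ∃ c, 0 < c ∧ c < a ∧ c ∉ S ∧
      ∀ T ∈ 𝓕, NoCross (insert c S) T ∧ NoCross T (insert c S) := by
  classical
  have hfirst : ∃ c, 0 < c ∧ c < a ∧ c ∉ S ∧ ∀ T ∈ 𝓕, ¬ RightBlock S a c T := by
    refine ⟨Nat.find hne, (Nat.find_spec hne).1, (Nat.find_spec hne).2.1, (Nat.find_spec hne).2.2,
      ?_⟩
    rintro T hT ⟨-, s, y, z, hs, hsT, hsy, hyT, hyS, hyq, -⟩
    have := (Nat.find_spec hne).2.1
    exact Nat.find_min hne hyq ⟨by omega, by omega, hyS⟩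
  obtain ⟨c, hc, hmax⟩ := exists_max_image ((range a).filter fun c => 0 < c ∧ c ∉ S ∧
    ∀ T ∈ 𝓕, ¬ RightBlock S a c T) id (by
      obtain ⟨c, h1, h2, h3, h4⟩ := hfirst
      exact ⟨c, by simp only [mem_filter, mem_range]; exact ⟨h2, h1, h3, h4⟩⟩)
  simp only [mem_filter, mem_range, id] at hc hmax
  obtain ⟨hca, h0c, hcS, hcR⟩ := hc
  refine ⟨c, h0c, hca, hcS, fun X hX => block_of_cross hS (hnc _ h0 X hX) (hnc _ ha X hX)
    (hnc X hX _ ha) h0c hca (hcR X hX) ?_⟩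
  rintro ⟨hcX, h0X, z, t, hcz, hzt, hta, hzX, hzS, ht, htX⟩
  have hlt : ∀ q, Cand S a c X q → q < a := by
    rintro q ⟨-, -, -, t, ht | ht, -, hqt⟩
    · omega
    · have := hS t ht
      omega
  obtain ⟨M, hM, hMmax⟩ := exists_max_image (X.filter fun q => Cand S a c X q) id
    ⟨z, by simp only [mem_filter]; exact ⟨hzX, hzX, hzS, hcz, t, ht, htX, hzt⟩⟩
  simp only [mem_filter, id] at hM hMmax
  have main : ∀ x, Cand S a c X x →
      (∀ w, x < w → w ≤ M → ∃ g h, DownLink 𝓕 S a c X g h ∧ x ≤ g ∧ g < w ∧ w ≤ h) → False := by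
    intro x
    induction x using Nat.strong_induction_on with
    | _ x ih =>
      intro hx hP
      have hR : ∃ T ∈ 𝓕, RightBlock S a x T := by
        by_contra! hcon
        have hcx := hx.2.2.1
        have := hmax x ⟨hlt x hx, by omega, hx.2.1, hcon⟩
        omega
      rcases link_exists hS hX hnc h0 ha h0c hcX h0X hcR hx hR with ⟨g, hg⟩ | ⟨v, hv⟩
      · refine ih g hg.2.1 hg.1 fun w h1 h2 => ?_
        by_cases hw : w ≤ x
        · exact ⟨g, x, hg, le_rfl, h1, hw⟩
        · obtain ⟨g', h', hl, i1, i2, i3⟩ := hP w (by omega) h2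
          have := hg.2.1
          exact ⟨g', h', hl, by omega, i2, i3⟩
      · obtain ⟨g', h', hl, i1, i2, i3⟩ := hP v hv.2.1 (hMmax v ⟨hv.1.1, hv.1⟩)
        exact link_no_conflict hS hX hcard hnc h0 ha h0X hl hv i1 i2 i3
  exact main M hM.2 fun w h1 h2 => absurd h1 (by omega)

end InsertNoCross

/-- `B − A` has elements on both sides of an element of `A − B`. -/
def Nested (A B : Finset ℕ) : Prop :=
  ∃ b a b', b < a ∧ a < b' ∧ b ∈ B ∧ b ∉ A ∧ a ∈ A ∧ a ∉ B ∧ b' ∈ B ∧ b' ∉ A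

theorem ld_or_inner (A B : Finset ℕ) : LD A B ∨ LD B A ∨ Nested A B ∨ Nested B A := by
  by_contra! hcon
  obtain ⟨h1, h2, h3, h4⟩ := hcon
  unfold LD at h1 h2
  push Not at h1 h2
  obtain ⟨a, b, ha, ha', hb, hb', hab⟩ := h1
  obtain ⟨d, c, hd, hd', hc, hc', hcd⟩ := h2
  have e1 : a ≠ b := by rintro rfl; exact ha' hb
  have e2 : c ≠ d := by rintro rfl; exact hc' hd
  have e3 : a ≠ d := by rintro rfl; exact ha' hd
  have e4 : c ≠ b := by rintro rfl; exact hb' hc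
  by_cases hda : d < a
  · exact h4 ⟨c, d, a, by omega, hda, hc, hc', hd, hd', ha, ha'⟩
  · exact h3 ⟨b, a, d, by omega, by omega, hb, hb', ha, ha', hd, hd'⟩

theorem Nested.normal {A B : Finset ℕ} (h : Nested A B) (n1 : NoCross A B) (n2 : NoCross B A) :
    (∃ b ∈ B, b ∉ A ∧ ∀ a ∈ A, a ∉ B → b < a) ∧ (∃ b ∈ B, b ∉ A ∧ ∀ a ∈ A, a ∉ B → a < b) ∧
      ∀ b ∈ B, b ∉ A → (∀ a ∈ A, a ∉ B → b < a) ∨ (∀ a ∈ A, a ∉ B → a < b) := by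
  obtain ⟨b, a, b', h1, h2, hb, hb', ha, ha', hc, hc'⟩ := h
  have sep : ∀ b ∈ B, b ∉ A → (∀ a ∈ A, a ∉ B → b < a) ∨ (∀ a ∈ A, a ∉ B → a < b) := by
    intro x hx hx'
    by_contra! hcon
    obtain ⟨⟨p, hp, hp', hpx⟩, ⟨p', hq, hq', hxp⟩⟩ := hcon
    have : p ≠ x := by rintro rfl; exact hp' hx
    have : p' ≠ x := by rintro rfl; exact hq' hx
    have : p' ≠ b' := by rintro rfl; exact hq' hc
    by_cases hlt : p' < b'
    · exact n1 p x p' b' (by omega) (by omega) hlt hp hp' hx hx' hq hq' hc hc'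
    · exact n2 b a b' p' h1 h2 (by omega) hb hb' ha ha' hc hc' hq hq'
  refine ⟨⟨b, hb, hb', ?_⟩, ⟨b', hc, hc', ?_⟩, sep⟩
  · rcases sep b hb hb' with h | h
    · exact h
    · exact absurd (h a ha ha') (by omega)
  · rcases sep b' hc hc' with h | h
    · exact absurd (h a ha ha') (by omega)
    · exact h

theorem Nested.exists_ne {A B : Finset ℕ} (h : Nested A B) (hc : #A = #B) (c : ℕ) :
    ∃ a ∈ A, a ∉ B ∧ a ≠ c := by
  by_contra! hcon
  obtain ⟨b, a, b', h1, h2, hb, hb', ha, ha', hd, hd'⟩ := h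
  have e1 : #(A \ B) = #(B \ A) := card_sdiff_comm hc
  have e2 : #(A \ B) ≤ 1 := card_le_one.2 fun x hx y hy => by
    simp only [mem_sdiff] at hx hy
    rw [hcon x hx.1 hx.2, hcon y hy.1 hy.2]
  have e3 : 1 < #(B \ A) := one_lt_card.2 ⟨b, by simp [*], b', by simp [*], by omega⟩
  omega

theorem Nested.not_ld_of_inner {A B C : Finset ℕ} (h1 : Nested C A) (h2 : Nested A B)
    (hBC : #B = #C) (n1 : NoCross C A) (n2 : NoCross A C) (n3 : NoCross A B) (n4 : NoCross B A) :
    ¬ LD B C := by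
  intro hLD
  obtain ⟨k, hk, hk', -⟩ : ∃ k ∈ C, k ∉ A ∧ True := by
    obtain ⟨_, k, _, _, _, _, _, hk, hk', _⟩ := h1
    exact ⟨k, hk, hk', trivial⟩
  obtain ⟨⟨x, hxA, hxC, hx⟩, ⟨x', hxA', hxC', hx'⟩, -⟩ := h1.normal n1 n2
  obtain ⟨-, ⟨b', hbB', hbA', hb'⟩, sep⟩ := h2.normal n3 n4
  have ex : ∀ y ∈ B, y ∉ C → ∃ r ∈ C, r ∉ B := fun y hy hy' =>
    exists_mem_notMem_of_card hBC.le (by rintro rfl; exact hy' hy)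
  by_cases hcase : ∃ c ∈ C, c ∉ A ∧ c ∈ B
  · obtain ⟨c, hcC, hcA, hcB⟩ := hcase
    have i1 := hx c hcC hcA
    have i2 := hx' c hcC hcA
    rcases sep c hcB hcA with hlow | hup
    · have hxB : x ∈ B := by
        by_contra h
        have := hlow x hxA h
        omega
      by_cases hbC : b' ∈ C
      · have i3 := hx' b' hbC hbA'
        have hxB' : x' ∈ B := by
          by_contra h
          have := hb' x' hxA' h
          omega
        obtain ⟨r, hr, hr'⟩ := ex x' hxB' hxC'
        have i4 := hLD x' r hxB' hxC' hr hr'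
        by_cases hrA : r ∈ A
        · have := hb' r hrA hr'
          omega
        · have := hx' r hr hrA
          omega
      · obtain ⟨r, hr, hr'⟩ := ex b' hbB' hbC
        have i4 := hLD b' r hbB' hbC hr hr'
        by_cases hrA : r ∈ A
        · have := hb' r hrA hr'
          omega
        · have := hx' r hr hrA
          by_cases hxB' : x' ∈ B
          · have := hLD x' r hxB' hxC' hr hr'
            omega
          · have := hb' x' hxA' hxB'
            omega
    · have hxB' : x' ∈ B := by
        by_contra h
        have := hup x' hxA' h
        omega
      obtain ⟨r, hr, hr'⟩ := ex x' hxB' hxC'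
      have i4 := hLD x' r hxB' hxC' hr hr'
      by_cases hrA : r ∈ A
      · have := hup r hrA hr'
        omega
      · have := hx' r hr hrA
        omega
  · push Not at hcase
    have hkB := hcase k hk hk'
    have i1 := hx' k hk hk'
    by_cases hxB' : x' ∈ B
    · have := hLD x' k hxB' hxC' hk hkB
      omega
    · have i2 := hb' x' hxA' hxB'
      by_cases hbC : b' ∈ C
      · exact hcase b' hbC hbA' hbB'
      · have := hLD b' k hbB' hbC hk hkB
        omega

theorem Nested.not_ld_of_inner' {A B C : Finset ℕ} (h1 : Nested C A) (h2 : Nested A B)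
    (hBC : #B = #C) (n1 : NoCross C A) (n2 : NoCross A C) (n3 : NoCross A B) (n4 : NoCross B A) :
    ¬ LD C B := by
  intro hLD
  obtain ⟨k, hk, hk', -⟩ : ∃ k ∈ C, k ∉ A ∧ True := by
    obtain ⟨_, k, _, _, _, _, _, hk, hk', _⟩ := h1
    exact ⟨k, hk, hk', trivial⟩
  obtain ⟨⟨x', hxA', hxC', hx'⟩, ⟨x, hxA, hxC, hx⟩, -⟩ := h1.normal n1 n2
  obtain ⟨⟨b', hbB', hbA', hb'⟩, -, sep⟩ := h2.normal n3 n4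
  have ex : ∀ y ∈ B, y ∉ C → ∃ r ∈ C, r ∉ B := fun y hy hy' =>
    exists_mem_notMem_of_card hBC.le (by rintro rfl; exact hy' hy)
  by_cases hcase : ∃ c ∈ C, c ∉ A ∧ c ∈ B
  · obtain ⟨c, hcC, hcA, hcB⟩ := hcase
    have i1 := hx c hcC hcA
    have i2 := hx' c hcC hcA
    rcases sep c hcB hcA with hlow | hup
    · have hxB' : x' ∈ B := by
        by_contra h
        have := hlow x' hxA' h
        omega
      obtain ⟨r, hr, hr'⟩ := ex x' hxB' hxC'
      have i4 := hLD r x' hr hr' hxB' hxC'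
      by_cases hrA : r ∈ A
      · have := hlow r hrA hr'
        omega
      · have := hx' r hr hrA
        omega
    · have hxB : x ∈ B := by
        by_contra h
        have := hup x hxA h
        omega
      by_cases hbC : b' ∈ C
      · have i3 := hx' b' hbC hbA'
        have hxB' : x' ∈ B := by
          by_contra h
          have := hb' x' hxA' h
          omega
        obtain ⟨r, hr, hr'⟩ := ex x' hxB' hxC'
        have i4 := hLD r x' hr hr' hxB' hxC'
        by_cases hrA : r ∈ A
        · have := hb' r hrA hr'
          omega
        · have := hx' r hr hrA
          omega
      · obtain ⟨r, hr, hr'⟩ := ex b' hbB' hbC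
        have i4 := hLD r b' hr hr' hbB' hbC
        by_cases hrA : r ∈ A
        · have := hb' r hrA hr'
          omega
        · have := hx' r hr hrA
          by_cases hxB' : x' ∈ B
          · have := hLD r x' hr hr' hxB' hxC'
            omega
          · have := hb' x' hxA' hxB'
            omega
  · push Not at hcase
    have hkB := hcase k hk hk'
    have i1 := hx' k hk hk'
    by_cases hxB' : x' ∈ B
    · have := hLD k x' hk hkB hxB' hxC'
      omega
    · have i2 := hb' x' hxA' hxB'
      by_cases hbC : b' ∈ C
      · exact hcase b' hbC hbA' hbB'
      · have := hLD k b' hk hkB hbB' hbC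
        omega

section Exchange

variable {V X Y : Finset ℕ} {c q : ℕ}

theorem exchange_inner_false (hqc : q < c) (hq : q ∉ V)
    (hXV : LD X V) (hZY : LD (insert q (V.erase c)) Y) (hXY : LD X Y)
    (hVY : Nested V Y) (hXZ : Nested X (insert q (V.erase c))) (cVY : #V = #Y)
    (cVX : #X = #(insert q (V.erase c))) (n1 : NoCross V Y) (n2 : NoCross Y V)
    (n3 : NoCross X (insert q (V.erase c))) (n4 : NoCross (insert q (V.erase c)) X) : False := by
  obtain ⟨v, hv, hvY, hvc⟩ := hVY.exists_ne cVY c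
  obtain ⟨x, hx, hxZ, hxc⟩ := hXZ.exists_ne cVX c
  obtain ⟨⟨y, hyY, hyV, hy⟩, -, sep⟩ := hVY.normal n1 n2
  obtain ⟨⟨d, hdZ, hdX, hd⟩, -, -⟩ := hXZ.normal n3 n4
  have mZ : ∀ u, u ∈ insert q (V.erase c) ↔ u = q ∨ (u ≠ c ∧ u ∈ V) := by simp
  rw [mZ] at hdZ hxZ
  push Not at hxZ
  have hlow : ∀ y ∈ Y, y ∉ V → y < v → y = q := by
    intro y hyY hyV hlt
    by_contra hne
    have := hZY v y (by rw [mZ]; tauto) hvY hyY (by rw [mZ]; tauto)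
    omega
  have hyv := hy v hv hvY
  have hyq := hlow y hyY hyV hyv
  subst hyq
  have hxV := hxZ.2 hxc
  have hdx := hd x hx (by rw [mZ]; tauto)
  have hdy : d = y := by
    by_contra hne
    have hdV : d ∈ V := by tauto
    have := hXV x d hx hxV hdV hdX
    omega
  subst hdy
  have hxY : x ∈ Y := by
    by_contra h
    have := hXY x d hx h hyY hdX
    omega
  have hvx : v < x := by
    rcases sep x hxY hxV with h | h
    · have := hlow x hxY hxV (h v hv hvY)
      omega
    · exact h v hv hvY
  have hvX : v ∉ X := fun h => by
    have := hXY v d h hvY hyY hdX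
    omega
  have := hXV x v hx hxV hv hvX
  omega

theorem exchange_inner_false' (hqc : q < c) (hc : c ∈ V)
    (hXV : LD X V) (hZY : LD (insert q (V.erase c)) Y) (hXY : LD X Y)
    (hVY : Nested Y V) (hXZ : Nested (insert q (V.erase c)) X) (cVY : #Y = #V)
    (cVX : #(insert q (V.erase c)) = #X) (n1 : NoCross V Y) (n2 : NoCross Y V)
    (n3 : NoCross X (insert q (V.erase c))) (n4 : NoCross (insert q (V.erase c)) X) : False := by
  obtain ⟨y, hy, hyV, hyq⟩ := hVY.exists_ne cVY q
  obtain ⟨z, hz, hzX, hzq⟩ := hXZ.exists_ne cVX q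
  obtain ⟨-, ⟨v, hv, hvY, hvy⟩, -⟩ := hVY.normal n2 n1
  obtain ⟨-, ⟨x, hx, hxZ, hxz⟩, sep⟩ := hXZ.normal n4 n3
  have mZ : ∀ u, u ∈ insert q (V.erase c) ↔ u = q ∨ (u ≠ c ∧ u ∈ V) := by simp
  have hzV : z ∈ V := by rw [mZ] at hz; tauto
  have hup : ∀ x ∈ X, x ∉ insert q (V.erase c) → z < x → x = c := by
    intro x hxX hxZ hlt
    by_contra hne
    rw [mZ] at hxZ
    have := hXV x z hxX (by tauto) hzV hzX
    omega
  have hzx := hxz z hz hzX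
  have hxc := hup x hx hxZ hzx
  subst hxc
  have hyv := hvy y hy hyV
  have hyZ : y ∉ insert q (V.erase x) := by rw [mZ]; tauto
  have hvx : v = x := by
    by_contra hne
    have := hZY v y (by rw [mZ]; tauto) hvY hy hyZ
    omega
  subst hvx
  have hyX : y ∈ X := by
    by_contra h
    have := hXY v y hx hvY hy h
    omega
  have hyz : y < z := by
    rcases sep y hyX hyZ with h | h
    · exact h z hz hzX
    · have := hup y hyX hyZ (h z hz hzX)
      omega
  have hzY : z ∉ Y := fun h => by
    have := hXY v z hx hvY h hzX
    omega
  have := hZY z y hz hzY hy hyZ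
  omega

end Exchange

section Interpolation

variable {𝓗 : Finset (Finset ℕ)} {m : ℕ}

/-- Two-by-two interpolation in an equal-size non-crossing family with exchange steps. -/
theorem exists_interpolant_two (hcard : ∀ T ∈ 𝓗, #T = m)
    (hnc : ∀ T ∈ 𝓗, ∀ T' ∈ 𝓗, NoCross T T')
    (hch : ∀ Y ∈ 𝓗, ∀ X ∈ 𝓗, LD X Y → X ≠ Y → ∃ Z ∈ 𝓗, LD X Z ∧ ∃ c q, q < c ∧ c ∈ Y ∧ q ∉ Y ∧
      Z = insert q (Y.erase c))
    {Y₁ Y₂ X₁ X₂ : Finset ℕ} (hY₁ : Y₁ ∈ 𝓗) (hY₂ : Y₂ ∈ 𝓗) (hX₁ : X₁ ∈ 𝓗) (hX₂ : X₂ ∈ 𝓗)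
    (h11 : LD X₁ Y₁) (h12 : LD X₁ Y₂) (h21 : LD X₂ Y₁) (h22 : LD X₂ Y₂) :
    ∃ V ∈ 𝓗, LD V Y₁ ∧ LD V Y₂ ∧ LD X₁ V ∧ LD X₂ V := by
  classical
  have rfl' : ∀ A : Finset ℕ, LD A A := fun A _ _ h h' => absurd h h'
  have tr : ∀ {A B C : Finset ℕ}, A ∈ 𝓗 → B ∈ 𝓗 → C ∈ 𝓗 → LD A B → LD B C → LD A C := by
    intro A B C hA hB hC h h'
    exact h.trans_of_noCross (by rw [hcard A hA, hcard B hB]) (by rw [hcard B hB, hcard C hC]) h'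
      (hnc A hA C hC)
  have eqc : ∀ {A B : Finset ℕ}, A ∈ 𝓗 → B ∈ 𝓗 → #A = #B := by
    intro A B hA hB
    rw [hcard A hA, hcard B hB]
  have LL : ∀ {A B C : Finset ℕ}, A ∈ 𝓗 → B ∈ 𝓗 → C ∈ 𝓗 → Nested A B → Nested B C → ¬ LD A C := by
    intro A B C hA hB hC h h'
    exact h.not_ld_of_inner' h' (eqc hC hA) (hnc _ hA _ hB) (hnc _ hB _ hA) (hnc _ hB _ hC)
      (hnc _ hC _ hB)
  have LL' : ∀ {A B C : Finset ℕ}, A ∈ 𝓗 → B ∈ 𝓗 → C ∈ 𝓗 → Nested A B → Nested B C → ¬ LD C A := by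
    intro A B C hA hB hC h h'
    exact h.not_ld_of_inner h' (eqc hC hA) (hnc _ hA _ hB) (hnc _ hB _ hA) (hnc _ hB _ hC)
      (hnc _ hC _ hB)
  by_contra hcon
  push Not at hcon
  obtain ⟨V, hV, hmin⟩ := exists_min_image (𝓗.filter fun V => LD V Y₁ ∧ LD X₁ V ∧ LD X₂ V)
    (fun V => ∑ i ∈ V, i) ⟨Y₁, by simp only [mem_filter]; exact ⟨hY₁, rfl' _, h11, h21⟩⟩
  simp only [mem_filter] at hV hmin
  obtain ⟨hV, hVY₁, hX₁V, hX₂V⟩ := hV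
  have nVY : ¬ LD V Y₂ := fun h => hcon V hV hVY₁ h hX₁V hX₂V
  have nYV : ¬ LD Y₂ V := fun h => hcon Y₂ hY₂ (tr hY₂ hV hY₁ h hVY₁) (rfl' _) h12 h22
  have step : ∀ X X', X ∈ 𝓗 → X' ∈ 𝓗 → LD X Y₁ → LD X Y₂ → LD X' Y₁ → LD X' Y₂ → LD X V →
      LD X' V → (∀ V ∈ 𝓗, LD V Y₁ → LD V Y₂ → LD X V → ¬ LD X' V) →
      (∀ W ∈ 𝓗, LD W Y₁ ∧ LD X W ∧ LD X' W → ∑ i ∈ V, i ≤ ∑ i ∈ W, i) →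
      ∃ Z ∈ 𝓗, LD X Z ∧ LD Z V ∧ ¬ LD X' Z ∧ ¬ LD Z X' ∧
      ∃ c q, q < c ∧ c ∈ V ∧ q ∉ V ∧ Z = insert q (V.erase c) := by
    intro X X' hX hX' h1 h2 h3 h4 hXV hXV' hcon hmin
    obtain ⟨Z, hZ, hXZ, c, q, hqc, hc, hq, rfl⟩ := hch V hV X hX hXV
      (by rintro rfl; exact nVY h2)
    have hZV : LD (insert q (V.erase c)) V := by
      intro u w hu hu' hw hw'
      simp only [mem_insert, mem_erase] at hu hw'
      have : u = q := by tauto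
      have : w = c := by by_contra hne; exact hw' (Or.inr ⟨hne, hw⟩)
      omega
    refine ⟨_, hZ, hXZ, hZV, ?_, ?_, c, q, hqc, hc, hq, rfl⟩
    · intro h
      have := hmin _ hZ ⟨tr hZ hV hY₁ hZV hVY₁, hXZ, h⟩
      rw [sum_insert (by simp [hq])] at this
      have := add_sum_erase V (fun i => i) hc
      omega
    · intro h
      exact hcon X' hX' h3 h4 (tr hX hZ hX' hXZ h) (rfl' _)
  obtain ⟨Z₁, hZ₁, hXZ₁, hZV₁, na1, nb1, c₁, q₁, hq1, hc1, hqV1, e1⟩ := step X₁ X₂ hX₁ hX₂ h11 h12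
    h21 h22 hX₁V hX₂V hcon (fun W hW h => hmin W ⟨hW, h⟩)
  obtain ⟨Z₂, hZ₂, hXZ₂, hZV₂, na2, nb2, c₂, q₂, hq2, hc2, hqV2, e2⟩ := step X₂ X₁ hX₂ hX₁ h21 h22
    h11 h12 hX₂V hX₁V (fun V hV h1 h2 h3 h4 => hcon V hV h1 h2 h4 h3)
    (fun W hW h => hmin W ⟨hW, h.1, h.2.2, h.2.1⟩)
  have i1 : Nested Z₁ X₂ ∨ Nested X₂ Z₁ := by
    rcases ld_or_inner Z₁ X₂ with h | h | h | h <;> tauto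
  have i2 : Nested Z₂ X₁ ∨ Nested X₁ Z₂ := by
    rcases ld_or_inner Z₂ X₁ with h | h | h | h <;> tauto
  have i3 : Nested Y₂ V ∨ Nested V Y₂ := by
    rcases ld_or_inner Y₂ V with h | h | h | h <;> tauto
  have i4 : Nested Z₁ Z₂ ∨ Nested Z₂ Z₁ := by
    rcases ld_or_inner Z₁ Z₂ with h | h | h | h
    · exact absurd (tr hX₁ hZ₁ hZ₂ hXZ₁ h) na2
    · exact absurd (tr hX₂ hZ₂ hZ₁ hXZ₂ h) na1
    · exact Or.inl h
    · exact Or.inr h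
  have outer : ∀ X Z, X ∈ 𝓗 → Z ∈ 𝓗 → LD X V → LD X Y₂ → LD Z V →
      (∃ c q, q < c ∧ c ∈ V ∧ q ∉ V ∧ Z = insert q (V.erase c)) → Nested Y₂ V → Nested Z X →
      False := by
    rintro X Z hX hZ hXV hXY hZV ⟨c, q, hqc, hc, hq, rfl⟩ hI hI'
    refine exchange_inner_false' hqc hc hXV ?_ hXY hI hI' (eqc hY₂ hV) (eqc hZ hX)
      (hnc _ hV _ hY₂) (hnc _ hY₂ _ hV) (hnc _ hX _ hZ) (hnc _ hZ _ hX)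
    rcases ld_or_inner Y₂ (insert q (V.erase c)) with h | h | h | h
    · exact absurd (tr hY₂ hZ hV h hZV) nYV
    · exact h
    · exact absurd hXY (LL' hY₂ hZ hX h hI')
    · exact absurd hZV (LL hZ hY₂ hV h hI)
  have inner : ∀ X Z, X ∈ 𝓗 → Z ∈ 𝓗 → LD X V → LD X Y₂ → LD Z V →
      (∃ c q, q < c ∧ c ∈ V ∧ q ∉ V ∧ Z = insert q (V.erase c)) → Nested V Y₂ → Nested X Z →
      False := by
    rintro X Z hX hZ hXV hXY hZV ⟨c, q, hqc, hc, hq, rfl⟩ hI hI'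
    refine exchange_inner_false hqc hq hXV ?_ hXY hI hI' (eqc hV hY₂) (eqc hX hZ)
      (hnc _ hV _ hY₂) (hnc _ hY₂ _ hV) (hnc _ hX _ hZ) (hnc _ hZ _ hX)
    rcases ld_or_inner Y₂ (insert q (V.erase c)) with h | h | h | h
    · exact absurd (tr hY₂ hZ hV h hZV) nYV
    · exact h
    · exact absurd hZV (LL' hV hY₂ hZ hI h)
    · exact absurd hXY (LL hX hZ hY₂ hI' h)
  rcases i3 with i3 | i3
  · rcases i1 with i1 | i1
    · exact outer X₂ Z₁ hX₂ hZ₁ hX₂V h22 hZV₁ ⟨c₁, q₁, hq1, hc1, hqV1, e1⟩ i3 i1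
    rcases i2 with i2 | i2
    · exact outer X₁ Z₂ hX₁ hZ₂ hX₁V h12 hZV₂ ⟨c₂, q₂, hq2, hc2, hqV2, e2⟩ i3 i2
    rcases i4 with i4 | i4
    · exact LL hX₂ hZ₁ hZ₂ i1 i4 hXZ₂
    · exact LL hX₁ hZ₂ hZ₁ i2 i4 hXZ₁
  · rcases i1 with i1 | i1
    swap
    · exact inner X₂ Z₁ hX₂ hZ₁ hX₂V h22 hZV₁ ⟨c₁, q₁, hq1, hc1, hqV1, e1⟩ i3 i1
    rcases i2 with i2 | i2
    swap
    · exact inner X₁ Z₂ hX₁ hZ₂ hX₁V h12 hZV₂ ⟨c₂, q₂, hq2, hc2, hqV2, e2⟩ i3 i2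
    rcases i4 with i4 | i4
    · exact LL' hZ₁ hZ₂ hX₁ i4 i2 hXZ₁
    · exact LL' hZ₂ hZ₁ hX₂ i4 i1 hXZ₂

/-- Interpolation between finite sets of members. -/
theorem exists_interpolant (hcard : ∀ T ∈ 𝓗, #T = m)
    (hnc : ∀ T ∈ 𝓗, ∀ T' ∈ 𝓗, NoCross T T')
    (hch : ∀ Y ∈ 𝓗, ∀ X ∈ 𝓗, LD X Y → X ≠ Y → ∃ Z ∈ 𝓗, LD X Z ∧ ∃ c q, q < c ∧ c ∈ Y ∧ q ∉ Y ∧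
      Z = insert q (Y.erase c))
    {𝓨 𝓧 : Finset (Finset ℕ)} (hY : 𝓨 ⊆ 𝓗) (hX : 𝓧 ⊆ 𝓗) (hYne : 𝓨.Nonempty) (hXne : 𝓧.Nonempty)
    (h : ∀ Y ∈ 𝓨, ∀ X ∈ 𝓧, LD X Y) :
    ∃ V ∈ 𝓗, (∀ Y ∈ 𝓨, LD V Y) ∧ ∀ X ∈ 𝓧, LD X V := by
  classical
  have tr : ∀ {A B C : Finset ℕ}, A ∈ 𝓗 → B ∈ 𝓗 → C ∈ 𝓗 → LD A B → LD B C → LD A C := by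
    intro A B C hA hB hC h h'
    exact h.trans_of_noCross (by rw [hcard A hA, hcard B hB]) (by rw [hcard B hB, hcard C hC]) h'
      (hnc A hA C hC)
  have one : ∀ Y₁ ∈ 𝓗, ∀ Y₂ ∈ 𝓗, (∀ X ∈ 𝓧, LD X Y₁ ∧ LD X Y₂) →
      ∃ V ∈ 𝓗, LD V Y₁ ∧ LD V Y₂ ∧ ∀ X ∈ 𝓧, LD X V := by
    clear h
    intro Y₁ hY₁ Y₂ hY₂ h
    induction hXne using Nonempty.cons_induction with
    | singleton X =>
      obtain ⟨h1, h2⟩ := h X (by simp)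
      have hX := hX (mem_singleton_self X)
      obtain ⟨V, hV, e1, e2, e3, -⟩ := exists_interpolant_two hcard hnc hch hY₁ hY₂ hX hX h1 h2 h1 h2
      exact ⟨V, hV, e1, e2, by simpa using e3⟩
    | cons X s hXs hs ih =>
      rw [cons_eq_insert] at hX h
      obtain ⟨V', hV', e1, e2, e3⟩ := ih ((subset_insert _ _).trans hX)
        fun X hX => h X (mem_insert_of_mem hX)
      obtain ⟨h1, h2⟩ := h X (mem_insert_self _ _)
      obtain ⟨V, hV, f1, f2, f3, f4⟩ := exists_interpolant_two hcard hnc hch hY₁ hY₂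
        (hX (mem_insert_self _ _)) hV' h1 h2 e1 e2
      refine ⟨V, hV, f1, f2, ?_⟩
      intro W hW
      rw [mem_cons] at hW
      rcases hW with rfl | hW
      · exact f3
      · exact tr (hX (mem_insert_of_mem hW)) hV' hV (e3 W hW) f4
  induction hYne using Nonempty.cons_induction with
  | singleton Y =>
    have hY := hY (mem_singleton_self Y)
    obtain ⟨V, hV, e1, -, e3⟩ := one Y hY Y hY fun X hX => ⟨h Y (by simp) X hX, h Y (by simp) X hX⟩
    exact ⟨V, hV, by simpa using e1, e3⟩
  | cons Y s hYs hs ih =>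
    rw [cons_eq_insert] at hY h
    obtain ⟨V', hV', e1, e2⟩ := ih ((subset_insert _ _).trans hY)
      fun Y hY => h Y (mem_insert_of_mem hY)
    obtain ⟨V, hV, f1, f2, f3⟩ := one V' hV' Y (hY (mem_insert_self _ _)) fun X hX =>
      ⟨e2 X hX, h Y (mem_insert_self _ _) X hX⟩
    refine ⟨V, hV, ?_, f3⟩
    intro W hW
    rw [mem_cons] at hW
    rcases hW with rfl | hW
    · exact f2
    · exact tr hV hV' (hY (mem_insert_of_mem hW)) f1 (e1 W hW)

end Interpolation

/-- `F` is a maximal weakly separated collection of subsets of `[m]`. -/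
structure Mx (m : ℕ) (F : Finset (Finset ℕ)) : Prop where
  sub : ∀ X ∈ F, X ⊆ Icc 1 m
  ws : ∀ X ∈ F, ∀ Y ∈ F, WS X Y
  max : ∀ Z, Z ⊆ Icc 1 m → (∀ X ∈ F, WS Z X) → Z ∈ F

theorem exists_mx {m : ℕ} {G : Finset (Finset ℕ)} (hs : ∀ X ∈ G, X ⊆ Icc 1 m)
    (hG : ∀ X ∈ G, ∀ Y ∈ G, WS X Y) : ∃ F, G ⊆ F ∧ Mx m F := by
  classical
  obtain ⟨F, hGF, hF⟩ := (((Icc 1 m).powerset.powerset).filter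
    fun F => ∀ X ∈ F, ∀ Y ∈ F, WS X Y).exists_le_maximal (a := G) (by
      simp only [mem_filter, mem_powerset]
      exact ⟨fun X hX => mem_powerset.2 (hs X hX), hG⟩)
  obtain ⟨h1, h2⟩ := hF
  simp only [mem_filter, mem_powerset] at h1
  refine ⟨F, hGF, fun X hX => mem_powerset.1 (h1.1 hX), h1.2, fun Z hZ h => ?_⟩
  refine h2 (y := insert Z F) ?_ (subset_insert _ _) (mem_insert_self _ _)
  simp only [mem_filter, mem_powerset]
  refine ⟨insert_subset (mem_powerset.2 hZ) h1.1, ?_⟩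
  intro X hX Y hY
  rw [mem_insert] at hX hY
  rcases hX with rfl | hX <;> rcases hY with rfl | hY
  · exact WS.refl _
  · exact h Y hY
  · exact (h X hX).symm
  · exact h1.2 X hX Y hY

theorem Mx.image {m : ℕ} {F : Finset (Finset ℕ)} (hF : Mx m F) {f : Finset ℕ → Finset ℕ}
    (hs : ∀ X, f X ⊆ Icc 1 m) (hinv : ∀ X, X ⊆ Icc 1 m → f (f X) = X)
    (hws : ∀ X Y, X ⊆ Icc 1 m → Y ⊆ Icc 1 m → WS X Y → WS (f X) (f Y)) : Mx m (F.image f) := by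
  refine ⟨?_, ?_, ?_⟩
  · simp only [mem_image]
    rintro _ ⟨X, hX, rfl⟩
    exact hs X
  · simp only [mem_image]
    rintro _ ⟨X, hX, rfl⟩ _ ⟨Y, hY, rfl⟩
    exact hws _ _ (hF.sub X hX) (hF.sub Y hY) (hF.ws X hX Y hY)
  · intro Z hZ h
    refine mem_image.2 ⟨f Z, hF.max _ (hs Z) fun X hX => ?_, hinv Z hZ⟩
    have := hws _ _ hZ (hs X) (h _ (mem_image_of_mem f hX))
    rwa [hinv X (hF.sub X hX)] at this

theorem mem_image_involution {m : ℕ} {F : Finset (Finset ℕ)} (hF : Mx m F)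
    {f : Finset ℕ → Finset ℕ} (hinv : ∀ X, X ⊆ Icc 1 m → f (f X) = X) {X : Finset ℕ}
    (hX : X ⊆ Icc 1 m) : X ∈ F.image f ↔ f X ∈ F := by
  constructor
  · intro h
    obtain ⟨Y, hY, rfl⟩ := mem_image.1 h
    rwa [hinv Y (hF.sub Y hY)]
  · intro h
    exact mem_image.2 ⟨_, h, hinv X hX⟩

/-- Complement in `[m]`. -/
def cpl (m : ℕ) (X : Finset ℕ) : Finset ℕ := Icc 1 m \ X

/-- Reversed complement in `[m]`. -/
def rcpl (m : ℕ) (X : Finset ℕ) : Finset ℕ := (Icc 1 m).filter fun x => m + 1 - x ∉ X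

theorem mem_cpl {m x : ℕ} {X : Finset ℕ} : x ∈ cpl m X ↔ (1 ≤ x ∧ x ≤ m) ∧ x ∉ X := by
  simp [cpl]

theorem mem_rcpl {m x : ℕ} {X : Finset ℕ} :
    x ∈ rcpl m X ↔ (1 ≤ x ∧ x ≤ m) ∧ m + 1 - x ∉ X := by
  simp [rcpl]

section Involutions

variable {m : ℕ} {X Y : Finset ℕ}

theorem cpl_subset (m : ℕ) (X : Finset ℕ) : cpl m X ⊆ Icc 1 m := sdiff_subset

theorem rcpl_subset (m : ℕ) (X : Finset ℕ) : rcpl m X ⊆ Icc 1 m := filter_subset _ _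

theorem cpl_cpl (hX : X ⊆ Icc 1 m) : cpl m (cpl m X) = X := by
  ext x
  have := @hX x
  simp only [mem_cpl, mem_Icc] at *
  tauto

theorem rcpl_rcpl (hX : X ⊆ Icc 1 m) : rcpl m (rcpl m X) = X := by
  ext x
  have h := @hX x
  simp only [mem_rcpl, mem_Icc] at *
  constructor
  · rintro ⟨h1, h2⟩
    rw [show m + 1 - (m + 1 - x) = x by omega] at h2
    by_contra hx
    exact h2 ⟨by omega, hx⟩
  · intro hx
    refine ⟨h hx, ?_⟩
    rw [show m + 1 - (m + 1 - x) = x by have := h hx; omega]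
    tauto

theorem card_cpl (hX : X ⊆ Icc 1 m) : #(cpl m X) + #X = m := by
  have := card_sdiff_add_card_eq_card hX
  simpa [cpl] using this

theorem card_rcpl (hX : X ⊆ Icc 1 m) : #(rcpl m X) + #X = m := by
  refine Eq.trans (congrArg (· + #X) ?_) (card_cpl hX)
  refine card_nbij' (fun x => m + 1 - x) (fun x => m + 1 - x) ?_ ?_ ?_ ?_
  · intro x hx
    have := mem_rcpl.1 hx
    exact mem_cpl.2 ⟨by simp only; omega, this.2⟩
  · intro x hx
    have := mem_cpl.1 hx
    refine mem_rcpl.2 ⟨by simp only; omega, ?_⟩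
    rw [show m + 1 - (m + 1 - x) = x by omega]
    exact this.2
  · intro x hx
    have := mem_rcpl.1 hx
    simp only
    omega
  · intro x hx
    have := mem_cpl.1 hx
    simp only
    omega

theorem of_mem_cpl {x : ℕ} (h : x ∈ cpl m X) (h' : x ∉ cpl m Y) :
    x ∈ Y ∧ x ∉ X := by
  rw [mem_cpl] at *
  tauto

theorem of_mem_rcpl {x : ℕ} (h : x ∈ rcpl m X)
    (h' : x ∉ rcpl m Y) : (1 ≤ x ∧ x ≤ m) ∧ m + 1 - x ∈ Y ∧ m + 1 - x ∉ X := by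
  rw [mem_rcpl] at *
  tauto

theorem LD.compl (h : LD X Y) :
    LD (cpl m Y) (cpl m X) := by
  intro a b ha ha' hb hb'
  obtain ⟨h1, h2⟩ := of_mem_cpl ha ha'
  obtain ⟨h3, h4⟩ := of_mem_cpl hb hb'
  exact h a b h1 h2 h3 h4

theorem LD.revCompl (h : LD X Y) :
    LD (rcpl m X) (rcpl m Y) := by
  intro a b ha ha' hb hb'
  obtain ⟨h0, h1, h2⟩ := of_mem_rcpl ha ha'
  obtain ⟨h0', h3, h4⟩ := of_mem_rcpl hb hb'
  have := h _ _ h3 h4 h1 h2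
  omega

theorem WS.compl (h : WS X Y) (hX : X ⊆ Icc 1 m) (hY : Y ⊆ Icc 1 m) :
    WS (cpl m X) (cpl m Y) := by
  have key : ∀ {X Y}, X ⊆ Icc 1 m → Y ⊆ Icc 1 m → WS X Y →
      NoCross (cpl m X) (cpl m Y) ∧
      CardAlt (cpl m X) (cpl m Y) := by
    intro X Y hX hY h
    constructor
    · intro a b a' b' i1 i2 i3 ha ha' hb hb' hc hc' hd hd'
      obtain ⟨h1, h2⟩ := of_mem_cpl ha ha'
      obtain ⟨h3, h4⟩ := of_mem_cpl hb hb'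
      obtain ⟨h5, h6⟩ := of_mem_cpl hc hc'
      obtain ⟨h7, h8⟩ := of_mem_cpl hd hd'
      exact h.nc' a b a' b' i1 i2 i3 h1 h2 h3 h4 h5 h6 h7 h8
    · intro a b a' i1 i2 ha ha' hb hb' hc hc'
      obtain ⟨h1, h2⟩ := of_mem_cpl ha ha'
      obtain ⟨h3, h4⟩ := of_mem_cpl hb hb'
      obtain ⟨h5, h6⟩ := of_mem_cpl hc hc'
      have := h.alt' a b a' i1 i2 h1 h2 h3 h4 h5 h6
      have := card_cpl hX
      have := card_cpl hY
      omega
  have h1 := key hX hY h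
  have h2 := key hY hX h.symm
  exact ⟨h1.1, h2.1, h1.2, h2.2⟩

theorem WS.revCompl (h : WS X Y) (hX : X ⊆ Icc 1 m) (hY : Y ⊆ Icc 1 m) :
    WS (rcpl m X) (rcpl m Y) := by
  have key : ∀ {X Y}, X ⊆ Icc 1 m → Y ⊆ Icc 1 m → WS X Y →
      NoCross (rcpl m X) (rcpl m Y) ∧
      CardAlt (rcpl m X) (rcpl m Y) := by
    intro X Y hX hY h
    constructor
    · intro a b a' b' i1 i2 i3 ha ha' hb hb' hc hc' hd hd'
      obtain ⟨_, h1, h2⟩ := of_mem_rcpl ha ha'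
      obtain ⟨_, h3, h4⟩ := of_mem_rcpl hb hb'
      obtain ⟨_, h5, h6⟩ := of_mem_rcpl hc hc'
      obtain ⟨_, h7, h8⟩ := of_mem_rcpl hd hd'
      exact h.nc _ _ _ _ (by omega) (by omega) (by omega) h7 h8 h5 h6 h3 h4 h1 h2
    · intro a b a' i1 i2 ha ha' hb hb' hc hc'
      obtain ⟨_, h1, h2⟩ := of_mem_rcpl ha ha'
      obtain ⟨_, h3, h4⟩ := of_mem_rcpl hb hb'
      obtain ⟨_, h5, h6⟩ := of_mem_rcpl hc hc'
      have := h.alt' _ _ _ (by omega) (by omega) h5 h6 h3 h4 h1 h2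
      have := card_rcpl hX
      have := card_rcpl hY
      omega
  have h1 := key hX hY h
  have h2 := key hY hX h.symm
  exact ⟨h1.1, h2.1, h1.2, h2.2⟩

end Involutions

section Mx

variable {m : ℕ} {F : Finset (Finset ℕ)}

theorem Mx.compl (hF : Mx m F) : Mx m (F.image (cpl m)) :=
  hF.image (cpl_subset m) (fun _ h => cpl_cpl h) fun _ _ hX hY h => h.compl hX hY

theorem Mx.revCompl (hF : Mx m F) : Mx m (F.image (rcpl m)) :=
  hF.image (rcpl_subset m) (fun _ h => rcpl_rcpl h)
    fun _ _ hX hY h => h.revCompl hX hY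

theorem Mx.mem_cpl (hF : Mx m F) {X : Finset ℕ} (hX : X ⊆ Icc 1 m) :
    X ∈ F.image (cpl m) ↔ cpl m X ∈ F :=
  mem_image_involution hF (fun _ h => cpl_cpl h) hX

theorem Mx.mem_rcpl (hF : Mx m F) {X : Finset ℕ} (hX : X ⊆ Icc 1 m) :
    X ∈ F.image (rcpl m) ↔ rcpl m X ∈ F :=
  mem_image_involution hF (fun _ h => rcpl_rcpl h) hX

/-- Right links of an edge `(S, Sc)`. -/
def VRight (m : ℕ) (F : Finset (Finset ℕ)) : Prop :=
  ∀ S c, c ∉ S → S ∈ F → insert c S ∈ F → (∃ c', c < c' ∧ c' ∉ S ∧ insert c' S ∈ F) ∨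
    (∃ b ∈ S, b < c ∧ (insert c S).erase b ∈ F) ∨ insert c S = Icc c m

/-- Left links of an edge `(S, Sc)`. -/
def VLeft (F : Finset (Finset ℕ)) : Prop :=
  ∀ S c, c ∉ S → S ∈ F → insert c S ∈ F → (∃ c', c' < c ∧ c' ∉ S ∧ insert c' S ∈ F) ∨
    (∃ b ∈ S, c < b ∧ (insert c S).erase b ∈ F) ∨ insert c S = Icc 1 c

/-- One-step moves towards a larger set. -/
def ChainUp (F : Finset (Finset ℕ)) : Prop :=
  ∀ Y ∈ F, ∀ X ∈ F, Pre Y X → Y ≠ X → ∃ Z ∈ F, Pre Z X ∧ ((∃ c, c ∉ Y ∧ Z = insert c Y) ∨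
    ∃ b c, b ∈ Y ∧ c ∉ Y ∧ b < c ∧ Z = insert c (Y.erase b))

/-- One-step moves towards a smaller set lying to the right. -/
def ChainDown (F : Finset (Finset ℕ)) : Prop :=
  ∀ Y ∈ F, ∀ X ∈ F, #X ≤ #Y → LD Y X → Y ≠ X → ∃ Z ∈ F, #X ≤ #Z ∧ LD Z X ∧
    ((∃ c, c ∈ Y ∧ Z = Y.erase c) ∨ ∃ b c, b ∈ Y ∧ c ∉ Y ∧ b < c ∧ Z = insert c (Y.erase b))

theorem VRight.left (hF : Mx m F) (h : VRight m (F.image (cpl m))) : VLeft F := by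
  intro S c hc hS hSc
  have hcm := mem_Icc.1 (hF.sub _ hSc (mem_insert_self c S))
  have hSm := hF.sub S hS
  have e : insert c (cpl m (insert c S)) = cpl m S := by
    ext x
    simp only [mem_insert, mem_cpl]
    by_cases hx : x = c
    · subst hx; simp [hc]; omega
    · simp [hx]
  have m1 : ∀ {X}, X ∈ F → cpl m X ∈ F.image (cpl m) := fun h => mem_image_of_mem _ h
  rcases h (cpl m (insert c S)) c (by simp [mem_cpl]) (m1 hSc) (by rw [e]; exact m1 hS) with
    ⟨c', h1, h2, h3⟩ | ⟨b, h1, h2, h3⟩ | h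
  · have h4 := hF.compl.sub _ h3
    have h5 := mem_Icc.1 (h4 (mem_insert_self _ _))
    rw [hF.mem_cpl h4] at h3
    have h6 : c' ∈ S := by
      by_contra h6
      exact h2 (mem_cpl.2 ⟨h5, by simp [h6]; omega⟩)
    refine Or.inr (Or.inl ⟨c', h6, h1, ?_⟩)
    convert h3 using 1
    ext x
    have := @hSm x
    simp only [mem_erase, mem_insert, mem_cpl, mem_Icc] at *
    grind
  · have h4 := hF.compl.sub _ h3
    rw [hF.mem_cpl h4] at h3
    rw [mem_cpl, mem_insert, not_or] at h1
    refine Or.inl ⟨b, h2, h1.2.2, ?_⟩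
    convert h3 using 1
    ext x
    have := @hSm x
    simp only [mem_erase, mem_insert, mem_cpl, mem_Icc] at *
    grind
  · rw [e] at h
    refine Or.inr (Or.inr ?_)
    ext x
    have := @hSm x
    have h := congrArg (x ∈ ·) h
    simp only [mem_insert, mem_cpl, mem_Icc] at *
    grind

theorem ChainUp.down (hF : Mx m F) (h : ChainUp (F.image (rcpl m))) : ChainDown F := by
  intro Y hY X hX hc hYX hne
  have hYm := hF.sub Y hY
  have hXm := hF.sub X hX
  have cY := card_rcpl hYm
  have cX := card_rcpl hXm
  obtain ⟨Z, hZ, hZX, hZ'⟩ := h (rcpl m Y) (mem_image_of_mem _ hY) (rcpl m X)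
    (mem_image_of_mem _ hX) ⟨by omega, hYX.revCompl⟩ (by
      intro h
      apply hne
      rw [← rcpl_rcpl hYm, h, rcpl_rcpl hXm])
  have hZm := hF.revCompl.sub Z hZ
  rw [hF.mem_rcpl hZm] at hZ
  have cZ := card_rcpl hZm
  have := hZX.1
  refine ⟨_, hZ, by omega, ?_, ?_⟩
  · have := hZX.2.revCompl (m := m)
    rwa [rcpl_rcpl hXm] at this
  · rcases hZ' with ⟨c, h1, rfl⟩ | ⟨b, c, h1, h2, h3, rfl⟩
    · left
      have hcm := mem_Icc.1 (hZm (mem_insert_self _ _))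
      refine ⟨m + 1 - c, ?_, ?_⟩
      · rw [mem_rcpl] at h1
        tauto
      · ext x
        have := @hYm x
        simp only [mem_erase, mem_insert, mem_rcpl, mem_Icc] at *
        by_cases hx : 1 ≤ x ∧ x ≤ m
        · rw [show m + 1 - (m + 1 - x) = x by omega]
          grind
        · grind
    · right
      have hcm := mem_Icc.1 (hZm (mem_insert_self _ _))
      rw [mem_rcpl] at h1 h2
      refine ⟨m + 1 - c, m + 1 - b, by tauto, h1.2, by omega, ?_⟩
      ext x
      have := @hYm x
      simp only [mem_erase, mem_insert, mem_rcpl, mem_Icc] at *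
      by_cases hx : 1 ≤ x ∧ x ≤ m
      · rw [show m + 1 - (m + 1 - x) = x by omega]
        grind
      · grind

/-- A member `P` with `P ∪ {n}` also a member can be enlarged below `n`. -/
theorem Mx.exists_insert {n : ℕ} (hF : Mx n F) {P : Finset ℕ} (hP : P ∈ F) (hn : n ∉ P)
    (hPn : insert n P ∈ F) (hne : ∃ c, 1 ≤ c ∧ c < n ∧ c ∉ P) :
    ∃ c, c < n ∧ c ∉ P ∧ insert c P ∈ F := by
  have hPm := hF.sub P hP
  have hPnm := hF.sub _ hPn
  have hlt : #P < n := by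
    have := card_le_of_subset_Icc hPnm
    rw [card_insert_of_notMem hn] at this
    omega
  obtain ⟨c₀, h1, h2, h3⟩ := hne
  have hPlt : #P + 1 < n := by
    have : insert c₀ (insert n P) ⊆ Icc 1 n := insert_subset (by simp; omega) hPnm
    have := card_le_of_subset_Icc this
    rw [card_insert_of_notMem (by simp [h3]; omega), card_insert_of_notMem hn] at this
    omega
  set S := P.image (n - ·) ∪ Ico n (2 * n - #P - 1) with hS
  have mS : ∀ {x}, x ∈ S ↔ (x < n ∧ n - x ∈ P) ∨ (n ≤ x ∧ x < 2 * n - #P - 1) := by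
    intro x
    simp only [hS, mem_union, mem_image, mem_Ico]
    constructor
    · rintro (⟨a, ha, rfl⟩ | h)
      · have := mem_Icc.1 (hPm ha)
        refine Or.inl ⟨by omega, ?_⟩
        rwa [show n - (n - a) = a by omega]
      · exact Or.inr h
    · rintro (⟨h, h'⟩ | h)
      · exact Or.inl ⟨_, h', by omega⟩
      · exact Or.inr h
  have e : ∀ c, 1 ≤ c → c ≤ n → c ∉ P → pad n (insert c P) = insert (n - c) S := by
    intro c hc hc' hcP
    have hs : insert c P ⊆ Icc 1 n := insert_subset (by simp; omega) hPm
    ext x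
    rw [mem_pad hs, card_insert_of_notMem hcP, mem_insert, mem_insert, mS]
    constructor
    · rintro (⟨h, h' | h'⟩ | h)
      · left; omega
      · tauto
      · right; right; omega
    · rintro (h | h | h)
      · left; exact ⟨by omega, Or.inl (by omega)⟩
      · tauto
      · right; omega
  have e' : pad n P = insert (2 * n - #P - 1) S := by
    ext x
    rw [mem_pad hPm, mem_insert, mS]
    constructor
    · rintro (h | h)
      · tauto
      · by_cases x = 2 * n - #P - 1
        · tauto
        · right; right; omega
    · rintro (h | h | h)
      · right; omega
      · tauto
      · right; omega
  obtain ⟨c, hc1, hc2, hc3, hc4⟩ := exists_insert_noCross (𝓕 := F.image (pad n)) (S := S)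
    (a := 2 * n - #P - 1) (m := n)
    (by
      simp only [mem_image]
      rintro _ ⟨X, hX, rfl⟩
      exact card_pad (hF.sub X hX))
    (by
      simp only [mem_image]
      rintro _ ⟨X, hX, rfl⟩ _ ⟨Y, hY, rfl⟩
      exact (hF.ws X hX Y hY).noCross_pad (hF.sub X hX) (hF.sub Y hY))
    (by
      intro x hx
      rcases mS.1 hx with h | h
      · have : x ≠ 0 := by rintro rfl; exact hn (by simpa using h.2)
        omega
      · omega)
    (by
      rw [← Nat.sub_self n, ← e n (by omega) le_rfl hn]
      exact mem_image_of_mem _ hPn)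
    (by rw [← e']; exact mem_image_of_mem _ hP)
    ⟨n - c₀, by omega, by omega, by
      rw [mS, show n - (n - c₀) = c₀ by omega]
      rintro (h | h)
      · exact h3 h.2
      · omega⟩
  have hcn : c < n := by
    by_contra h
    exact hc3 (mS.2 (Or.inr ⟨by omega, hc2⟩))
  have hcP : n - c ∉ P := fun h => hc3 (mS.2 (Or.inl ⟨hcn, h⟩))
  have hs : insert (n - c) P ⊆ Icc 1 n := insert_subset (by simp; omega) hPm
  refine ⟨n - c, by omega, hcP, hF.max _ hs fun X hX => ?_⟩
  have := hc4 (pad n X) (mem_image_of_mem _ hX)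
  rw [show c = n - (n - c) by omega, ← e (n - c) (by omega) (by omega) hcP] at this
  exact ws_of_noCross_pad hs (hF.sub X hX) this.1 this.2

theorem Mx.exists_erase {n : ℕ} (hF : Mx n F) {P : Finset ℕ} (hP : P ∈ F) (hn : n ∉ P)
    (hPn : insert n P ∈ F) (hne : P.Nonempty) : ∃ b ∈ P, insert n (P.erase b) ∈ F := by
  obtain ⟨b₀, hb₀⟩ := hne
  have hPm := hF.sub P hP
  have hbm := mem_Icc.1 (hPm hb₀)
  have hbn : b₀ ≠ n := by rintro rfl; exact hn hb₀
  have m1 : ∀ {X}, X ∈ F → cpl n X ∈ F.image (cpl n) := fun h => mem_image_of_mem _ h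
  obtain ⟨c, h1, h2, h3⟩ := hF.compl.exists_insert (m1 hPn) (by simp [_root_.mem_cpl]) (by
    convert m1 hP using 1
    ext x
    simp only [mem_insert, _root_.mem_cpl]
    by_cases hx : x = n
    · subst hx; simp [hn]; omega
    · simp [hx]) ⟨b₀, by omega, by omega, by simp [_root_.mem_cpl, hb₀]⟩
  have h4 := hF.compl.sub _ h3
  have h5 := mem_Icc.1 (h4 (mem_insert_self _ _))
  rw [hF.mem_cpl h4] at h3
  refine ⟨c, ?_, ?_⟩
  · by_contra h6
    exact h2 (_root_.mem_cpl.2 ⟨h5, by simp [h6]; omega⟩)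
  · convert h3 using 1
    ext x
    have := @hPm x
    simp only [mem_erase, mem_insert, _root_.mem_cpl, mem_Icc] at *
    grind

theorem Mx.exists_interpolant (hF : Mx m F) (hch : ChainUp F) {𝓨 𝓧 : Finset (Finset ℕ)}
    (hY : 𝓨 ⊆ F) (hX : 𝓧 ⊆ F) (hYne : 𝓨.Nonempty) (hXne : 𝓧.Nonempty)
    (h : ∀ Y ∈ 𝓨, ∀ X ∈ 𝓧, Pre Y X) :
    ∃ V ∈ F, (∀ Y ∈ 𝓨, Pre Y V) ∧ ∀ X ∈ 𝓧, Pre V X := by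
  obtain ⟨V, hV, h1, h2⟩ := _root_.exists_interpolant (𝓗 := F.image (pad m)) (m := m)
    (𝓨 := 𝓨.image (pad m)) (𝓧 := 𝓧.image (pad m))
    (by
      simp only [mem_image]
      rintro _ ⟨X, hX, rfl⟩
      exact card_pad (hF.sub X hX))
    (by
      simp only [mem_image]
      rintro _ ⟨X, hX, rfl⟩ _ ⟨Y, hY, rfl⟩
      exact (hF.ws X hX Y hY).noCross_pad (hF.sub X hX) (hF.sub Y hY))
    (by
      simp only [mem_image]
      rintro _ ⟨Y, hY, rfl⟩ _ ⟨X, hX, rfl⟩ hl hne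
      have hYm := hF.sub Y hY
      have hXm := hF.sub X hX
      obtain ⟨Z, hZ, hZX, hc⟩ := hch Y hY X hX (pre_of_pad hYm hXm hl) (by rintro rfl; exact hne rfl)
      have hZm := hF.sub Z hZ
      refine ⟨_, ⟨Z, hZ, rfl⟩, hZX.pad hZm hXm, ?_⟩
      rcases hc with ⟨c, hc, rfl⟩ | ⟨b, c, hb, hc, hbc, rfl⟩
      · have hcm := mem_Icc.1 (hZm (mem_insert_self _ _))
        have hcard := card_le_of_subset_Icc hZm
        rw [card_insert_of_notMem hc] at hcard
        refine ⟨2 * m - #Y - 1, m - c, by omega, ?_, ?_, ?_⟩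
        · rw [mem_pad hYm]; right; omega
        · rw [sub_mem_pad hYm hcm.1 hcm.2]; exact hc
        · ext x
          rw [mem_pad hZm, mem_insert, mem_insert, mem_erase, mem_pad hYm, card_insert_of_notMem hc]
          by_cases hx : x < m
          · have : ¬ m ≤ x := by omega
            have : m - x = c ↔ x = m - c := by omega
            have : x ≠ 2 * m - #Y - 1 := by omega
            tauto
          · have : m ≤ x := by omega
            have : x ≠ m - c := by omega
            have : x < 2 * m - (#Y + 1) ↔ x ≠ 2 * m - #Y - 1 ∧ x < 2 * m - #Y := by omega
            tauto
      · have hcm := mem_Icc.1 (hZm (mem_insert_self _ _))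
        have hbm := mem_Icc.1 (hYm hb)
        have e : #(insert c (Y.erase b)) = #Y := by
          rw [card_insert_of_notMem (by simp [hc]), card_erase_add_one hb]
        refine ⟨m - b, m - c, by omega, ?_, ?_, ?_⟩
        · rw [sub_mem_pad hYm hbm.1 hbm.2]; exact hb
        · rw [sub_mem_pad hYm hcm.1 hcm.2]; exact hc
        · ext x
          rw [mem_pad hZm, mem_insert, mem_erase, mem_insert, mem_erase, mem_pad hYm, e]
          by_cases hx : x < m
          · have : ¬ m ≤ x := by omega
            have : m - x = c ↔ x = m - c := by omega
            have : m - x = b ↔ x = m - b := by omega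
            tauto
          · have : m ≤ x := by omega
            have : x ≠ m - c := by omega
            have : x ≠ m - b := by omega
            tauto)
    (image_subset_image hY) (image_subset_image hX) (hYne.image _) (hXne.image _)
    (by
      simp only [mem_image]
      rintro _ ⟨Y, hY', rfl⟩ _ ⟨X, hX', rfl⟩
      exact (h Y hY' X hX').pad (hF.sub Y (hY hY')) (hF.sub X (hX hX')))
  obtain ⟨V, hVF, rfl⟩ := mem_image.1 hV
  refine ⟨V, hVF, fun Y hY' => ?_, fun X hX' => ?_⟩
  · exact pre_of_pad (hF.sub _ (hY hY')) (hF.sub V hVF) (h1 _ (mem_image_of_mem _ hY'))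
  · exact pre_of_pad (hF.sub V hVF) (hF.sub _ (hX hX')) (h2 _ (mem_image_of_mem _ hX'))

end Mx

theorem Nested.exists_between_ne {A B : Finset ℕ} (h : Nested A B) (hc : #A = #B)
    (n1 : NoCross A B) (n2 : NoCross B A) (c : ℕ) :
    ∃ b a b', b < a ∧ a < b' ∧ b ∈ B ∧ b ∉ A ∧ a ∈ A ∧ a ∉ B ∧ b' ∈ B ∧ b' ∉ A ∧ a ≠ c := by
  obtain ⟨a, ha, ha', hac⟩ := h.exists_ne hc c
  obtain ⟨⟨b, hb, hb', h1⟩, ⟨b', hd, hd', h2⟩, -⟩ := h.normal n1 n2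
  exact ⟨b, a, b', h1 a ha ha', h2 a ha ha', hb, hb', ha, ha', hd, hd', hac⟩

section Con

variable {m : ℕ} {X Y : Finset ℕ}

theorem succ_notMem (hY : Y ⊆ Icc 1 m) : m + 1 ∉ Y := fun h => by
  have := mem_Icc.1 (hY h)
  omega

theorem card_insert_succ (hX : X ⊆ Icc 1 m) : #(insert (m + 1) X) = #X + 1 :=
  card_insert_of_notMem (succ_notMem hX)

theorem LD.insert_right (h : LD Y X) (hY : Y ⊆ Icc 1 m) : LD Y (insert (m + 1) X) := by
  intro a b ha ha' hb hb'
  have := mem_Icc.1 (hY ha)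
  simp only [mem_insert, not_or] at *
  rcases hb with rfl | hb
  · omega
  · exact h a b ha ha'.2 hb hb'

theorem LD.of_insert_right (h : LD Y (insert (m + 1) X)) (hY : Y ⊆ Icc 1 m) : LD Y X := by
  intro a b ha ha' hb hb'
  have := mem_Icc.1 (hY ha)
  refine h a b ha ?_ (mem_insert_of_mem hb) hb'
  simp only [mem_insert, not_or]
  exact ⟨by omega, ha'⟩

theorem LD.insert_both (h : LD Y X) (c : ℕ) : LD (insert c Y) (insert c X) := by
  intro a b ha ha' hb hb'
  simp only [mem_insert, not_or] at *
  exact h a b (by tauto) ha'.2 (by tauto) hb'.2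

theorem LD.of_insert_both {c : ℕ} (h : LD (insert c Y) (insert c X)) (hY : c ∉ Y) (hX : c ∉ X) :
    LD Y X := by
  intro a b ha ha' hb hb'
  refine h a b (mem_insert_of_mem ha) ?_ (mem_insert_of_mem hb) ?_ <;>
  simp only [mem_insert, not_or] <;> refine ⟨?_, by assumption⟩
  · rintro rfl; exact hY ha
  · rintro rfl; exact hX hb

theorem ws_insert_both {c : ℕ} (hY : c ∉ Y) (hX : c ∉ X) :
    WS (insert c Y) (insert c X) ↔ WS Y X := by
  have e1 : ∀ {A B : Finset ℕ}, c ∉ A → ∀ {x}, (x ∈ insert c A ∧ x ∉ insert c B) ↔ (x ∈ A ∧ x ∉ B) := by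
    intro A B hA x
    simp only [mem_insert, not_or]
    constructor
    · tauto
    · rintro ⟨h1, h2⟩
      exact ⟨Or.inr h1, by rintro rfl; exact hA h1, h2⟩
  have nc : ∀ {A B : Finset ℕ}, c ∉ A → c ∉ B → (NoCross (insert c A) (insert c B) ↔ NoCross A B) := by
    intro A B hA hB
    constructor
    · intro h a b a' b' h1 h2 h3 ha ha' hb hb' hc hc' hd hd'
      have i1 := (e1 hA).2 ⟨ha, ha'⟩
      have i2 := (e1 hB).2 ⟨hb, hb'⟩
      have i3 := (e1 hA).2 ⟨hc, hc'⟩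
      have i4 := (e1 hB).2 ⟨hd, hd'⟩
      exact h a b a' b' h1 h2 h3 i1.1 i1.2 i2.1 i2.2 i3.1 i3.2 i4.1 i4.2
    · intro h a b a' b' h1 h2 h3 ha ha' hb hb' hc hc' hd hd'
      have i1 := (e1 hA).1 ⟨ha, ha'⟩
      have i2 := (e1 hB).1 ⟨hb, hb'⟩
      have i3 := (e1 hA).1 ⟨hc, hc'⟩
      have i4 := (e1 hB).1 ⟨hd, hd'⟩
      exact h a b a' b' h1 h2 h3 i1.1 i1.2 i2.1 i2.2 i3.1 i3.2 i4.1 i4.2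
  have ca : ∀ {A B : Finset ℕ}, c ∉ A → c ∉ B → (CardAlt (insert c A) (insert c B) ↔ CardAlt A B) := by
    intro A B hA hB
    have cA := card_insert_of_notMem hA
    have cB := card_insert_of_notMem hB
    constructor
    · intro h a b a' h1 h2 ha ha' hb hb' hc hc'
      have i1 := (e1 hA).2 ⟨ha, ha'⟩
      have i2 := (e1 hB).2 ⟨hb, hb'⟩
      have i3 := (e1 hA).2 ⟨hc, hc'⟩
      have := h a b a' h1 h2 i1.1 i1.2 i2.1 i2.2 i3.1 i3.2
      omega
    · intro h a b a' h1 h2 ha ha' hb hb' hc hc'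
      have i1 := (e1 hA).1 ⟨ha, ha'⟩
      have i2 := (e1 hB).1 ⟨hb, hb'⟩
      have i3 := (e1 hA).1 ⟨hc, hc'⟩
      have := h a b a' h1 h2 i1.1 i1.2 i2.1 i2.2 i3.1 i3.2
      omega
  constructor
  · rintro ⟨h1, h2, h3, h4⟩
    exact ⟨(nc hY hX).1 h1, (nc hX hY).1 h2, (ca hY hX).1 h3, (ca hX hY).1 h4⟩
  · rintro ⟨h1, h2, h3, h4⟩
    exact ⟨(nc hY hX).2 h1, (nc hX hY).2 h2, (ca hY hX).2 h3, (ca hX hY).2 h4⟩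

theorem WS.pre_of_insert (hY : Y ⊆ Icc 1 m) (hX : X ⊆ Icc 1 m) (h : WS Y (insert (m + 1) X))
    (hc : #Y ≤ #X) : Pre Y X := by
  refine ⟨hc, fun y x hy hy' hx hx' => ?_⟩
  have hym := mem_Icc.1 (hY hy)
  by_contra hlt
  have hne : x ≠ y := by rintro rfl; exact hx' hy
  have := h.alt' x y (m + 1) (by omega) (by omega) (mem_insert_of_mem hx) hx' hy
    (by simp only [mem_insert, not_or]; exact ⟨by omega, hy'⟩) (mem_insert_self _ _) (succ_notMem hY)
  rw [card_insert_succ hX] at this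
  omega

theorem WS.of_insert (hY : Y ⊆ Icc 1 m) (hX : X ⊆ Icc 1 m) (h : WS Y (insert (m + 1) X)) :
    WS Y X := by
  have e : ∀ {x}, x ∈ Y → x ∉ X → x ∉ insert (m + 1) X := by
    intro x hx hx'
    have := mem_Icc.1 (hY hx)
    simp only [mem_insert, not_or]
    exact ⟨by omega, hx'⟩
  have i : ∀ {x}, x ∈ X → x ∈ insert (m + 1) X := fun h => mem_insert_of_mem h
  by_cases hc : #Y ≤ #X
  · exact (h.pre_of_insert hY hX hc).ws
  refine ⟨?_, ?_, ?_, fun _ _ _ _ _ _ _ _ _ _ _ => by omega⟩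
  · intro a b a' b' h1 h2 h3 ha ha' hb hb' hc hc' hd hd'
    exact h.nc a b a' b' h1 h2 h3 ha (e ha ha') (i hb) hb' hc (e hc hc') (i hd) hd'
  · intro a b a' b' h1 h2 h3 ha ha' hb hb' hc hc' hd hd'
    exact h.nc' a b a' b' h1 h2 h3 (i ha) ha' hb (e hb hb') (i hc) hc' hd (e hd hd')
  · intro a b a' h1 h2 ha ha' hb hb' hc hc'
    have := mem_Icc.1 (hY hc)
    exact (h.nc a b a' (m + 1) h1 h2 (by omega) ha (e ha ha') (i hb) hb' hc (e hc hc')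
      (mem_insert_self _ _) (succ_notMem hY)).elim

theorem WS.insert_right (hY : Y ⊆ Icc 1 m) (hX : X ⊆ Icc 1 m) (h : WS Y X)
    (hp : #Y ≤ #X → Pre Y X) : WS Y (insert (m + 1) X) := by
  by_cases hcard : #Y ≤ #X
  · exact ((hp hcard).2.insert_right hY).ws
  have cX := card_insert_succ hX
  have i : ∀ {x y}, y ∈ Y → x < y → x ∈ insert (m + 1) X → x ∈ X := by
    intro x y hy hxy hx
    have := mem_Icc.1 (hY hy)
    rw [mem_insert] at hx
    rcases hx with rfl | hx
    · omega
    · exact hx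
  have e : ∀ {x}, x ∉ insert (m + 1) X → x ∉ X := fun h h' => h (mem_insert_of_mem h')
  refine ⟨?_, ?_, ?_, fun _ _ _ _ _ _ _ _ _ _ _ => by omega⟩
  · intro a b a' b' h1 h2 h3 ha ha' hb hb' hc hc' hd hd'
    exact hcard (h.alt a b a' h1 h2 ha (e ha') (i hc h2 hb) hb' hc (e hc'))
  · intro a b a' b' h1 h2 h3 ha ha' hb hb' hc hc' hd hd'
    exact h.nc' a b a' b' h1 h2 h3 (i hb h1 ha) ha' hb (e hb') (i hd h3 hc) hc' hd (e hd')
  · intro a b a' h1 h2 ha ha' hb hb' hc hc'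
    have := h.alt a b a' h1 h2 ha (e ha') (i hc h2 hb) hb' hc (e hc')
    omega

end Con

/-- Splitting of a maximal collection of subsets of `[m + 1]` along the element `m + 1`. -/
structure Cut (m : ℕ) (F H : Finset (Finset ℕ)) (P : ℕ → Finset ℕ) : Prop where
  hF : Mx (m + 1) F
  hH : Mx m H
  low : ∀ {X}, X ∈ F → X ⊆ Icc 1 m → X ∈ H
  upp : ∀ {X}, insert (m + 1) X ∈ F → X ⊆ Icc 1 m → X ∈ H
  cardP : ∀ {k}, k ≤ m → #(P k) = k
  subP : ∀ {k}, k ≤ m → P k ⊆ Icc 1 m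
  lowP : ∀ {k}, k ≤ m → P k ∈ F
  uppP : ∀ {k}, k ≤ m → insert (m + 1) (P k) ∈ F
  low_pre : ∀ {X k}, k ≤ m → X ∈ F → X ⊆ Icc 1 m → #X ≤ k → Pre X (P k)
  upp_pre : ∀ {X k}, k ≤ m → insert (m + 1) X ∈ F → X ⊆ Icc 1 m → k ≤ #X → Pre (P k) X

section

variable {m : ℕ} {F : Finset (Finset ℕ)}

theorem mem_of_notMem_succ (hF : Mx (m + 1) F) {X : Finset ℕ} (hX : X ∈ F) (h : m + 1 ∉ X) :
    X ⊆ Icc 1 m := by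
  intro x hx
  have := mem_Icc.1 (hF.sub X hX hx)
  have : x ≠ m + 1 := by rintro rfl; exact h hx
  rw [mem_Icc]
  omega

theorem exists_of_mem_succ (hF : Mx (m + 1) F) {X : Finset ℕ} (hX : X ∈ F) (h : m + 1 ∈ X) :
    ∃ X', X' ⊆ Icc 1 m ∧ X = insert (m + 1) X' := by
  refine ⟨X.erase (m + 1), ?_, (insert_erase h).symm⟩
  intro x hx
  rw [mem_erase] at hx
  have := mem_Icc.1 (hF.sub X hX hx.2)
  rw [mem_Icc]
  omega

theorem Mx.cases_succ (hF : Mx (m + 1) F) {X : Finset ℕ} (hX : X ∈ F) :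
    X ⊆ Icc 1 m ∨ ∃ X', X' ⊆ Icc 1 m ∧ X = insert (m + 1) X' := by
  by_cases h : m + 1 ∈ X
  · exact Or.inr (exists_of_mem_succ hF hX h)
  · exact Or.inl (mem_of_notMem_succ hF hX h)

theorem Icc_mono_succ {X : Finset ℕ} (h : X ⊆ Icc 1 m) : X ⊆ Icc 1 (m + 1) :=
  h.trans (Icc_subset_Icc le_rfl (Nat.le_succ m))

theorem insert_succ_subset {X : Finset ℕ} (h : X ⊆ Icc 1 m) : insert (m + 1) X ⊆ Icc 1 (m + 1) :=
  insert_subset (by simp) (Icc_mono_succ h)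

theorem Mx.mem_low (hF : Mx (m + 1) F) {V : Finset ℕ} (hV : V ⊆ Icc 1 m)
    (h1 : ∀ X ∈ F, X ⊆ Icc 1 m → WS V X)
    (h2 : ∀ X, insert (m + 1) X ∈ F → X ⊆ Icc 1 m → WS V X ∧ (#V ≤ #X → Pre V X)) : V ∈ F := by
  refine hF.max _ (Icc_mono_succ hV) fun X hX => ?_
  rcases hF.cases_succ hX with h | ⟨X', h, rfl⟩
  · exact h1 X hX h
  · obtain ⟨i1, i2⟩ := h2 X' hX h
    exact i1.insert_right hV h i2

theorem Mx.mem_upp (hF : Mx (m + 1) F) {V : Finset ℕ} (hV : V ⊆ Icc 1 m)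
    (h1 : ∀ X ∈ F, X ⊆ Icc 1 m → WS V X ∧ (#X ≤ #V → Pre X V))
    (h2 : ∀ X, insert (m + 1) X ∈ F → X ⊆ Icc 1 m → WS V X) : insert (m + 1) V ∈ F := by
  refine hF.max _ (insert_succ_subset hV) fun X hX => ?_
  rcases hF.cases_succ hX with h | ⟨X', h, rfl⟩
  · obtain ⟨i1, i2⟩ := h1 X hX h
    exact (i1.symm.insert_right h hV i2).symm
  · exact (ws_insert_both (succ_notMem hV) (succ_notMem h)).2 (h2 X' hX h)

theorem Mx.exists_cut (hF : Mx (m + 1) F) (hgood : ∀ H, Mx m H → ChainUp H) :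
    ∃ H P, Cut m F H P := by
  classical
  obtain ⟨H, hGH, hH⟩ := exists_mx (m := m) (G := F.filter (m + 1 ∉ ·) ∪
      (F.filter (m + 1 ∈ ·)).image (·.erase (m + 1)))
    (by
      intro X hX
      simp only [mem_union, mem_filter, mem_image] at hX
      rcases hX with h | ⟨Y, ⟨hY, hY'⟩, rfl⟩
      · exact mem_of_notMem_succ hF h.1 h.2
      · obtain ⟨X', h1, rfl⟩ := exists_of_mem_succ hF hY hY'
        rwa [erase_insert (succ_notMem h1)])
    (by
      intro X hX Y hY
      have key : ∀ X, X ∈ F.filter (m + 1 ∉ ·) ∪ (F.filter (m + 1 ∈ ·)).image (·.erase (m + 1)) →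
          X ⊆ Icc 1 m ∧ (X ∈ F ∨ insert (m + 1) X ∈ F) := by
        intro X hX
        simp only [mem_union, mem_filter, mem_image] at hX
        rcases hX with h | ⟨Y, ⟨hY, hY'⟩, rfl⟩
        · exact ⟨mem_of_notMem_succ hF h.1 h.2, Or.inl h.1⟩
        · obtain ⟨X', h1, rfl⟩ := exists_of_mem_succ hF hY hY'
          rw [erase_insert (succ_notMem h1)]
          exact ⟨h1, Or.inr hY⟩
      obtain ⟨hXm, h1⟩ := key X hX
      obtain ⟨hYm, h2⟩ := key Y hY
      rcases h1 with h1 | h1 <;> rcases h2 with h2 | h2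
      · exact hF.ws _ h1 _ h2
      · exact (hF.ws _ h1 _ h2).of_insert hXm hYm
      · exact ((hF.ws _ h2 _ h1).of_insert hYm hXm).symm
      · exact (ws_insert_both (succ_notMem hXm) (succ_notMem hYm)).1 (hF.ws _ h1 _ h2))
  have low : ∀ {X}, X ∈ F → X ⊆ Icc 1 m → X ∈ H := fun {X} hX hXm => hGH (by
    simp only [mem_union, mem_filter]
    exact Or.inl ⟨hX, succ_notMem hXm⟩)
  have upp : ∀ {X}, insert (m + 1) X ∈ F → X ⊆ Icc 1 m → X ∈ H := fun {X} hX hXm => hGH (by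
    simp only [mem_union, mem_filter, mem_image]
    exact Or.inr ⟨_, ⟨hX, mem_insert_self _ _⟩, erase_insert (succ_notMem hXm)⟩)
  have ex : ∀ k, ∃ V, k ≤ m → #V = k ∧ V ⊆ Icc 1 m ∧ V ∈ F ∧ insert (m + 1) V ∈ F ∧
      (∀ X ∈ F, X ⊆ Icc 1 m → #X ≤ k → Pre X V) ∧
      ∀ X, insert (m + 1) X ∈ F → X ⊆ Icc 1 m → k ≤ #X → Pre V X := by
    intro k
    by_cases hk : k ≤ m
    swap
    · exact ⟨∅, fun h => absurd h hk⟩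
    have hinit : ∀ X ⊆ Icc 1 m, LD (Icc 1 k) X := by
      intro X hX a b ha ha' hb hb'
      have := mem_Icc.1 (hX hb)
      rw [mem_Icc] at *
      omega
    have hfin : ∀ X ⊆ Icc 1 m, LD X (Icc (m + 1 - k) m) := by
      intro X hX a b ha ha' hb hb'
      have := mem_Icc.1 (hX ha)
      rw [mem_Icc] at *
      omega
    have sub1 : Icc 1 k ⊆ Icc 1 m := Icc_subset_Icc le_rfl hk
    have sub2 : Icc (m + 1 - k) m ⊆ Icc 1 m := Icc_subset_Icc (by omega) le_rfl
    have mem1 : Icc 1 k ∈ H := hH.max _ sub1 fun X hX => (hinit X (hH.sub X hX)).ws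
    have mem2 : Icc (m + 1 - k) m ∈ H :=
      hH.max _ sub2 fun X hX => (hfin X (hH.sub X hX)).ws.symm
    have c1 : #(Icc 1 k) = k := by simp
    have c2 : #(Icc (m + 1 - k) m) = k := by rw [Nat.card_Icc]; omega
    obtain ⟨V, hV, h1, h2⟩ := hH.exists_interpolant (hgood H hH)
      (𝓨 := insert (Icc 1 k) (F.filter fun X => X ⊆ Icc 1 m ∧ #X ≤ k))
      (𝓧 := insert (Icc (m + 1 - k) m) (H.filter fun X => insert (m + 1) X ∈ F ∧ k ≤ #X))
      (insert_subset mem1 fun X hX => by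
        rw [mem_filter] at hX
        exact low hX.1 hX.2.1)
      (insert_subset mem2 (filter_subset _ _)) (insert_nonempty _ _) (insert_nonempty _ _)
      (by
        intro Y hY X hX
        simp only [mem_insert, mem_filter] at hY hX
        have cY : #Y ≤ k := by
          rcases hY with rfl | hY
          · omega
          · exact hY.2.2
        have cX : k ≤ #X := by
          rcases hX with rfl | hX
          · omega
          · exact hX.2.2
        have hXm : X ⊆ Icc 1 m := by
          rcases hX with rfl | hX
          · exact sub2
          · exact hH.sub X hX.1
        have hYm : Y ⊆ Icc 1 m := by
          rcases hY with rfl | hY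
          · exact sub1
          · exact hY.2.1
        rcases hY with rfl | hY
        · exact ⟨by omega, hinit X hXm⟩
        · rcases hX with rfl | hX
          · exact ⟨by omega, hfin Y hYm⟩
          · exact (hF.ws _ hY.1 _ hX.2.1).pre_of_insert hYm hXm (by omega))
    have hVm := hH.sub V hV
    have cV : #V = k := by
      have := (h1 _ (mem_insert_self _ _)).1
      have := (h2 _ (mem_insert_self _ _)).1
      omega
    have l1 : ∀ X ∈ F, X ⊆ Icc 1 m → #X ≤ k → Pre X V := fun X hX hXm hc =>
      h1 X (mem_insert_of_mem (mem_filter.2 ⟨hX, hXm, hc⟩))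
    have l2 : ∀ X, insert (m + 1) X ∈ F → X ⊆ Icc 1 m → k ≤ #X → Pre V X := fun X hX hXm hc =>
      h2 X (mem_insert_of_mem (mem_filter.2 ⟨upp hX hXm, hX, hc⟩))
    refine ⟨V, fun _ => ⟨cV, hVm, hF.mem_low hVm ?_ ?_, hF.mem_upp hVm ?_ ?_, l1, l2⟩⟩
    · exact fun X hX hXm => hH.ws V hV X (low hX hXm)
    · exact fun X hX hXm => ⟨hH.ws V hV X (upp hX hXm), fun h => l2 X hX hXm (by omega)⟩
    · exact fun X hX hXm => ⟨hH.ws V hV X (low hX hXm), fun h => l1 X hX hXm (by omega)⟩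
    · exact fun X hX hXm => hH.ws V hV X (upp hX hXm)
  choose P hP using ex
  exact ⟨H, P, hF, hH, low, upp, fun h => (hP _ h).1, fun h => (hP _ h).2.1,
    fun h => (hP _ h).2.2.1, fun h => (hP _ h).2.2.2.1, fun {X k} hk => (hP k hk).2.2.2.2.1 X,
    fun {X k} hk => (hP k hk).2.2.2.2.2 X⟩

end

namespace Cut

variable {m k : ℕ} {F H : Finset (Finset ℕ)} {P : ℕ → Finset ℕ} {Z : Finset ℕ}

theorem card_le (h : Cut m F H P) (hZ : Z ∈ H) : #Z ≤ m := card_le_of_subset_Icc (h.hH.sub Z hZ)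

theorem memP (h : Cut m F H P) (hk : k ≤ m) : P k ∈ H := h.low (h.lowP hk) (h.subP hk)

theorem trans (h : Cut m F H P) {A B C : Finset ℕ} (hA : A ∈ H) (hB : B ∈ H) (hC : C ∈ H)
    (h1 : Pre A B) (h2 : Pre B C) : Pre A C :=
  h1.trans (h.hH.sub A hA) (h.hH.sub B hB) (h.hH.sub C hC) h2 (h.hH.ws A hA C hC)

theorem mem_low (h : Cut m F H P) (hZ : Z ∈ H) (hp : Pre Z (P #Z)) : Z ∈ F := by
  have hZm := h.hH.sub Z hZ
  refine h.hF.mem_low hZm ?_ ?_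
  · exact fun X hX hXm => h.hH.ws Z hZ X (h.low hX hXm)
  · exact fun X hX hXm => ⟨h.hH.ws Z hZ X (h.upp hX hXm), fun hc =>
      h.trans hZ (h.memP (h.card_le hZ)) (h.upp hX hXm) hp (h.upp_pre (h.card_le hZ) hX hXm hc)⟩

theorem mem_upp (h : Cut m F H P) (hZ : Z ∈ H) (hp : Pre (P #Z) Z) : insert (m + 1) Z ∈ F := by
  have hZm := h.hH.sub Z hZ
  refine h.hF.mem_upp hZm ?_ ?_
  · exact fun X hX hXm => ⟨h.hH.ws Z hZ X (h.low hX hXm), fun hc =>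
      h.trans (h.low hX hXm) (h.memP (h.card_le hZ)) hZ (h.low_pre (h.card_le hZ) hX hXm hc) hp⟩
  · exact fun X hX hXm => h.hH.ws Z hZ X (h.upp hX hXm)

theorem eq_P (h : Cut m F H P) (hZm : Z ⊆ Icc 1 m) (h1 : Z ∈ F) (h2 : insert (m + 1) Z ∈ F) :
    Z = P #Z := by
  have hc := card_le_of_subset_Icc hZm
  exact (h.low_pre hc h1 hZm le_rfl).antisymm (h.upp_pre hc h2 hZm le_rfl)

theorem pre_P {l : ℕ} (h : Cut m F H P) (hkl : k ≤ l) (hl : l ≤ m) : Pre (P k) (P l) :=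
  h.low_pre hl (h.lowP (hkl.trans hl)) (h.subP (hkl.trans hl)) (by rw [h.cardP (hkl.trans hl)]; exact hkl)

theorem exists_insert_P (h : Cut m F H P) (hk : k < m) : ∃ c ∉ P k, insert c (P k) ∈ F ∧
    insert c (P k) ⊆ Icc 1 m ∧ insert c (P k) ∈ H := by
  have hs := h.subP hk.le
  have hc := h.cardP hk.le
  have hne : ∃ c, 1 ≤ c ∧ c < m + 1 ∧ c ∉ P k := by
    by_contra! hcon
    have : Icc 1 m ⊆ P k := fun x hx => hcon x (mem_Icc.1 hx).1 (by have := (mem_Icc.1 hx).2; omega)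
    have := card_le_card this
    rw [Nat.card_Icc] at this
    omega
  obtain ⟨c, h1, h2, h3⟩ := h.hF.exists_insert (h.lowP hk.le) (succ_notMem hs) (h.uppP hk.le) hne
  have := mem_Icc.1 (h.hF.sub _ h3 (mem_insert_self _ _))
  have h4 : insert c (P k) ⊆ Icc 1 m := insert_subset (by simp; omega) hs
  exact ⟨c, h2, h3, h4, h.low h3 h4⟩

theorem exists_erase_P (h : Cut m F H P) (hk : 0 < k) (hkm : k ≤ m) :
    ∃ b ∈ P k, insert (m + 1) ((P k).erase b) ∈ F ∧ (P k).erase b ∈ H := by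
  have hs := h.subP hkm
  obtain ⟨b, h1, h2⟩ := h.hF.exists_erase (h.lowP hkm) (succ_notMem hs) (h.uppP hkm)
    (card_pos.1 (by rw [h.cardP hkm]; exact hk))
  exact ⟨b, h1, h2, h.upp h2 ((erase_subset _ _).trans hs)⟩

theorem total (h : Cut m F H P) (hZ : Z ∈ H) : Pre Z (P #Z) ∨ Pre (P #Z) Z := by
  have hk := h.card_le hZ
  have hc := h.cardP hk
  have hP := h.memP hk
  have hws := h.hH.ws _ hZ _ hP
  rcases ld_or_inner Z (P #Z) with h1 | h1 | h1 | h1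
  · exact Or.inl ⟨hc.ge, h1⟩
  · exact Or.inr ⟨hc.le, h1⟩
  · have hk' : #Z < m := by
      refine lt_of_le_of_ne hk fun he => ?_
      obtain ⟨_, a, _, _, _, _, _, ha, ha', _⟩ := h1
      have : P #Z = Icc 1 m := eq_of_subset_of_card_le (h.subP hk) (by rw [hc]; simp [he])
      rw [this] at ha'
      exact ha' (h.hH.sub Z hZ ha)
    obtain ⟨c, hcP, -, -, h3⟩ := h.exists_insert_P hk'
    obtain ⟨b, a, b', i1, i2, hb, hb', ha, ha', hd, hd', hac⟩ :=
      h1.exists_between_ne hc.symm hws.nc hws.nc' c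
    have := (h.hH.ws _ h3 _ hZ).alt b a b' i1 i2 (mem_insert_of_mem hb) hb' ha
      (by simp [hac, ha']) (mem_insert_of_mem hd) hd'
    rw [card_insert_of_notMem hcP] at this
    omega
  · obtain ⟨_, a, _, _, _, _, _, haP, _, _⟩ := id h1
    obtain ⟨c, hcP, -, h3⟩ := h.exists_erase_P (k := #Z)
      (by rw [← hc]; exact card_pos.2 ⟨a, haP⟩) hk
    obtain ⟨b, a, b', i1, i2, hb, hb', ha, ha', hd, hd', hac⟩ :=
      h1.exists_between_ne hc hws.nc' hws.nc c
    have := (h.hH.ws _ hZ _ h3).alt b a b' i1 i2 hb (by simp [hb']) (by simp [hac, ha]) ha' hd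
      (by simp [hd'])
    have := card_erase_add_one hcP
    omega

theorem pre_of_notMem_low (h : Cut m F H P) (hZ : Z ∈ H) (hF : Z ∉ F) : Pre (P #Z) Z :=
  (h.total hZ).resolve_left fun hp => hF (h.mem_low hZ hp)

theorem pre_of_notMem_upp (h : Cut m F H P) (hZ : Z ∈ H) (hF : insert (m + 1) Z ∉ F) :
    Pre Z (P #Z) :=
  (h.total hZ).resolve_right fun hp => hF (h.mem_upp hZ hp)

theorem low_or_upp (h : Cut m F H P) (hZ : Z ∈ H) : Z ∈ F ∨ insert (m + 1) Z ∈ F :=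
  (h.total hZ).imp (h.mem_low hZ) (h.mem_upp hZ)

theorem card_eq (h : Cut m F H P) : #F = #H + (m + 1) := by
  classical
  set L := F.filter (m + 1 ∉ ·)
  set U := H.filter (insert (m + 1) · ∈ F)
  have hF : F = L ∪ U.image (insert (m + 1)) := by
    ext X
    simp only [L, U, mem_union, mem_filter, mem_image]
    constructor
    · intro hX
      rcases h.hF.cases_succ hX with h1 | ⟨X', h1, rfl⟩
      · exact Or.inl ⟨hX, succ_notMem h1⟩
      · exact Or.inr ⟨X', ⟨h.upp hX h1, hX⟩, rfl⟩
    · rintro (h | ⟨X, h, rfl⟩)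
      · exact h.1
      · exact h.2
  have hH : H = L ∪ U := by
    ext X
    simp only [L, U, mem_union, mem_filter]
    constructor
    · intro hX
      rcases h.low_or_upp hX with h1 | h1
      · exact Or.inl ⟨h1, succ_notMem (h.hH.sub X hX)⟩
      · exact Or.inr ⟨hX, h1⟩
    · rintro (h1 | h1)
      · exact h.low h1.1 (mem_of_notMem_succ h.hF h1.1 h1.2)
      · exact h1.1
  have hI : L ∩ U = (range (m + 1)).image P := by
    ext X
    simp only [L, U, mem_inter, mem_filter, mem_image, mem_range]
    constructor
    · rintro ⟨⟨h1, -⟩, h2, h3⟩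
      exact ⟨#X, by have := h.card_le h2; omega, (h.eq_P (h.hH.sub X h2) h1 h3).symm⟩
    · rintro ⟨k, hk, rfl⟩
      have hk : k ≤ m := by omega
      exact ⟨⟨h.lowP hk, succ_notMem (h.subP hk)⟩, h.memP hk, h.uppP hk⟩
  have e1 : #F = #L + #U := by
    conv_lhs => rw [hF]
    rw [card_union_of_disjoint, card_image_of_injOn]
    · intro A hA B hB he
      have hA := h.hH.sub A (mem_filter.1 hA).1
      have hB := h.hH.sub B (mem_filter.1 hB).1
      rw [← erase_insert (succ_notMem hA), ← erase_insert (succ_notMem hB)]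
      exact congrArg (·.erase (m + 1)) he
    · rw [disjoint_left]
      intro X hX hX'
      obtain ⟨Y, -, rfl⟩ := mem_image.1 hX'
      exact (mem_filter.1 hX).2 (mem_insert_self _ _)
  have e2 : #(L ∩ U) = m + 1 := by
    rw [hI, card_image_of_injOn, card_range]
    intro a ha b hb he
    have ha : a ≤ m := by simp at ha; omega
    have hb : b ≤ m := by simp at hb; omega
    rw [← h.cardP ha, ← h.cardP hb]
    exact congrArg card he
  have := card_union_add_card_inter L U
  rw [← hH] at this
  omega

end Cut

section Between

variable {S P W Q : Finset ℕ} {b c : ℕ}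

theorem eq_erase_of_subset {A B : Finset ℕ} (h : A ⊆ B) (hc : #A + 1 = #B) :
    ∃ x ∈ B, x ∉ A ∧ A = B.erase x := by
  obtain ⟨x, hx, hx'⟩ := exists_mem_notMem_of_card (A := A) (B := B) (by omega)
    (by rintro rfl; omega)
  refine ⟨x, hx, hx', eq_of_subset_of_card_le (subset_erase.2 ⟨h, hx'⟩) ?_⟩
  rw [card_erase_of_mem hx]
  omega

theorem LD.insert_erase (hbc : b < c) : LD S (insert c (S.erase b)) := by
  intro x y hx hx' hy hy'
  simp only [mem_insert, mem_erase, not_or] at *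
  have : x = b := by tauto
  have : y = c := by tauto
  omega

theorem LD.insert_erase' (hbc : b < c) :
    LD S ((insert c S).erase b) := by
  rw [erase_insert_of_ne hbc.ne']
  exact LD.insert_erase hbc

theorem LD.insert_insert (hbc : b < c) : LD (insert b S) (insert c S) := by
  intro x y hx hx' hy hy'
  simp only [mem_insert, not_or] at *
  have : x = b := by tauto
  have : y = c := by tauto
  omega

theorem eq_erase_of_ld_insert (h1 : LD S P) (h2 : LD P (insert c S)) (hc : c ∉ S)
    (hcard : #P = #S) (hne : P ≠ S) : ∃ x ∈ S, x < c ∧ P = (insert c S).erase x := by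
  obtain ⟨s, hs, hs'⟩ := exists_mem_notMem_of_card hcard.le hne
  have hsub : P ⊆ insert c S := by
    intro p hp
    by_contra hp'
    have i1 := h2 p s hp hp' (mem_insert_of_mem hs) hs'
    have i2 := h1 s p hs hs' hp fun h => hp' (mem_insert_of_mem h)
    omega
  obtain ⟨x, hx, hx', rfl⟩ := eq_erase_of_subset hsub (by rw [card_insert_of_notMem hc, hcard])
  have hxc : x ≠ c := by
    rintro rfl
    exact hne (erase_insert hc)
  have hxS : x ∈ S := (mem_insert.1 hx).resolve_left hxc
  exact ⟨x, hxS, h1 x c hxS hx' (mem_erase.2 ⟨hxc.symm, mem_insert_self _ _⟩) hc, rfl⟩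

theorem eq_insert_of_ld_insert {c' : ℕ} (h1 : LD (insert c S) P) (h2 : LD P (insert c' S))
    (hc : c ∉ S) (hc' : c' ∉ S) (hcc : c < c') (hcard : #P = #S + 1) (hws : WS P S) :
    ∃ x, c ≤ x ∧ x ∉ S ∧ P = insert x S := by
  have hsub : S ⊆ P := by
    intro s hs
    by_contra hsP
    have e0 : ∀ p ∈ P, p ∉ insert c S → p = c' := by
      intro p hp hp'
      by_contra hpc
      have i1 := h1 s p (mem_insert_of_mem hs) hsP hp hp'
      have i2 := h2 p s hp (by simp only [mem_insert, not_or] at *; tauto) (mem_insert_of_mem hs) hsP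
      omega
    obtain ⟨p, hp, hp'⟩ := exists_mem_notMem_of_card (A := insert c S) (B := P)
      (by rw [card_insert_of_notMem hc, hcard]) (by rintro rfl; exact hsP (mem_insert_of_mem hs))
    obtain rfl := e0 p hp hp'
    have hcP : c ∈ P := by
      by_contra hcP
      have hs2 : P ⊆ insert p (S.erase s) := by
        intro q hq
        by_cases hqc : q ∈ insert c S
        · rw [mem_insert] at hqc
          rcases hqc with rfl | hqc
          · exact absurd hq hcP
          · refine mem_insert_of_mem (mem_erase.2 ⟨?_, hqc⟩)
            rintro rfl
            exact hsP hq
        · rw [e0 q hq hqc]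
          exact mem_insert_self _ _
      have := card_le_card hs2
      have := card_insert_le p (S.erase s)
      have := card_erase_add_one hs
      omega
    have i1 := h2 c s hcP (by simp only [mem_insert, not_or]; exact ⟨hcc.ne, hc⟩)
      (mem_insert_of_mem hs) hsP
    have i2 := h1 s p (mem_insert_of_mem hs) hsP hp hp'
    have := hws.alt c s p i1 i2 hcP hc hs hsP hp hc'
    omega
  obtain ⟨x, hx, hx', e⟩ := eq_erase_of_subset hsub hcard.symm
  have e : P = insert x S := by rw [e, Finset.insert_erase hx]
  refine ⟨x, ?_, hx', e⟩
  by_cases hxc : x = c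
  · exact hxc.ge
  · exact (h1 c x (mem_insert_self _ _) (by rw [e]; simp [hc]; omega) hx (by simp [hxc, hx'])).le

theorem eq_erase_of_ld_erase (h1 : LD S P) (h2 : LD P ((insert c S).erase b)) (hc : c ∉ S)
    (hb : b ∈ S) (hbc : b < c) (hcard : #P = #S) (hws : WS P (insert c S)) :
    ∃ x ∈ insert c S, x ≤ c ∧ P = (insert c S).erase x := by
  have cS := card_insert_of_notMem hc
  have hsub : P ⊆ insert c S := by
    intro p hp
    by_contra hp'
    have hpS : p ∉ S := fun h => hp' (mem_insert_of_mem h)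
    have hpc : p ≠ c := by rintro rfl; exact hp' (mem_insert_self _ _)
    have e0 : ∀ s ∈ S, s ∉ P → s = b := by
      intro s hs hs'
      by_contra hsb
      have i1 := h1 s p hs hs' hp hpS
      have i2 := h2 p s hp (fun h => hp' (mem_of_mem_erase h))
        (mem_erase.2 ⟨hsb, mem_insert_of_mem hs⟩) hs'
      omega
    obtain ⟨s, hs, hs'⟩ := exists_mem_notMem_of_card hcard.le (by rintro rfl; exact hpS hp)
    obtain rfl := e0 s hs hs'
    have hcP : c ∉ P := by
      intro hcP
      have hs2 : S.erase s ⊆ (P.erase p).erase c := by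
        intro q hq
        rw [mem_erase] at hq
        rw [mem_erase, mem_erase]
        refine ⟨?_, ?_, ?_⟩
        · rintro rfl; exact hc hq.2
        · rintro rfl; exact hpS hq.2
        · by_contra hqP; exact hq.1 (e0 q hq.2 hqP)
      have := card_le_card hs2
      have := card_erase_add_one hs
      have := card_erase_add_one hp
      have := card_erase_add_one (mem_erase.2 ⟨hpc.symm, hcP⟩)
      omega
    have i1 := h1 s p hs hs' hp hpS
    have i2 := h2 p c hp (fun h => hp' (mem_of_mem_erase h))
      (mem_erase.2 ⟨hbc.ne', mem_insert_self _ _⟩) hcP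
    have := hws.alt' s p c i1 i2 (mem_insert_of_mem hs) hs' hp hp' (mem_insert_self _ _) hcP
    omega
  obtain ⟨x, hx, hx', e⟩ := eq_erase_of_subset hsub (by omega)
  refine ⟨x, hx, ?_, e⟩
  by_cases hxc : x = c
  · exact hxc.le
  · exact (h1 x c ((mem_insert.1 hx).resolve_left hxc) hx' (by rw [e]; simp; omega) hc).le

theorem LD.insert_of_ws (h : LD W P) (hcard : #W = #P) (hne : W ≠ P) (hc : c ∉ W)
    (hws : WS (insert c W) P) : LD (insert c W) P := by
  intro x p hx hx' hp hp'
  have hpW : p ∉ W := fun h => hp' (mem_insert_of_mem h)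
  have hpc : p ≠ c := by rintro rfl; exact hp' (mem_insert_self _ _)
  rw [mem_insert] at hx
  rcases hx with rfl | hx
  · by_contra hlt
    obtain ⟨w, hw, hw'⟩ := exists_mem_notMem_of_card hcard.ge hne.symm
    have i1 := h w p hw hw' hp hpW
    have := hws.alt w p x i1 (by omega) (mem_insert_of_mem hw) hw' hp hp' (mem_insert_self _ _) hx'
    rw [card_insert_of_notMem hc] at this
    omega
  · exact h x p hx hx' hp hpW

theorem LD.erase_of_ws (h : LD W Q) (hcard : #W = #Q) (hne : W ≠ Q) (hb : b ∈ W)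
    (hws : WS (W.erase b) Q) : LD (W.erase b) Q := by
  intro w q hw hw' hq hq'
  rw [mem_erase] at hw
  by_cases hqb : q = b
  · subst hqb
    by_contra hlt
    obtain ⟨p, hp, hp'⟩ := exists_mem_notMem_of_card hcard.le hne
    have i1 := h w p hw.2 hw' hp hp'
    have := hws.alt' q w p (by omega) i1 hq hq' (mem_erase.2 hw) hw' hp
      (fun h => hp' (mem_of_mem_erase h))
    have := card_erase_add_one hb
    omega
  · exact h w q hw.2 hw' hq fun h => hq' (mem_erase.2 ⟨hqb, h⟩)

theorem LD.right_Icc {m : ℕ} {X : Finset ℕ} (hX : X ⊆ Icc 1 m) (c : ℕ) : LD X (Icc c m) := by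
  intro a b ha ha' hb hb'
  have := mem_Icc.1 (hX ha)
  rw [mem_Icc] at *
  omega

end Between

namespace Cut

variable {m k : ℕ} {F H : Finset (Finset ℕ)} {P : ℕ → Finset ℕ} {Z : Finset ℕ}

theorem mem_upp_of_ld (h : Cut m F H P) {A : Finset ℕ} (hZ : Z ∈ H) (hA : A ⊆ Icc 1 m)
    (hAF : insert (m + 1) A ∈ F) (hc : #A = #Z) (hl : LD A Z) : insert (m + 1) Z ∈ F :=
  h.mem_upp hZ (h.trans (h.memP (h.card_le hZ)) (h.upp hAF hA) hZ
    (h.upp_pre (h.card_le hZ) hAF hA hc.ge) ⟨hc.le, hl⟩)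

theorem mem_low_of_ld (h : Cut m F H P) {A : Finset ℕ} (hZ : Z ∈ H) (hA : A ⊆ Icc 1 m)
    (hAF : A ∈ F) (hc : #Z = #A) (hl : LD Z A) : Z ∈ F :=
  h.mem_low hZ (h.trans hZ (h.low hAF hA) (h.memP (h.card_le hZ)) ⟨hc.le, hl⟩
    (h.low_pre (h.card_le hZ) hAF hA hc.ge))

theorem vright (h : Cut m F H P) (hv : VRight m H) : VRight (m + 1) F := by
  intro S c hc hS hSc
  by_cases hcN : c = m + 1
  · subst hcN
    rcases S.eq_empty_or_nonempty with rfl | hne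
    · right; right; simp
    · obtain ⟨b, hb, hb'⟩ := h.hF.exists_erase hS hc hSc hne
      refine Or.inr (Or.inl ⟨b, hb, ?_, ?_⟩)
      · have := mem_Icc.1 (h.hF.sub S hS hb)
        have : b ≠ m + 1 := by rintro rfl; exact hc hb
        omega
      · rwa [erase_insert_of_ne]
        rintro rfl; exact hc hb
  have hcm := mem_Icc.1 (h.hF.sub _ hSc (mem_insert_self _ _))
  rcases h.hF.cases_succ hS with hSm | ⟨S', hSm, rfl⟩
  · have hScm : insert c S ⊆ Icc 1 m := insert_subset (by simp; omega) hSm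
    have cS := card_insert_of_notMem hc
    have cSm := card_le_of_subset_Icc hScm
    have p1 := h.low_pre (by omega) hSc hScm cS.le
    have p0 := h.low_pre (by omega) hS hSm le_rfl
    have c0 := h.cardP (k := #S) (by omega)
    have c1 := h.cardP (k := #S + 1) (by omega)
    have done : P #S = S → ∃ c', c < c' ∧ c' ∉ S ∧ insert c' S ∈ F := by
      intro e
      refine ⟨m + 1, by omega, succ_notMem hSm, ?_⟩
      have := h.uppP (k := #S) (by omega)
      rwa [e] at this
    rcases hv S c hc (h.low hS hSm) (h.low hSc hScm) with ⟨c', i1, i2, i3⟩ | ⟨b, i1, i2, i3⟩ | hb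
    · by_cases hF : insert c' S ∈ F
      · exact Or.inl ⟨c', i1, i2, hF⟩
      have p2 := h.pre_of_notMem_low i3 hF
      rw [card_insert_of_notMem i2] at p2
      obtain ⟨x, hcx, hxS, e⟩ := eq_insert_of_ld_insert p1.2 p2.2 hc i2 i1 c1
        (h.hF.ws _ (h.lowP (by omega)) _ hS)
      by_cases hxc : x = c
      · subst hxc
        by_cases hPS : P #S = S
        · exact Or.inl (done hPS)
        have p3 := h.pre_P (k := #S) (l := #S + 1) (by omega) (by omega)
        rw [e] at p3
        obtain ⟨y, hy, hyx, e'⟩ := eq_erase_of_ld_insert p0.2 p3.2 hc c0 hPS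
        exact Or.inr (Or.inl ⟨y, hy, hyx, by rw [← e']; exact h.lowP (by omega)⟩)
      · exact Or.inl ⟨x, by omega, hxS, by rw [← e]; exact h.lowP (by omega)⟩
    · by_cases hF : (insert c S).erase b ∈ F
      · exact Or.inr (Or.inl ⟨b, i1, i2, hF⟩)
      have p2 := h.pre_of_notMem_low i3 hF
      rw [card_erase_of_mem (mem_insert_of_mem i1), cS, Nat.add_sub_cancel] at p2
      obtain ⟨x, hx, hxc, e⟩ := eq_erase_of_ld_erase p0.2 p2.2 hc i1 i2 c0
        (h.hF.ws _ (h.lowP (by omega)) _ hSc)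
      by_cases hxc : x = c
      · subst hxc
        rw [erase_insert hc] at e
        exact Or.inl (done e)
      · refine Or.inr (Or.inl ⟨x, (mem_insert.1 hx).resolve_left hxc, by omega, ?_⟩)
        rw [← e]; exact h.lowP (by omega)
    · left
      apply done
      have e : S = Icc (c + 1) m := by
        ext x
        have h1 := congrArg (x ∈ ·) hb
        simp only [mem_insert, mem_Icc, eq_iff_iff] at h1 ⊢
        by_cases hx : x = c
        · subst hx
          simp only [hc, false_iff]
          omega
        · simp only [hx, false_or] at h1
          rw [h1]
          omega
      refine (LD.antisymm c0.symm p0.2 ?_).symm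
      have := LD.right_Icc (h.subP (k := #S) (by omega)) (c + 1)
      rwa [← e] at this
  · have hcS : c ∉ S' := fun h => hc (mem_insert_of_mem h)
    have hScm : insert c S' ⊆ Icc 1 m := insert_subset (by simp; omega) hSm
    rw [Finset.insert_comm] at hSc
    rcases hv S' c hcS (h.upp hS hSm) (h.upp hSc hScm) with
      ⟨c', i1, i2, i3⟩ | ⟨b, i1, i2, i3⟩ | hb
    · refine Or.inl ⟨c', i1, ?_, ?_⟩
      · have := mem_Icc.1 (h.hH.sub _ i3 (mem_insert_self _ _))
        simp only [mem_insert, not_or]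
        exact ⟨by omega, i2⟩
      · rw [Finset.insert_comm]
        refine h.mem_upp_of_ld i3 hScm hSc ?_ (LD.insert_insert i1)
        rw [card_insert_of_notMem hcS, card_insert_of_notMem i2]
    · refine Or.inr (Or.inl ⟨b, mem_insert_of_mem i1, i2, ?_⟩)
      have hbm := mem_Icc.1 (hSm i1)
      rw [Finset.insert_comm, erase_insert_of_ne (by omega)]
      refine h.mem_upp_of_ld i3 hSm hS ?_ (LD.insert_erase' i2)
      rw [card_erase_of_mem (mem_insert_of_mem i1), card_insert_of_notMem hcS]
      rfl
    · right; right
      rw [Finset.insert_comm, hb]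
      ext x
      simp only [mem_insert, mem_Icc]
      omega

end Cut

/-- `Z` arises from `Y` by adding an element or by moving an element to the right. -/
def IsStep (Y Z : Finset ℕ) : Prop :=
  (∃ c, c ∉ Y ∧ Z = insert c Y) ∨ ∃ b c, b ∈ Y ∧ c ∉ Y ∧ b < c ∧ Z = insert c (Y.erase b)

theorem IsStep.pre {Y Z : Finset ℕ} (h : IsStep Y Z) : Pre Y Z := by
  rcases h with ⟨c, hc, rfl⟩ | ⟨b, c, hb, hc, hbc, rfl⟩
  · exact ⟨by rw [card_insert_of_notMem hc]; omega,
      fun a _ ha ha' => absurd (mem_insert_of_mem ha) ha'⟩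
  · refine ⟨?_, LD.insert_erase hbc⟩
    rw [card_insert_of_notMem (by simp [hc]), card_erase_add_one hb]

theorem IsStep.insert {Y Z : Finset ℕ} {a : ℕ} (h : IsStep Y Z) (ha : a ∉ Z) :
    IsStep (insert a Y) (insert a Z) := by
  rcases h with ⟨c, hc, rfl⟩ | ⟨b, c, hb, hc, hbc, rfl⟩
  · rw [mem_insert, not_or] at ha
    exact Or.inl ⟨c, by simp only [mem_insert, not_or]; exact ⟨fun h => ha.1 h.symm, hc⟩,
      Finset.insert_comm _ _ _⟩
  · rw [mem_insert, mem_erase, not_or] at ha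
    by_cases hab : a = b
    · subst hab
      rw [insert_eq_of_mem hb]
      left
      refine ⟨c, hc, ?_⟩
      rw [Finset.insert_comm, Finset.insert_erase hb]
    · refine Or.inr ⟨b, c, mem_insert_of_mem hb, ?_, hbc, ?_⟩
      · simp only [mem_insert, not_or]
        exact ⟨fun h => ha.1 h.symm, hc⟩
      · rw [erase_insert_of_ne hab, Finset.insert_comm]

theorem Pre.insert_both {m : ℕ} {Y X : Finset ℕ} (h : Pre Y X) (hY : Y ⊆ Icc 1 m)
    (hX : X ⊆ Icc 1 m) : Pre (insert (m + 1) Y) (insert (m + 1) X) :=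
  ⟨by rw [card_insert_succ hY, card_insert_succ hX]; have := h.1; omega, h.2.insert_both _⟩

theorem Mx.trans {n : ℕ} {F : Finset (Finset ℕ)} (hF : Mx n F) {A B C : Finset ℕ} (hA : A ∈ F)
    (hB : B ∈ F) (hC : C ∈ F) (h1 : Pre A B) (h2 : Pre B C) : Pre A C :=
  h1.trans (hF.sub A hA) (hF.sub B hB) (hF.sub C hC) h2 (hF.ws A hA C hC)

namespace Cut

variable {m : ℕ} {F H : Finset (Finset ℕ)} {P : ℕ → Finset ℕ} {X Y : Finset ℕ}

theorem step_low (h : Cut m F H P) (hch : ChainUp H) (hY : Y ∈ F) (hYm : Y ⊆ Icc 1 m)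
    (hne : Y ≠ P #Y) : ∃ Z ∈ F, Z ⊆ Icc 1 m ∧ Pre Z (P #Y) ∧ IsStep Y Z := by
  have hk := card_le_of_subset_Icc hYm
  obtain ⟨Z, hZ, h1, h2⟩ := hch Y (h.low hY hYm) _ (h.memP hk) (h.low_pre hk hY hYm le_rfl) hne
  have e := h1.1
  rw [h.cardP hk] at e
  have e : #Z = #Y := le_antisymm e (IsStep.pre h2).1
  exact ⟨Z, h.mem_low hZ (by rwa [e]), h.hH.sub Z hZ, h1, h2⟩

theorem chain_low_low (h : Cut m F H P) (hch : ChainUp H) (hvl : VLeft F) (hY : Y ∈ F)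
    (hYm : Y ⊆ Icc 1 m) (hX : X ∈ F) (hXm : X ⊆ Icc 1 m) (hYX : Pre Y X) (hne : Y ≠ X) :
    ∃ Z ∈ F, Pre Z X ∧ IsStep Y Z := by
  have hk := card_le_of_subset_Icc hYm
  have hYH := h.low hY hYm
  have hXH := h.low hX hXm
  by_cases hYP : Y = P #Y
  · have hlt : #Y < #X := by
      by_contra hlt
      have := h.low_pre hk hX hXm (by omega)
      rw [← hYP] at this
      exact hne (hYX.antisymm this)
    have hkm : #Y < m := hlt.trans_le (card_le_of_subset_Icc hXm)
    obtain ⟨c₀, h1, h2, h3, -⟩ := h.exists_insert_P hkm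
    rw [← hYP] at h1 h2 h3
    obtain ⟨c, hc, hmin⟩ := exists_min_image
      ((Icc 1 m).filter fun c => c ∉ Y ∧ insert c Y ∈ F) id
      ⟨c₀, mem_filter.2 ⟨h3 (mem_insert_self _ _), h1, h2⟩⟩
    simp only [mem_filter, mem_Icc, id, and_imp] at hc hmin
    obtain ⟨hcm, hcY, hcF⟩ := hc
    refine ⟨_, hcF, ⟨by rw [card_insert_of_notMem hcY]; omega, ?_⟩, Or.inl ⟨c, hcY, rfl⟩⟩
    intro a v ha ha' hv hv'
    rw [mem_insert, not_or] at hv'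
    rw [mem_insert] at ha
    rcases ha with rfl | ha
    swap
    · exact hYX.2 a v ha ha' hv hv'.2
    by_contra hlt
    rcases hvl Y a hcY hY hcF with ⟨c', i1, i2, i3⟩ | ⟨b, i1, i2, i3⟩ | hb
    · have := mem_Icc.1 (h.hF.sub _ i3 (mem_insert_self _ _))
      have := hmin c' (by omega) (by omega) i2 i3
      omega
    · have hbX : b ∈ X := by
        by_contra hbX
        have := hYX.2 b v i1 hbX hv hv'.2
        omega
      have := (h.hF.ws _ hX _ i3).alt v a b (by omega) i2 hv (by simp [hv']) (by simp [i2.ne]) ha' hbX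
        (by simp)
      rw [card_erase_of_mem (mem_insert_of_mem i1), card_insert_of_notMem hcY] at this
      omega
    · have := mem_Icc.1 (hXm hv)
      have : v ∈ insert a Y := by rw [hb, mem_Icc]; omega
      rw [mem_insert] at this
      tauto
  · obtain ⟨Z, hZ, h1, h2⟩ := hch Y hYH X hXH hYX hne
    by_cases hZF : Z ∈ F
    · exact ⟨Z, hZF, h1, h2⟩
    obtain ⟨Z', i1, i2, i3, i4⟩ := h.step_low hch hY hYm hYP
    have hZm := h.card_le hZ
    have hZ'H := h.low i1 i2
    refine ⟨Z', i1, ?_, i4⟩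
    exact h.trans hZ'H (h.memP hk) hXH i3 (h.trans (h.memP hk) (h.memP hZm) hXH
      (h.pre_P (IsStep.pre h2).1 hZm) (h.trans (h.memP hZm) hZ hXH (h.pre_of_notMem_low hZ hZF) h1))

theorem chain_low_upp_le (h : Cut m F H P) (hch : ChainUp H) (hY : Y ∈ F)
    (hYm : Y ⊆ Icc 1 m) (hX : insert (m + 1) X ∈ F) (hXm : X ⊆ Icc 1 m) (hc : #Y ≤ #X) :
    ∃ Z ∈ F, Pre Z (insert (m + 1) X) ∧ IsStep Y Z := by
  have hk := card_le_of_subset_Icc hYm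
  have hYX := (h.hF.ws _ hY _ hX).pre_of_insert hYm hXm hc
  by_cases hYP : Y = P #Y
  · refine ⟨insert (m + 1) Y, ?_, hYX.insert_both hYm hXm, Or.inl ⟨m + 1, succ_notMem hYm, rfl⟩⟩
    rw [hYP]
    exact h.uppP hk
  · obtain ⟨Z, i1, i2, i3, i4⟩ := h.step_low hch hY hYm hYP
    have := h.trans (h.low i1 i2) (h.memP hk) (h.upp hX hXm) i3 (h.upp_pre hk hX hXm hc)
    exact ⟨Z, i1, ⟨this.1.trans (by rw [card_insert_succ hXm]; omega), this.2.insert_right i2⟩, i4⟩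

theorem chain_top (h : Cut m F H P) (hvl : VLeft H) (hX : insert (m + 1) X ∈ F)
    (hXm : X ⊆ Icc 1 m) (hk : #X < m) (hl : LD (P (#X + 1)) X) :
    ∃ c ∈ P (#X + 1), insert (m + 1) ((P (#X + 1)).erase c) ∈ F ∧ LD ((P (#X + 1)).erase c) X := by
  obtain ⟨c₀, h1, h2, -⟩ := h.exists_erase_P (k := #X + 1) (by omega) hk
  have hQm := h.subP (k := #X + 1) hk
  have hQF := h.lowP (k := #X + 1) hk
  have hQc := h.cardP (k := #X + 1) hk
  set Q := P (#X + 1) with hQ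
  obtain ⟨c, hc, hmax⟩ := exists_max_image
      (Q.filter fun c => insert (m + 1) (Q.erase c) ∈ F) id ⟨c₀, mem_filter.2 ⟨h1, h2⟩⟩
  simp only [mem_filter, id, and_imp] at hc hmax
  obtain ⟨hcQ, hcF⟩ := hc
  refine ⟨c, hcQ, hcF, ?_⟩
  have hSm : Q.erase c ⊆ Icc 1 m := (erase_subset _ _).trans hQm
  have cS := card_erase_add_one hcQ
  intro u v hu hu' hv hv'
  rw [mem_erase] at hu
  by_cases hvc : v = c
  swap
  · exact hl u v hu.2 hu' hv fun h => hv' (mem_erase.2 ⟨hvc, h⟩)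
  subst hvc
  by_contra hlt
  have hum := mem_Icc.1 (hQm hu.2)
  have hvm := mem_Icc.1 (hQm hcQ)
  have e : insert v (Q.erase v) = Q := Finset.insert_erase hcQ
  rcases hvl (Q.erase v) v (by simp) (h.upp hcF hSm) (by rw [e]; exact h.low hQF hQm) with
    ⟨c', i1, i2, i3⟩ | ⟨b, i1, i2, i3⟩ | hb
  · have hc'Q : c' ∉ Q := fun h => i2 (mem_erase.2 ⟨i1.ne, h⟩)
    have i4 : insert c' (Q.erase v) ∈ F := by
      refine h.mem_low_of_ld i3 hQm hQF ?_ ?_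
      · rw [card_insert_of_notMem i2, cS]
      · have := LD.insert_insert (S := Q.erase v) i1
        rwa [e] at this
    have hc'X : c' ∉ X := by
      intro hc'X
      have := hl u c' hu.2 hu' hc'X hc'Q
      omega
    refine (h.hF.ws _ i4 _ hX).nc c' v u (m + 1) i1 (by omega) (by omega) (mem_insert_self _ _) ?_
      (mem_insert_of_mem hv) ?_ (mem_insert_of_mem (mem_erase.2 hu)) ?_ (mem_insert_self _ _) ?_
    · simp only [mem_insert, not_or]; exact ⟨by omega, hc'X⟩
    · simp only [mem_insert, mem_erase, not_or]; exact ⟨by omega, by simp⟩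
    · simp only [mem_insert, not_or]; exact ⟨by omega, hu'⟩
    · exact succ_notMem (h.hH.sub _ i3)
  · rw [e] at i3
    have hbQ := mem_of_mem_erase i1
    have cb := card_erase_add_one hbQ
    have hbF : insert (m + 1) (Q.erase b) ∉ F := fun h' => by
      have := hmax b hbQ h'
      omega
    have p1 := h.pre_of_notMem_upp i3 hbF
    rw [show #(Q.erase b) = #X by omega] at p1
    have p2 := h.upp_pre (k := #X) hk.le hcF hSm (by omega)
    obtain ⟨x, hx, -, ex⟩ := eq_erase_of_ld_erase (S := Q.erase b) (c := b) (b := v) p1.2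
      (by rw [Finset.insert_erase hbQ]; exact p2.2) (by simp) (mem_erase.2 ⟨i2.ne, hcQ⟩) i2
      (by rw [h.cardP hk.le]; omega)
      (by rw [Finset.insert_erase hbQ]; exact h.hF.ws _ (h.lowP hk.le) _ hQF)
    rw [Finset.insert_erase hbQ] at ex hx
    have p3 := h.upp_pre (k := #X) hk.le hX hXm le_rfl
    have p4 := h.uppP (k := #X) hk.le
    rw [ex] at p2 p3 p4
    have := hmax x hx p4
    have hxv : x = v := by
      by_contra hxv
      have := p2.2 v x (mem_erase.2 ⟨fun h => hxv h.symm, hcQ⟩) (by simp) (mem_erase.2 ⟨hxv, hx⟩)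
        (by simp)
      omega
    subst hxv
    have := p3.2 u x (mem_erase.2 hu) hu' hv hv'
    omega
  · rw [e] at hb
    have := hu.2
    rw [hb, mem_Icc] at this
    omega

end Cut

namespace Cut

variable {m : ℕ} {F H : Finset (Finset ℕ)} {P : ℕ → Finset ℕ} {X Y : Finset ℕ}

theorem chain_low_upp_succ (h : Cut m F H P) (hch : ChainUp H) (hcd : ChainDown H)
    (hvl : VLeft H) (hvr : VRight (m + 1) F) (hY : Y ∈ F) (hYm : Y ⊆ Icc 1 m)
    (hX : insert (m + 1) X ∈ F) (hXm : X ⊆ Icc 1 m) (hc : #Y = #X + 1) (hl : LD Y X) :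
    ∃ Z ∈ F, Pre Z (insert (m + 1) X) ∧ IsStep Y Z := by
  have hk := card_le_of_subset_Icc hYm
  have hXk := card_le_of_subset_Icc hXm
  have cX := card_insert_succ hXm
  have hNY := succ_notMem hYm
  have step : ∀ c ∈ Y, insert (m + 1) (Y.erase c) ∈ F → Pre (Y.erase c) X →
      ∃ Z ∈ F, Pre Z (insert (m + 1) X) ∧ IsStep Y Z := by
    intro c hcY hF hp
    refine ⟨_, hF, hp.insert_both ((erase_subset _ _).trans hYm) hXm, Or.inr
      ⟨c, m + 1, hcY, hNY, ?_, rfl⟩⟩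
    have := mem_Icc.1 (hYm hcY)
    omega
  by_cases hsub : X ⊆ Y
  · obtain ⟨c, hcY, hcX, rfl⟩ := eq_erase_of_subset hsub hc.symm
    exact step c hcY hX (Pre.refl _)
  by_cases hYP : Y = P #Y
  · rw [hc] at hYP
    obtain ⟨c, h1, h2, h3⟩ := h.chain_top hvl hX hXm (by omega) (by rwa [← hYP])
    rw [← hYP] at h1 h2 h3
    have := card_erase_add_one h1
    exact step c h1 h2 ⟨by omega, h3⟩
  by_cases hQX : LD (P #Y) X
  · obtain ⟨Z, i1, i2, i3, i4⟩ := h.step_low hch hY hYm hYP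
    exact ⟨Z, i1, h.hF.trans i1 (h.lowP hk) hX i3
      ⟨by rw [h.cardP hk, cX, hc], hQX.insert_right (h.subP hk)⟩, i4⟩
  obtain ⟨Z, hZ, i1, i2, ⟨c, hcY, rfl⟩ | ⟨b, c, hbY, hcY, hbc, rfl⟩⟩ :=
    hcd Y (h.low hY hYm) X (h.upp hX hXm) (by omega) hl (by rintro rfl; omega)
  · have cZ := card_erase_add_one hcY
    by_cases hZF : insert (m + 1) (Y.erase c) ∈ F
    · exact step c hcY hZF ⟨by omega, i2⟩
    have hZF := h.mem_low hZ (h.pre_of_notMem_upp hZ hZF)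
    obtain ⟨c', hc', hmin⟩ := exists_min_image
      (Y.filter fun c => Y.erase c ∈ F) id ⟨c, mem_filter.2 ⟨hcY, hZF⟩⟩
    simp only [mem_filter, id, and_imp] at hc' hmin
    obtain ⟨hcY', hWF⟩ := hc'
    have cW := card_erase_add_one hcY'
    have hWm : Y.erase c' ⊆ Icc 1 m := (erase_subset _ _).trans hYm
    have p1 := h.low_pre hXk hWF hWm (by omega)
    have p2 := h.upp_pre hXk hX hXm le_rfl
    have p3 := h.trans (h.low hWF hWm) (h.memP hXk) (h.upp hX hXm) p1 p2
    by_cases hWP : Y.erase c' = P #X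
    · exact step c' hcY' (by rw [hWP]; exact h.uppP hXk) p3
    have e : insert c' (Y.erase c') = Y := Finset.insert_erase hcY'
    rcases hvr (Y.erase c') c' (by simp) hWF (by rwa [e]) with
      ⟨c'', j1, j2, j3⟩ | ⟨b, j1, j2, j3⟩ | hb
    · by_cases hcN : c'' = m + 1
      · subst hcN
        exact step c' hcY' j3 p3
      have := mem_Icc.1 (h.hF.sub _ j3 (mem_insert_self _ _))
      have j4 : insert c'' (Y.erase c') ⊆ Icc 1 m := insert_subset (mem_Icc.2 (by omega)) hWm
      have l1 := (p1.2.insert_of_ws (by rw [h.cardP hXk]; omega) hWP j2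
        (h.hF.ws _ j3 _ (h.lowP hXk))).insert_right j4
      refine ⟨_, j3, h.hF.trans j3 (h.uppP hXk) hX ⟨?_, l1⟩
        (p2.insert_both (h.subP hXk) hXm), Or.inr ⟨c', c'', hcY', ?_, j1, rfl⟩⟩
      · rw [card_insert_of_notMem j2, card_insert_succ (h.subP hXk), h.cardP hXk]
        omega
      · exact fun hY => j2 (mem_erase.2 ⟨j1.ne', hY⟩)
    · rw [e] at j3
      have := hmin b (mem_of_mem_erase j1) j3
      omega
    · rw [e] at hb
      have := mem_Icc.1 (hYm hcY')
      exact absurd (by rw [hb, mem_Icc]; omega) hNY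
  · have cZ : #(insert c (Y.erase b)) = #Y := by
      rw [card_insert_of_notMem (by simp [hcY]), card_erase_add_one hbY]
    have hZm := h.hH.sub _ hZ
    have p1 : Pre (insert c (Y.erase b)) (insert (m + 1) X) := ⟨by omega, i2.insert_right hZm⟩
    by_cases hZF : insert c (Y.erase b) ∈ F
    · exact ⟨_, hZF, p1, Or.inr ⟨b, c, hbY, hcY, hbc, rfl⟩⟩
    have p0 := h.pre_of_notMem_low hZ hZF
    rw [cZ] at p0
    have := p0.trans (Icc_mono_succ (h.subP hk)) (Icc_mono_succ hZm) (h.hF.sub _ hX) p1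
      (h.hF.ws _ (h.lowP hk) _ hX)
    exact absurd (this.2.of_insert_right (h.subP hk)) hQX

theorem chain_upp_upp (h : Cut m F H P) (hch : ChainUp H) (hvr : VRight m H)
    (hY : insert (m + 1) Y ∈ F) (hYm : Y ⊆ Icc 1 m)
    (hX : insert (m + 1) X ∈ F) (hXm : X ⊆ Icc 1 m) (hp : Pre Y X) (hne : Y ≠ X) :
    ∃ Z ∈ F, Pre Z (insert (m + 1) X) ∧ IsStep (insert (m + 1) Y) Z := by
  have hk := card_le_of_subset_Icc hYm
  have hYH := h.upp hY hYm
  have hXH := h.upp hX hXm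
  have step : ∀ Z ∈ H, insert (m + 1) Z ∈ F → Pre Z X → IsStep Y Z →
      ∃ Z ∈ F, Pre Z (insert (m + 1) X) ∧ IsStep (insert (m + 1) Y) Z := by
    intro Z hZ hF hp hs
    have hZm := h.hH.sub _ hZ
    exact ⟨_, hF, hp.insert_both hZm hXm, hs.insert (succ_notMem hZm)⟩
  obtain ⟨Z, hZ, i1, i2⟩ := hch Y hYH X hXH hp hne
  by_cases hZF : insert (m + 1) Z ∈ F
  · exact step Z hZ hZF i1 i2
  have p0 := h.pre_of_notMem_upp hZ hZF
  have hZF := h.mem_low hZ p0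
  rcases i2 with ⟨c₀, hcY₀, rfl⟩ | ⟨b, c, hbY, hcY, hbc, rfl⟩
  swap
  · exfalso
    have cZ : #(insert c (Y.erase b)) = #Y := by
      rw [card_insert_of_notMem (by simp [hcY]), card_erase_add_one hbY]
    rw [cZ] at p0
    have := h.trans hZ (h.memP hk) hYH p0 (h.upp_pre hk hY hYm le_rfl)
    have := this.antisymm (IsStep.pre (Or.inr ⟨b, c, hbY, hcY, hbc, rfl⟩))
    exact hcY (by rw [← this]; exact mem_insert_self _ _)
  obtain ⟨c, hc, hmax⟩ := exists_max_image
    ((Icc 1 m).filter fun c => c ∉ Y ∧ insert c Y ∈ F) id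
    ⟨c₀, mem_filter.2 ⟨h.hH.sub _ hZ (mem_insert_self _ _), hcY₀, hZF⟩⟩
  simp only [mem_filter, mem_Icc, id, and_imp] at hc hmax
  obtain ⟨hcm, hcY, hcF⟩ := hc
  have cZ₀ := card_insert_of_notMem hcY₀
  have cZ := card_insert_of_notMem hcY
  have hZm : insert c Y ⊆ Icc 1 m := insert_subset (mem_Icc.2 hcm) hYm
  have hkm : #Y + 1 ≤ m := cZ ▸ card_le_of_subset_Icc hZm
  have hYc := i1.1
  have pQ := h.upp_pre hkm hX hXm (by omega)
  have p1 := h.low_pre hkm hcF hZm cZ.le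
  by_cases hZQ : insert c Y = P (#Y + 1)
  · have hF := h.uppP hkm
    rw [← hZQ] at hF pQ
    exact step _ (h.upp hF hZm) hF pQ (Or.inl ⟨c, hcY, rfl⟩)
  have cQ := h.cardP hkm
  rcases hvr Y c hcY hYH (h.low hcF hZm) with ⟨c', j1, j2, j3⟩ | ⟨b, j1, j2, j3⟩ | hb
  · have hcm' := mem_Icc.1 (h.hH.sub _ j3 (mem_insert_self _ _))
    have hF' : insert c' Y ∉ F := fun hF' => by
      have := hmax c' (by omega) (by omega) j2 hF'
      omega
    have p2 := h.pre_of_notMem_low j3 hF'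
    rw [card_insert_of_notMem j2] at p2
    obtain ⟨x, -, hxY, e⟩ := eq_insert_of_ld_insert p1.2 p2.2 hcY j2 j1 cQ
      (h.hH.ws _ (h.memP hkm) _ hYH)
    exact step _ (h.memP hkm) (h.uppP hkm) pQ (Or.inl ⟨x, hxY, e⟩)
  · have hbc' : b ≠ c := j2.ne
    have e : (insert c Y).erase b = insert c (Y.erase b) := erase_insert_of_ne hbc'.symm
    have cE : #((insert c Y).erase b) = #Y := by
      rw [card_erase_of_mem (mem_insert_of_mem j1), cZ]
      rfl
    have hF := h.mem_upp_of_ld j3 hYm hY cE.symm (LD.insert_erase' j2)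
    have l := p1.2.erase_of_ws (by rw [cZ, cQ]) hZQ (mem_insert_of_mem j1)
      (h.hH.ws _ j3 _ (h.memP hkm))
    exact step _ j3 hF (h.trans j3 (h.memP hkm) hXH ⟨by omega, l⟩ pQ)
      (Or.inr ⟨b, c, j1, hcY, j2, e⟩)
  · exfalso
    refine hZQ (LD.antisymm (by rw [cZ, cQ]) p1.2 ?_)
    have := LD.right_Icc (h.subP hkm) c
    rwa [← hb] at this

theorem chainUp (h : Cut m F H P) (hch : ChainUp H) (hcd : ChainDown H) (hvl : VLeft H)
    (hvr : VRight m H) (hvlF : VLeft F) (hvrF : VRight (m + 1) F) : ChainUp F := by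
  intro Y hY X hX hp hne
  change ∃ Z ∈ F, Pre Z X ∧ IsStep Y Z
  rcases h.hF.cases_succ hY with hYm | ⟨Y, hYm, rfl⟩ <;>
  rcases h.hF.cases_succ hX with hXm | ⟨X, hXm, rfl⟩
  · exact h.chain_low_low hch hvlF hY hYm hX hXm hp hne
  · by_cases hc : #Y ≤ #X
    · exact h.chain_low_upp_le hch hY hYm hX hXm hc
    · have := hp.1
      rw [card_insert_succ hXm] at this
      exact h.chain_low_upp_succ hch hcd hvl hvrF hY hYm hX hXm (by omega)
        (hp.2.of_insert_right hYm)
  · obtain ⟨x, hx, hx'⟩ := exists_mem_notMem_of_card hp.1 hne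
    have := hp.2 (m + 1) x (mem_insert_self _ _) (succ_notMem hXm) hx hx'
    have := mem_Icc.1 (hXm hx)
    omega
  · refine h.chain_upp_upp hch hvr hY hYm hX hXm ⟨?_, ?_⟩ ?_
    · have := hp.1
      rw [card_insert_succ hXm, card_insert_succ hYm] at this
      omega
    · exact hp.2.of_insert_both (succ_notMem hYm) (succ_notMem hXm)
    · rintro rfl
      exact hne rfl

end Cut

structure Good (m : ℕ) (F : Finset (Finset ℕ)) : Prop where
  card : 2 * #F = m * (m + 1) + 2
  vright : VRight m F
  chainUp : ChainUp F

theorem Mx.good : ∀ {m : ℕ} {F : Finset (Finset ℕ)}, Mx m F → Good m F := by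
  intro m
  induction m with
  | zero =>
    intro F hF
    have e : F = {∅} := by
      have h0 : ∀ X ∈ F, X = ∅ := fun X hX => by simpa using hF.sub X hX
      refine eq_singleton_iff_unique_mem.2 ⟨hF.max _ (empty_subset _) fun X hX => ?_, h0⟩
      rw [h0 X hX]
      exact WS.refl _
    subst e
    refine ⟨by simp, ?_, ?_⟩
    · intro S c _ _ h2
      simp at h2
    · intro Y hY X hX _ hne
      rw [mem_singleton] at hX hY
      exact absurd (hY.trans hX.symm) hne
  | succ m ih =>
    have key : ∀ {F}, Mx (m + 1) F → 2 * #F = (m + 1) * (m + 2) + 2 ∧ VRight (m + 1) F := by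
      intro F hF
      obtain ⟨H, P, h⟩ := hF.exists_cut fun H hH => (ih hH).chainUp
      have g := ih h.hH
      refine ⟨?_, h.vright g.vright⟩
      rw [h.card_eq, mul_add, g.card]
      ring
    intro F hF
    obtain ⟨H, P, h⟩ := hF.exists_cut fun H hH => (ih hH).chainUp
    have g := ih h.hH
    exact ⟨(key hF).1, (key hF).2, h.chainUp g.chainUp
      (ChainUp.down h.hH (ih h.hH.revCompl).chainUp) (VRight.left h.hH (ih h.hH.compl).vright)
      g.vright (VRight.left hF (key hF.compl).2) (key hF).2⟩

/-- `X` is an `ω`-chamber set. -/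
def IsChamber (n : ℕ) (ω : ℕ → ℕ) (X : Finset ℕ) : Prop :=
  ∀ i ∈ Icc 1 n, ∀ j ∈ Icc 1 n, i < j → ω i < ω j → j ∈ X → i ∈ X

/-- `X` contains `j` with every `i` such that `(i, j)` is an inversion of `ω`. -/
def IsCochamber (n : ℕ) (ω : ℕ → ℕ) (X : Finset ℕ) : Prop :=
  ∀ i ∈ Icc 1 n, ∀ j ∈ Icc 1 n, i < j → ω j < ω i → i ∈ X → j ∈ X

/-- The elements of `[n]` to which `ω` gives one of the values `1, …, k`. -/
def level (n : ℕ) (ω : ℕ → ℕ) (k : ℕ) : Finset ℕ := (Icc 1 n).filter (ω · ≤ k)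

section Permutation

variable {n : ℕ} {ω : ℕ → ℕ} {X Y Z : Finset ℕ}

theorem mem_level {k x : ℕ} : x ∈ level n ω k ↔ x ∈ Icc 1 n ∧ ω x ≤ k := by
  rw [level, mem_filter]

theorem level_subset (n : ℕ) (ω : ℕ → ℕ) (k : ℕ) : level n ω k ⊆ Icc 1 n := filter_subset _ _

theorem isChamber_level (n : ℕ) (ω : ℕ → ℕ) (k : ℕ) : IsChamber n ω (level n ω k) := by
  intro i hi j _ _ h2 h3
  rw [mem_level] at *
  exact ⟨hi, h2.le.trans h3.2⟩

theorem isCochamber_level (n : ℕ) (ω : ℕ → ℕ) (k : ℕ) : IsCochamber n ω (level n ω k) := by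
  intro i _ j hj _ h2 h3
  rw [mem_level] at *
  exact ⟨hj, h2.le.trans h3.2⟩

theorem map_lt_or_gt (hω : Set.BijOn ω (Set.Icc 1 n) (Set.Icc 1 n)) {a b : ℕ}
    (ha : a ∈ Icc 1 n) (hb : b ∈ Icc 1 n) (hab : a ≠ b) : ω a < ω b ∨ ω b < ω a :=
  Nat.lt_or_gt_of_ne fun h => hab (hω.injOn (by simpa using ha) (by simpa using hb) h)

theorem mem_Icc_map (hω : Set.BijOn ω (Set.Icc 1 n) (Set.Icc 1 n)) {a : ℕ}
    (ha : a ∈ Icc 1 n) : 1 ≤ ω a ∧ ω a ≤ n :=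
  hω.mapsTo (by simpa using ha)

theorem card_level (hω : Set.BijOn ω (Set.Icc 1 n) (Set.Icc 1 n)) {k : ℕ} (hk : k ≤ n) :
    #(level n ω k) = k := by
  have : #(level n ω k) = #(Icc 1 k) := by
    refine card_nbij ω ?_ ?_ ?_
    · intro x hx
      have hx := mem_level.1 hx
      exact mem_coe.2 (mem_Icc.2 ⟨(mem_Icc_map hω hx.1).1, hx.2⟩)
    · intro x hx y hy h
      exact hω.injOn (by simpa using (mem_level.1 hx).1) (by simpa using (mem_level.1 hy).1) h
    · intro y hy
      have hy := mem_Icc.1 hy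
      obtain ⟨x, hx, rfl⟩ := hω.surjOn (show y ∈ Set.Icc 1 n from ⟨hy.1, hy.2.trans hk⟩)
      exact ⟨x, mem_coe.2 (mem_level.2 ⟨by simpa using hx, hy.2⟩), rfl⟩
  rw [this, Nat.card_Icc, Nat.add_sub_cancel]

theorem IsChamber.ld (hω : Set.BijOn ω (Set.Icc 1 n) (Set.Icc 1 n)) (hY : IsChamber n ω Y)
    (hX : IsCochamber n ω X) (hYn : Y ⊆ Icc 1 n) (hXn : X ⊆ Icc 1 n) : LD Y X := by
  intro a b ha ha' hb hb'
  have hne : b ≠ a := by rintro rfl; exact hb' ha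
  by_contra hlt
  rcases map_lt_or_gt hω (hXn hb) (hYn ha) hne with h | h
  · exact hb' (hY b (hXn hb) a (hYn ha) (by omega) h ha)
  · exact ha' (hX b (hXn hb) a (hYn ha) (by omega) h hb)

theorem eq_level (hω : Set.BijOn ω (Set.Icc 1 n) (Set.Icc 1 n)) (h1 : IsChamber n ω X)
    (h2 : IsCochamber n ω X) (hX : X ⊆ Icc 1 n) : X = level n ω #X := by
  have hk := card_le_of_subset_Icc hX
  exact (h1.ld hω (isCochamber_level n ω _) hX (level_subset _ _ _)).antisymm
    (card_level hω hk).symm ((isChamber_level n ω _).ld hω h2 (level_subset _ _ _) hX)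

theorem isChamber_or_isCochamber (hω : Set.BijOn ω (Set.Icc 1 n) (Set.Icc 1 n))
    (hZ : Z ⊆ Icc 1 n) (hws : ∀ k ≤ n, WS Z (level n ω k)) :
    IsChamber n ω Z ∨ IsCochamber n ω Z := by
  have hs := card_le_of_subset_Icc hZ
  have cs := card_level hω hs
  have hval : ∀ k, ∃ c, ∀ x ∈ Icc 1 n, ω x = k → x = c := by
    intro k
    by_cases hk : ∃ c ∈ Icc 1 n, ω c = k
    · obtain ⟨c, hc, rfl⟩ := hk
      exact ⟨c, fun x hx h => hω.injOn (by simpa using hx) (by simpa using hc) h⟩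
    · exact ⟨0, fun x hx h => absurd ⟨x, hx, h⟩ hk⟩
  have inLevel : ∀ {x l}, x ∈ Icc 1 n → (x ∈ level n ω l ↔ ω x ≤ l) := by
    intro x l hx
    rw [mem_level]
    exact and_iff_right hx
  have altZ : ∀ {a b a' l}, l ≤ n → a < b → b < a' → a ∈ Z → l < ω a → b ∉ Z → b ∈ Icc 1 n →
      ω b ≤ l → a' ∈ Z → l < ω a' → #Z ≤ l := by
    intro a b a' l hl h1 h2 ha ha' hb hbn hb' hc hc'
    have := (hws l hl).alt a b a' h1 h2 ha (by rw [inLevel (hZ ha)]; omega)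
      ((inLevel hbn).2 hb') hb hc (by rw [inLevel (hZ hc)]; omega)
    rwa [card_level hω hl] at this
  have altI : ∀ {a b a' l}, l ≤ n → a < b → b < a' → a ∉ Z → a ∈ Icc 1 n → ω a ≤ l → b ∈ Z →
      l < ω b → a' ∉ Z → a' ∈ Icc 1 n → ω a' ≤ l → l ≤ #Z := by
    intro a b a' l hl h1 h2 ha han ha' hb hb' hc hcn hc'
    have := (hws l hl).alt' a b a' h1 h2 ((inLevel han).2 ha') ha hb
      (by rw [inLevel (hZ hb)]; omega) ((inLevel hcn).2 hc') hc
    rwa [card_level hω hl] at this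
  have sub := level_subset n ω #Z
  rcases ld_or_inner Z (level n ω #Z) with h | h | h | h
  · left
    intro i hi j hj hij hωij hjZ
    by_contra hiZ
    have mi := mem_Icc_map hω hi
    have mj := mem_Icc_map hω hj
    have hne : level n ω #Z ≠ Z := by
      intro e
      have e1 := (inLevel hi).not.1 (by rwa [e])
      have e2 := (inLevel hj).1 (by rwa [e])
      omega
    by_cases hjs : ω j ≤ #Z
    · obtain ⟨b, hb, hb'⟩ := exists_mem_notMem_of_card cs.le hne
      have hbi := h b i hb hb' ((inLevel hi).2 (by omega)) hiZ
      rw [inLevel (hZ hb)] at hb'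
      have := altZ (l := ω i) (by omega) hbi hij hb (by omega) hiZ hi le_rfl hjZ hωij
      omega
    · have hjI : j ∉ level n ω #Z := fun h => hjs ((inLevel hj).1 h)
      by_cases his : ω i ≤ #Z
      · have := h j i hjZ hjI ((inLevel hi).2 his) hiZ
        omega
      · obtain ⟨a, ha, ha'⟩ := exists_mem_notMem_of_card cs.ge hne.symm
        have hja := h j a hjZ hjI ha ha'
        have hal := (inLevel (sub ha)).1 ha
        have := altI (l := ω j - 1) (by omega) hij hja hiZ hi (by omega) hjZ (by omega) ha' (sub ha)
          (by omega)
        omega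
  · right
    intro p hp q hq hpq hωpq hpZ
    by_contra hqZ
    have mp := mem_Icc_map hω hp
    have mq := mem_Icc_map hω hq
    have hne : level n ω #Z ≠ Z := by
      intro e
      have e1 := (inLevel hq).not.1 (by rwa [e])
      have e2 := (inLevel hp).1 (by rwa [e])
      omega
    by_cases hps : ω p ≤ #Z
    · obtain ⟨b, hb, hb'⟩ := exists_mem_notMem_of_card cs.le hne
      have hqb := h q b ((inLevel hq).2 (by omega)) hqZ hb hb'
      rw [inLevel (hZ hb)] at hb'
      have := altZ (l := ω q) (by omega) hpq hqb hpZ hωpq hqZ hq le_rfl hb (by omega)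
      omega
    · have hpI : p ∉ level n ω #Z := fun h => hps ((inLevel hp).1 h)
      by_cases hqs : ω q ≤ #Z
      · have := h q p ((inLevel hq).2 hqs) hqZ hpZ hpI
        omega
      · obtain ⟨a, ha, ha'⟩ := exists_mem_notMem_of_card cs.ge hne.symm
        have hap := h a p ha ha' hpZ hpI
        have hal := (inLevel (sub ha)).1 ha
        have := altI (l := ω p - 1) (by omega) hap hpq ha' (sub ha) (by omega) hpZ (by omega) hqZ hq
          (by omega)
        omega
  · exfalso
    obtain ⟨c, hc⟩ := hval (#Z + 1)
    obtain ⟨b, a, b', h1, h2, hb, hb', ha, ha', hd, hd', hac⟩ :=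
      h.exists_between_ne cs.symm (hws _ hs).nc (hws _ hs).nc' c
    have ma := mem_Icc_map hω (hZ ha)
    rw [inLevel (hZ ha)] at ha'
    have := (inLevel (sub hb)).1 hb
    have := (inLevel (sub hd)).1 hd
    have : ω a ≠ #Z + 1 := fun e => hac (hc a (hZ ha) e)
    have := altI (l := ω a - 1) (by omega) h1 h2 hb' (sub hb) (by omega) ha (by omega) hd' (sub hd)
      (by omega)
    omega
  · exfalso
    obtain ⟨c, hc⟩ := hval #Z
    obtain ⟨b, a, b', h1, h2, hb, hb', ha, ha', hd, hd', hac⟩ :=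
      h.exists_between_ne cs (hws _ hs).nc' (hws _ hs).nc c
    rw [inLevel (hZ hb)] at hb'
    rw [inLevel (hZ hd)] at hd'
    have hal := (inLevel (sub ha)).1 ha
    have : ω a ≠ #Z := fun e => hac (hc a (sub ha) e)
    have := altZ (l := ω a) (by omega) h1 h2 hb (by omega) ha' (sub ha) le_rfl hd (by omega)
    omega

/-- The part of `level n ω (ω p.1)` lying in `[p.2]`. -/
def corner (n : ℕ) (ω : ℕ → ℕ) (p : ℕ × ℕ) : Finset ℕ :=
  (Icc 1 n).filter fun x => x ≤ p.2 ∧ ω x ≤ ω p.1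

theorem mem_corner {p : ℕ × ℕ} {x : ℕ} :
    x ∈ corner n ω p ↔ x ∈ Icc 1 n ∧ x ≤ p.2 ∧ ω x ≤ ω p.1 := by
  rw [corner, mem_filter]

theorem corner_ws (n : ℕ) (ω : ℕ → ℕ) (p q : ℕ × ℕ) : WS (corner n ω p) (corner n ω q) := by
  have key : ∀ p q : ℕ × ℕ, p.2 ≤ q.2 → LD (corner n ω p) (corner n ω q) := by
    intro p q hpq a b ha ha' hb hb'
    simp only [mem_corner, mem_Icc] at *
    omega
  rcases le_total p.2 q.2 with h | h
  · exact (key p q h).ws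
  · exact (key q p h).ws.symm

theorem exists_isChamber (hω : Set.BijOn ω (Set.Icc 1 n) (Set.Icc 1 n)) :
    ∃ A : Finset (Finset ℕ), (∀ X ∈ A, X ⊆ Icc 1 n ∧ IsChamber n ω X) ∧
      (∀ X ∈ A, ∀ Y ∈ A, WS X Y) ∧ #A = #(InvPairs n ω) + n + 1 := by
  classical
  set D := (Icc 1 n).image fun i => (i, i) with hD
  have hmem : ∀ p ∈ InvPairs n ω ∪ D, p.1 ∈ Icc 1 n ∧ p.2 ∈ Icc 1 n ∧ p.1 ≤ p.2 ∧
      ω p.2 ≤ ω p.1 := by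
    intro p hp
    simp only [hD, InvPairs, mem_union, mem_filter, mem_product, mem_image] at hp
    rcases hp with hp | ⟨i, hi, rfl⟩
    · exact ⟨hp.1.1, hp.1.2, hp.2.1.le, hp.2.2.le⟩
    · exact ⟨hi, hi, le_rfl, le_rfl⟩
  have hself : ∀ p ∈ InvPairs n ω ∪ D, p.1 ∈ corner n ω p ∧ p.2 ∈ corner n ω p := by
    intro p hp
    obtain ⟨h1, h2, h3, h4⟩ := hmem p hp
    exact ⟨mem_corner.2 ⟨h1, h3, le_rfl⟩, mem_corner.2 ⟨h2, le_rfl, h4⟩⟩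
  have hinj : Set.InjOn (corner n ω) (InvPairs n ω ∪ D : Finset (ℕ × ℕ)) := by
    intro p hp q hq h
    obtain ⟨p1, p2⟩ := hself p hp
    obtain ⟨q1, q2⟩ := hself q hq
    rw [h] at p1 p2
    rw [← h] at q1 q2
    rw [mem_corner] at p1 p2 q1 q2
    exact Prod.ext (hω.injOn (by simpa using p1.1) (by simpa using q1.1)
      (le_antisymm p1.2.2 q1.2.2)) (le_antisymm p2.2.1 q2.2.1)
  have hdisj : Disjoint (InvPairs n ω) D := by
    rw [disjoint_left]
    intro p hp hp'
    obtain ⟨i, -, rfl⟩ := mem_image.1 hp'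
    exact absurd (mem_filter.1 hp).2.1 (lt_irrefl _)
  refine ⟨insert ∅ ((InvPairs n ω ∪ D).image (corner n ω)), ?_, ?_, ?_⟩
  · intro X hX
    rw [mem_insert, mem_image] at hX
    rcases hX with rfl | ⟨p, -, rfl⟩
    · exact ⟨empty_subset _, fun _ _ _ _ _ _ h => absurd h (notMem_empty _)⟩
    · refine ⟨filter_subset _ _, fun i hi j _ h1 h2 h3 => ?_⟩
      rw [mem_corner] at *
      exact ⟨hi, h1.le.trans h3.2.1, h2.le.trans h3.2.2⟩
  · have h0 : ∀ X : Finset ℕ, WS ∅ X := fun X => LD.ws fun a _ h => absurd h (notMem_empty a)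
    intro X hX Y hY
    rw [mem_insert, mem_image] at hX hY
    rcases hX with rfl | ⟨p, -, rfl⟩
    · exact h0 Y
    · rcases hY with rfl | ⟨q, -, rfl⟩
      · exact (h0 _).symm
      · exact corner_ws n ω p q
  · rw [card_insert_of_notMem, card_image_of_injOn hinj, card_union_of_disjoint hdisj,
      card_image_of_injective _ fun a b h => congrArg Prod.fst h, Nat.card_Icc, Nat.add_sub_cancel]
    intro h
    obtain ⟨p, hp, e⟩ := mem_image.1 h
    exact absurd (e ▸ (hself p hp).1) (notMem_empty _)

end Permutation

section Rank

variable {n : ℕ} {ω ω' : ℕ → ℕ}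

theorem two_mul_card_pairs (n : ℕ) :
    2 * #(((Icc 1 n) ×ˢ (Icc 1 n)).filter fun p : ℕ × ℕ => p.1 < p.2) + n = n * n := by
  classical
  set L := ((Icc 1 n) ×ˢ (Icc 1 n)).filter fun p : ℕ × ℕ => p.1 < p.2 with hL
  have e : (Icc 1 n).offDiag = L ∪ L.image Prod.swap := by
    ext ⟨a, b⟩
    simp only [hL, mem_offDiag, mem_union, mem_image, mem_filter, mem_product, Prod.exists,
      Prod.swap_prod_mk, Prod.mk.injEq]
    constructor
    · rintro ⟨ha, hb, hab⟩
      rcases Nat.lt_or_gt_of_ne hab with h | h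
      · exact Or.inl ⟨⟨ha, hb⟩, h⟩
      · exact Or.inr ⟨b, a, ⟨⟨hb, ha⟩, h⟩, rfl, rfl⟩
    · rintro (⟨⟨ha, hb⟩, h⟩ | ⟨x, y, ⟨⟨hx, hy⟩, h⟩, rfl, rfl⟩)
      · exact ⟨ha, hb, h.ne⟩
      · exact ⟨hy, hx, h.ne'⟩
  have hd : Disjoint L (L.image Prod.swap) := by
    rw [disjoint_left]
    rintro ⟨a, b⟩ h1 h2
    obtain ⟨⟨x, y⟩, h3, h4⟩ := mem_image.1 h2
    rw [Prod.swap_prod_mk, Prod.mk.injEq] at h4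
    have := (mem_filter.1 h1).2
    have := (mem_filter.1 h3).2
    simp only at *
    omega
  have hc := congrArg card e
  rw [offDiag_card, card_union_of_disjoint hd, card_image_of_injective _ Prod.swap_injective,
    Nat.card_Icc, Nat.add_sub_cancel] at hc
  have := Nat.le_mul_self n
  omega

/-- The permutation `n + 1 - ω` of `[n]`. -/
def opp (n : ℕ) (ω : ℕ → ℕ) (x : ℕ) : ℕ := n + 1 - ω x

theorem opp_bijOn (hω : Set.BijOn ω (Set.Icc 1 n) (Set.Icc 1 n)) :
    Set.BijOn (opp n ω) (Set.Icc 1 n) (Set.Icc 1 n) := by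
  refine ⟨fun x hx => ?_, fun x hx y hy h => hω.injOn hx hy ?_, fun y hy => ?_⟩
  · have := hω.mapsTo hx
    simp only [opp, Set.mem_Icc] at *
    omega
  · have := hω.mapsTo hx
    have := hω.mapsTo hy
    simp only [opp, Set.mem_Icc] at *
    omega
  · obtain ⟨x, hx, e⟩ := hω.surjOn (show n + 1 - y ∈ Set.Icc 1 n by
      rw [Set.mem_Icc] at *; omega)
    refine ⟨x, hx, ?_⟩
    rw [Set.mem_Icc] at hy
    rw [opp, e]
    omega

theorem card_invPairs_opp (hω : Set.BijOn ω (Set.Icc 1 n) (Set.Icc 1 n)) :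
    2 * (#(InvPairs n ω) + #(InvPairs n (opp n ω))) + n = n * n := by
  rw [← two_mul_card_pairs n, ← card_filter_add_card_filter_not
    (s := ((Icc 1 n) ×ˢ (Icc 1 n)).filter fun p : ℕ × ℕ => p.1 < p.2) (fun p => ω p.2 < ω p.1),
    filter_filter, filter_filter]
  congr 4
  refine filter_congr fun p hp => and_congr_right fun hlt => ?_
  rw [mem_product] at hp
  have h1 := mem_Icc_map hω hp.1
  have h2 := mem_Icc_map hω hp.2
  have := map_lt_or_gt hω hp.1 hp.2 hlt.ne
  simp only [opp]
  omega

theorem exists_isCochamber (hω : Set.BijOn ω (Set.Icc 1 n) (Set.Icc 1 n)) :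
    ∃ B : Finset (Finset ℕ), (∀ X ∈ B, X ⊆ Icc 1 n ∧ IsCochamber n ω X) ∧
      (∀ X ∈ B, ∀ Y ∈ B, WS X Y) ∧ #B = #(InvPairs n (opp n ω)) + n + 1 := by
  classical
  obtain ⟨A, h1, h2, h3⟩ := exists_isChamber (opp_bijOn hω)
  refine ⟨A.image (cpl n), ?_, ?_, ?_⟩
  · intro X hX
    obtain ⟨Y, hY, rfl⟩ := mem_image.1 hX
    refine ⟨cpl_subset _ _, fun i hi j hj hij hω' hiY => ?_⟩
    rw [mem_cpl] at *
    refine ⟨mem_Icc.1 hj, fun hjY => hiY.2 ((h1 Y hY).2 i hi j hj hij ?_ hjY)⟩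
    have := mem_Icc_map hω hi
    simp only [opp]
    omega
  · intro X hX Y hY
    obtain ⟨S, hS, rfl⟩ := mem_image.1 hX
    obtain ⟨T, hT, rfl⟩ := mem_image.1 hY
    exact (h2 S hS T hT).compl (h1 S hS).1 (h1 T hT).1
  · rw [card_image_of_injOn, h3]
    intro X hX Y hY h
    rw [← cpl_cpl (h1 X hX).1, ← cpl_cpl (h1 Y hY).1]
    exact congrArg (cpl n) h

theorem exists_mx_chamber (hω : Set.BijOn ω (Set.Icc 1 n) (Set.Icc 1 n))
    {A B : Finset (Finset ℕ)} (hA : ∀ X ∈ A, X ⊆ Icc 1 n ∧ IsChamber n ω X)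
    (hAw : ∀ X ∈ A, ∀ Y ∈ A, WS X Y) (hB : ∀ X ∈ B, X ⊆ Icc 1 n ∧ IsCochamber n ω X)
    (hBw : ∀ X ∈ B, ∀ Y ∈ B, WS X Y) :
    ∃ G, Mx n G ∧ A ⊆ G ∧ B ⊆ G ∧ ∀ k ≤ n, level n ω k ∈ G := by
  classical
  have hld : ∀ {X Y}, X ⊆ Icc 1 n ∧ IsChamber n ω X → Y ⊆ Icc 1 n ∧ IsCochamber n ω Y → WS X Y :=
    fun hX hY => (hX.2.ld hω hY.2 hX.1 hY.1).ws
  have l1 : ∀ k, level n ω k ⊆ Icc 1 n ∧ IsChamber n ω (level n ω k) := fun k =>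
    ⟨level_subset _ _ _, isChamber_level _ _ _⟩
  have l2 : ∀ k, level n ω k ⊆ Icc 1 n ∧ IsCochamber n ω (level n ω k) := fun k =>
    ⟨level_subset _ _ _, isCochamber_level _ _ _⟩
  obtain ⟨G, hG, hM⟩ := exists_mx (m := n) (G := A ∪ B ∪ (range (n + 1)).image (level n ω)) (by
      intro X hX
      simp only [mem_union, mem_image] at hX
      rcases hX with (hX | hX) | ⟨k, -, rfl⟩
      · exact (hA X hX).1
      · exact (hB X hX).1
      · exact (l1 k).1) (by
      intro X hX Y hY
      simp only [mem_union, mem_image] at hX hY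
      rcases hX with (hX | hX) | ⟨k, -, rfl⟩ <;> rcases hY with (hY | hY) | ⟨l, -, rfl⟩
      · exact hAw X hX Y hY
      · exact hld (hA X hX) (hB Y hY)
      · exact hld (hA X hX) (l2 l)
      · exact (hld (hA Y hY) (hB X hX)).symm
      · exact hBw X hX Y hY
      · exact (hld (l1 l) (hB X hX)).symm
      · exact (hld (hA Y hY) (l2 k)).symm
      · exact hld (l1 k) (hB Y hY)
      · exact hld (l1 k) (l2 l))
  refine ⟨G, hM, fun X hX => hG ?_, fun X hX => hG ?_, fun k hk => hG ?_⟩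
  · exact mem_union_left _ (mem_union_left _ hX)
  · exact mem_union_left _ (mem_union_right _ hX)
  · exact mem_union_right _ (mem_image_of_mem _ (mem_range.2 (by omega)))

theorem card_chamber_inter (hω : Set.BijOn ω (Set.Icc 1 n) (Set.Icc 1 n))
    {G : Finset (Finset ℕ)} (hG : ∀ X ∈ G, X ⊆ Icc 1 n) (hl : ∀ k ≤ n, level n ω k ∈ G)
    {U V : Finset (Finset ℕ)} (hU : ∀ X ∈ G, X ∈ U ↔ IsChamber n ω X)
    (hV : ∀ X ∈ G, X ∈ V ↔ IsCochamber n ω X) (hUG : U ⊆ G) : #(U ∩ V) = n + 1 := by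
  have e : U ∩ V = (range (n + 1)).image (level n ω) := by
    ext X
    rw [mem_inter, mem_image]
    constructor
    · rintro ⟨h1, h2⟩
      have hX := hUG h1
      refine ⟨#X, ?_, (eq_level hω ((hU X hX).1 h1) ((hV X hX).1 h2) (hG X hX)).symm⟩
      have := card_le_of_subset_Icc (hG X hX)
      rw [mem_range]
      omega
    · rintro ⟨k, hk, rfl⟩
      have hk := hl k (by rw [mem_range] at hk; omega)
      exact ⟨(hU _ hk).2 (isChamber_level _ _ _), (hV _ hk).2 (isCochamber_level _ _ _)⟩
  rw [e, card_image_of_injOn, card_range]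
  intro a ha b hb h
  have ha := mem_range.1 ha
  have hb := mem_range.1 hb
  have := congrArg card h
  rwa [card_level hω (by omega), card_level hω (by omega)] at this

open Classical in
theorem Mx.card_add_card (hω : Set.BijOn ω (Set.Icc 1 n) (Set.Icc 1 n))
    {G : Finset (Finset ℕ)} (hG : Mx n G) (hl : ∀ k ≤ n, level n ω k ∈ G) :
    #(G.filter (IsChamber n ω)) + #(G.filter (IsCochamber n ω)) = #G + (n + 1) := by
  rw [← card_union_add_card_inter, card_chamber_inter hω hG.sub hl
    (fun X hX => by simp [hX]) (fun X hX => by simp [hX]) (filter_subset _ _), ← filter_or,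
    filter_true_of_mem]
  exact fun X hX => isChamber_or_isCochamber hω (hG.sub X hX) fun k hk => hG.ws _ hX _ (hl k hk)

open Classical in
theorem Mx.card_chamber (hω : Set.BijOn ω (Set.Icc 1 n) (Set.Icc 1 n))
    {G : Finset (Finset ℕ)} (hG : Mx n G) (hl : ∀ k ≤ n, level n ω k ∈ G) :
    #(G.filter (IsChamber n ω)) = #(InvPairs n ω) + n + 1 := by
  have cG := hG.good.card
  have ci := card_invPairs_opp hω
  have hs := hG.card_add_card hω hl
  have hw : ∀ (p : Finset ℕ → Prop), ∀ X ∈ G.filter p, ∀ Y ∈ G.filter p, WS X Y :=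
    fun p X hX Y hY => hG.ws X (mem_filter.1 hX).1 Y (mem_filter.1 hY).1
  have hsub : ∀ (p : Finset ℕ → Prop), ∀ X ∈ G.filter p, X ⊆ Icc 1 n ∧ p X :=
    fun p X hX => ⟨hG.sub X (mem_filter.1 hX).1, (mem_filter.1 hX).2⟩
  obtain ⟨A, hA, hAw, cA⟩ := exists_isChamber hω
  obtain ⟨B, hB, hBw, cB⟩ := exists_isCochamber hω
  obtain ⟨G₁, h1, h2, h3, h4⟩ := exists_mx_chamber hω (hsub (IsChamber n ω)) (hw _) hB hBw
  obtain ⟨G₂, i1, i2, i3, i4⟩ := exists_mx_chamber hω hA hAw (hsub (IsCochamber n ω)) (hw _)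
  have c1 := h1.good.card
  have c2 := i1.good.card
  have s1 := h1.card_add_card hω h4
  have s2 := i1.card_add_card hω i4
  have sub : ∀ {A G : Finset (Finset ℕ)} {p : Finset ℕ → Prop}, A ⊆ G →
      (∀ X ∈ A, X ⊆ Icc 1 n ∧ p X) → #A ≤ #(G.filter p) := fun hA hp =>
    card_le_card fun X hX => mem_filter.2 ⟨hA hX, (hp X hX).2⟩
  have t1 := sub h2 (hsub _)
  have t2 := sub h3 hB
  have t3 := sub i2 hA
  have t4 := sub i3 (hsub _)
  have e : n * (n + 1) = n * n + n := by ring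
  omega

open Classical in
theorem card_of_isMaxWColl (hω' : Set.BijOn ω' (Set.Icc 1 n) (Set.Icc 1 n))
    (hω : Set.BijOn ω (Set.Icc 1 n) (Set.Icc 1 n)) (hInv : InvPairs n ω' ⊆ InvPairs n ω)
    {F : Finset (Finset ℕ)} (hF : IsMaxWColl (ChamberDomain2 n ω' ω) F) :
    #F + #(InvPairs n ω') = #(InvPairs n ω) + (n + 1) := by
  obtain ⟨hFD, hFw, hFm⟩ := hF
  have hD : ∀ {X}, X ∈ ChamberDomain2 n ω' ω ↔
    X ⊆ Icc 1 n ∧ IsChamber n ω X ∧ IsCochamber n ω' X := Iff.rfl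
  have h0 : ∀ {X}, X ⊆ Icc 1 n → 0 ∉ X := fun hX h => by
    have := mem_Icc.1 (hX h)
    omega
  have hsub : ∀ X ∈ F, X ⊆ Icc 1 n := fun X hX => (hD.1 (hFD hX)).1
  have hws : ∀ X ∈ F, ∀ Y ∈ F, WS X Y := fun X hX Y hY =>
    (weaklySep_iff (h0 (hsub X hX)) (h0 (hsub Y hY))).1 (hFw X hX Y hY)
  have hmem : ∀ X, X ⊆ Icc 1 n → IsChamber n ω X → IsCochamber n ω' X → (∀ Y ∈ F, WS X Y) →
      X ∈ F := by
    intro X hX h1 h2 h3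
    rw [hFm (insert X F) ?_ ?_ (subset_insert X F)]
    · exact mem_insert_self X F
    · rw [coe_insert, Set.insert_subset_iff]
      exact ⟨hD.2 ⟨hX, h1, h2⟩, hFD⟩
    · intro A hA B hB
      rw [mem_insert] at hA hB
      have sA : A ⊆ Icc 1 n := by rcases hA with rfl | hA; exacts [hX, hsub A hA]
      have sB : B ⊆ Icc 1 n := by rcases hB with rfl | hB; exacts [hX, hsub B hB]
      rw [weaklySep_iff (h0 sA) (h0 sB)]
      rcases hA with rfl | hA <;> rcases hB with rfl | hB
      · exact WS.refl _
      · exact h3 B hB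
      · exact (h3 A hA).symm
      · exact hws A hA B hB
  have hlt : ∀ i ∈ Icc 1 n, ∀ j ∈ Icc 1 n, i < j → ω' j < ω' i → ω j < ω i :=
    fun i hi j hj hij h => by
      have hp : (i, j) ∈ InvPairs n ω' := mem_filter.2 ⟨mem_product.2 ⟨hi, hj⟩, hij, h⟩
      exact (mem_filter.1 (hInv hp)).2.2
  have mono : ∀ {X}, IsChamber n ω' X → IsChamber n ω X := by
    intro X hX i hi j hj hij h hjX
    rcases map_lt_or_gt hω' hi hj hij.ne with h' | h'
    · exact hX i hi j hj hij h' hjX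
    · exact absurd h (hlt i hi j hj hij h').asymm
  have mono' : ∀ {X}, IsCochamber n ω X → IsCochamber n ω' X := by
    intro X hX i hi j hj hij h hiX
    exact hX i hi j hj hij (hlt i hi j hj hij h) hiX
  obtain ⟨G, hFG, hG⟩ := exists_mx hsub hws
  have l' : ∀ k, level n ω' k ∈ F := fun k => hmem _ (level_subset _ _ _)
    (mono (isChamber_level _ _ _)) (isCochamber_level _ _ _) fun Y hY =>
      ((isChamber_level _ _ _).ld hω' (hD.1 (hFD hY)).2.2 (level_subset _ _ _) (hsub Y hY)).ws
  have l : ∀ k, level n ω k ∈ F := fun k => hmem _ (level_subset _ _ _)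
    (isChamber_level _ _ _) (mono' (isCochamber_level _ _ _)) fun Y hY =>
      ((hD.1 (hFD hY)).2.1.ld hω (isCochamber_level _ _ _) (hsub Y hY) (level_subset _ _ _)).ws.symm
  have c' := hG.card_chamber hω' fun k _ => hFG (l' k)
  have c := hG.card_chamber hω fun k _ => hFG (l k)
  have eF : ∀ X ∈ G, X ∈ F ↔ IsChamber n ω X ∧ IsCochamber n ω' X := fun X hX =>
    ⟨fun h => (hD.1 (hFD h)).2, fun h => hmem X (hG.sub X hX) h.1 h.2 fun Y hY =>
      hG.ws X hX Y (hFG hY)⟩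
  have e : G.filter (IsChamber n ω) = G.filter (IsChamber n ω') ∪ F := by
    ext X
    rw [mem_union, mem_filter, mem_filter]
    constructor
    · rintro ⟨hX, h⟩
      rcases isChamber_or_isCochamber hω' (hG.sub X hX) fun k _ => hG.ws X hX _ (hFG (l' k)) with
        h' | h'
      · exact Or.inl ⟨hX, h'⟩
      · exact Or.inr ((eF X hX).2 ⟨h, h'⟩)
    · rintro (⟨hX, h⟩ | h)
      · exact ⟨hX, mono h⟩
      · exact ⟨hFG h, (hD.1 (hFD h)).2.1⟩
  have i : #(G.filter (IsChamber n ω') ∩ F) = n + 1 := by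
    have : G.filter (IsChamber n ω') ∩ F =
        G.filter (IsChamber n ω') ∩ G.filter (IsCochamber n ω') := by
      ext X
      simp only [mem_inter, mem_filter]
      constructor
      · rintro ⟨⟨hX, h⟩, h'⟩
        exact ⟨⟨hX, h⟩, hX, ((eF X hX).1 h').2⟩
      · rintro ⟨⟨hX, h⟩, -, h'⟩
        exact ⟨⟨hX, h⟩, (eF X hX).2 ⟨mono h, h'⟩⟩
    rw [this]
    exact card_chamber_inter hω' hG.sub (fun k _ => hFG (l' k)) (fun X hX => by simp [hX])
      (fun X hX => by simp [hX]) (filter_subset _ _)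
  have := card_union_add_card_inter (G.filter (IsChamber n ω')) F
  rw [← e] at this
  omega

end Rank

/-- for permutations `ω′, ω` of `[n]` with `Inv(ω′) ⊆ Inv(ω)`, the
domain `D(ω′,ω)` is w-pure, with w-rank `|Inv(ω)| − |Inv(ω′)| + n + 1`. -/
theorem chamber_domain2_w_pure (n : ℕ) (hn : 1 ≤ n) (ω' ω : ℕ → ℕ)
    (hω' : Set.BijOn ω' (Set.Icc 1 n) (Set.Icc 1 n))
    (hω : Set.BijOn ω (Set.Icc 1 n) (Set.Icc 1 n))
    (hInv : InvPairs n ω' ⊆ InvPairs n ω) :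
    WPure (ChamberDomain2 n ω' ω) ∧
    ∀ F : Finset (Finset ℕ), IsMaxWColl (ChamberDomain2 n ω' ω) F →
      F.card = (InvPairs n ω).card - (InvPairs n ω').card + n + 1 := by
  have key : ∀ F : Finset (Finset ℕ), IsMaxWColl (ChamberDomain2 n ω' ω) F →
      #F = #(InvPairs n ω) - #(InvPairs n ω') + n + 1 := by
    intro F hF
    have := card_of_isMaxWColl hω' hω hInv hF
    have := card_le_card hInv
    omega
  exact ⟨fun F G hF hG => (key F hF).trans (key G hG).symm, key⟩
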